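/- arXiv:0801.1585 — 5 statements merged into one kernel-verified Lean document; each statement's English description precedes it below -/
import Mathlib

section
/- Let R = ℂ[A₁, A₂, B₁, B₂, C₁, C₂, D₁, D₂] with the standard grading, set u := A₁C₂ − A₂C₁ and v := B₁D₂ − B₂D₁, and let I ⊆ R be the ideal generated by the eight F-term quadrics of phase I of F₀: C₂v, C₁v, A₁v, A₂v, B₁u, B₂u, D₁u, D₂u. Then the Hilbert series of R/I satisfies (Σ_{n≥0} h(n) tⁿ)·(1−t)⁶ = 1 + 2t + 3t² − 4t³ + 2t⁴; i.e. H(t; F♭_{(F₀)_I}) = (1 + 2t + 3t² − 4t³ + 2t⁴)/(1−t)⁶. In particular the full master space of phase I of F₀ has dimension 6 and degree 4. -/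
open MvPolynomial

namespace F0PhaseIHilbert

-- R = ℂ[A₁, A₂, B₁, B₂, C₁, C₂, D₁, D₂], standard grading (all weights 1)
noncomputable def A₁ : MvPolynomial (Fin 8) ℂ := X 0
noncomputable def A₂ : MvPolynomial (Fin 8) ℂ := X 1
noncomputable def B₁ : MvPolynomial (Fin 8) ℂ := X 2
noncomputable def B₂ : MvPolynomial (Fin 8) ℂ := X 3
noncomputable def C₁ : MvPolynomial (Fin 8) ℂ := X 4
noncomputable def C₂ : MvPolynomial (Fin 8) ℂ := X 5
noncomputable def D₁ : MvPolynomial (Fin 8) ℂ := X 6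
noncomputable def D₂ : MvPolynomial (Fin 8) ℂ := X 7

/-- `u = A₁C₂ − A₂C₁`. -/
noncomputable def u : MvPolynomial (Fin 8) ℂ := A₁ * C₂ - A₂ * C₁
/-- `v = B₁D₂ − B₂D₁`. -/
noncomputable def v : MvPolynomial (Fin 8) ℂ := B₁ * D₂ - B₂ * D₁

/-- The ideal generated by the eight F-term quadrics of phase I of `F₀`. -/
noncomputable def I : Ideal (MvPolynomial (Fin 8) ℂ) :=
  Ideal.span {C₂ * v, C₁ * v, A₁ * v, A₂ * v, B₁ * u, B₂ * u, D₁ * u, D₂ * u}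

/-- The Hilbert function of `R/I` with the standard grading:
`h(n) = dim_ℂ R_n/(I ∩ R_n)`. -/
noncomputable def h (n : ℕ) : ℕ :=
  Module.finrank ℂ
    ((homogeneousSubmodule (Fin 8) ℂ n).map (Ideal.Quotient.mkₐ ℂ I).toLinearMap)

section Helpers

attribute [local instance] MvPolynomial.gradedAlgebra

/-- Degree-`n` piece of an ideal. -/
noncomputable def piece {N : ℕ} (J : Ideal (MvPolynomial (Fin N) ℂ)) (n : ℕ) :
    Submodule ℂ (MvPolynomial (Fin N) ℂ) :=
  J.restrictScalars ℂ ⊓ homogeneousSubmodule (Fin N) ℂ n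

/-- Hilbert series of an ideal. -/
noncomputable def HS {N : ℕ} (J : Ideal (MvPolynomial (Fin N) ℂ)) : PowerSeries ℤ :=
  PowerSeries.mk fun n => (Module.finrank ℂ (piece J n) : ℤ)

lemma mem_piece {N : ℕ} {J : Ideal (MvPolynomial (Fin N) ℂ)} {n : ℕ}
    {f : MvPolynomial (Fin N) ℂ} :
    f ∈ piece J n ↔ f ∈ J ∧ f.IsHomogeneous n := Iff.rfl

instance finite_homog (N n : ℕ) :
    Module.Finite ℂ (homogeneousSubmodule (Fin N) ℂ n) :=
  Module.Finite.iff_fg.mpr (homogeneousSubmodule_fg (Fin N) ℂ n)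

instance finite_piece {N : ℕ} (J : Ideal (MvPolynomial (Fin N) ℂ)) (n : ℕ) :
    Module.Finite ℂ (piece J n) :=
  Submodule.finiteDimensional_of_le (S₂ := homogeneousSubmodule (Fin N) ℂ n) inf_le_right

lemma finrank_homog (d n : ℕ) :
    Module.finrank ℂ (homogeneousSubmodule (Fin (d + 1)) ℂ n) = Nat.choose (d + n) d := by
  rw [homogeneousSubmodule_eq_finsupp_supported]
  have e : (AddMonoidAlgebra.supported ℂ ℂ {x : Fin (d + 1) →₀ ℕ | x.degree = n}) ≃ₗ[ℂ]
      ({x : Fin (d + 1) →₀ ℕ | x.degree = n} →₀ ℂ) :=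
    AddMonoidAlgebra.supportedEquivFinsupp _
  rw [e.finrank_eq]
  have hset : {x : Fin (d + 1) →₀ ℕ | x.degree = n}
      = ((Finset.univ : Finset (Fin (d + 1))).finsuppAntidiag n : Set _) := by
    ext x
    simp [Finsupp.degree_eq_sum]
  rw [hset, Module.finrank_finsupp_self]
  simp only [Finset.coe_sort_coe, Fintype.card_coe]
  rw [Finset.card_finsuppAntidiag_nat_eq_choose]
  simp only [Finset.card_univ, Fintype.card_fin]
  rw [show d + 1 + n - 1 = d + n by omega, Nat.choose_symm_add]

lemma piece_top (N n : ℕ) :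
    piece (⊤ : Ideal (MvPolynomial (Fin N) ℂ)) n = homogeneousSubmodule (Fin N) ℂ n := by
  ext f
  simp [mem_piece]

lemma HS_top (d : ℕ) :
    HS (⊤ : Ideal (MvPolynomial (Fin (d + 1)) ℂ)) * (1 - PowerSeries.X) ^ (d + 1) = 1 := by
  have h1 : HS (⊤ : Ideal (MvPolynomial (Fin (d + 1)) ℂ))
      = PowerSeries.mk fun n => (Nat.choose (d + n) d : ℤ) := by
    ext n
    simp only [HS, PowerSeries.coeff_mk]
    rw [piece_top, finrank_homog]
  rw [h1]
  exact PowerSeries.mk_add_choose_mul_one_sub_pow_eq_one ℤ d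

lemma sup_piece {N : ℕ} {J K : Ideal (MvPolynomial (Fin N) ℂ)}
    (hJ : J.IsHomogeneous (homogeneousSubmodule (Fin N) ℂ))
    (hK : K.IsHomogeneous (homogeneousSubmodule (Fin N) ℂ)) (n : ℕ) :
    piece (J ⊔ K) n = piece J n ⊔ piece K n := by
  apply le_antisymm
  · intro f hf
    rw [mem_piece] at hf
    obtain ⟨hf, hn⟩ := hf
    obtain ⟨a, ha, b, hb, rfl⟩ := Submodule.mem_sup.mp hf
    rw [← homogeneousComponent_eq_self hn, map_add]
    exact Submodule.add_mem_sup
      ⟨homogeneousComponent_mem_of_mem hJ ha n, homogeneousComponent_isHomogeneous n a⟩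
      ⟨homogeneousComponent_mem_of_mem hK hb n, homogeneousComponent_isHomogeneous n b⟩
  · refine sup_le ?_ ?_
    · exact fun f hf => ⟨(le_sup_left : J ≤ J ⊔ K) hf.1, hf.2⟩
    · exact fun f hf => ⟨(le_sup_right : K ≤ J ⊔ K) hf.1, hf.2⟩

lemma HS_sup {N : ℕ} {J K : Ideal (MvPolynomial (Fin N) ℂ)}
    (hJ : J.IsHomogeneous (homogeneousSubmodule (Fin N) ℂ))
    (hK : K.IsHomogeneous (homogeneousSubmodule (Fin N) ℂ)) :
    HS (J ⊔ K) + HS (J ⊓ K) = HS J + HS K := by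
  ext n
  simp only [HS, PowerSeries.coeff_mk, map_add]
  rw [sup_piece hJ hK]
  have h1 : piece (J ⊓ K) n = piece J n ⊓ piece K n := by
    ext f
    simp only [mem_piece, Submodule.mem_inf]
    tauto
  rw [h1]
  exact_mod_cast Submodule.finrank_sup_add_finrank_inf_eq (piece J n) (piece K n)

lemma decomp_eq {N : ℕ} (f : MvPolynomial (Fin N) ℂ) (n : ℕ) :
    (DirectSum.decompose (homogeneousSubmodule (Fin N) ℂ) f n : MvPolynomial (Fin N) ℂ)
      = homogeneousComponent n f :=
  decomposition.decompose'_apply f n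

lemma comp_mul {N : ℕ} {f a : MvPolynomial (Fin N) ℂ} {d : ℕ} (hf : f.IsHomogeneous d)
    {n : ℕ} (h : d ≤ n) :
    homogeneousComponent n (f * a) = f * homogeneousComponent (n - d) a := by
  have := DirectSum.coe_decompose_mul_of_left_mem_of_le (homogeneousSubmodule (Fin N) ℂ)
    (a := f) (b := a) hf h
  simpa only [decomp_eq] using this

lemma comp_mul_zero {N : ℕ} {f a : MvPolynomial (Fin N) ℂ} {d : ℕ} (hf : f.IsHomogeneous d)
    {n : ℕ} (h : ¬ d ≤ n) :
    homogeneousComponent n (f * a) = 0 := by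
  have := DirectSum.coe_decompose_mul_of_left_mem_of_not_le (homogeneousSubmodule (Fin N) ℂ)
    (a := f) (b := a) hf h
  simpa only [decomp_eq] using this

lemma HS_mul {N : ℕ} {f : MvPolynomial (Fin N) ℂ} {d : ℕ} (hf : f.IsHomogeneous d)
    (hf0 : f ≠ 0) {J : Ideal (MvPolynomial (Fin N) ℂ)}
    (hJ : J.IsHomogeneous (homogeneousSubmodule (Fin N) ℂ)) :
    HS (Ideal.span {f} * J) = PowerSeries.X ^ d * HS J := by
  ext n
  rw [PowerSeries.coeff_X_pow_mul']
  split_ifs with hd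
  · simp only [HS, PowerSeries.coeff_mk]
    have h1 : piece (Ideal.span {f} * J) n
        = (piece J (n - d)).map (LinearMap.mulLeft ℂ f) := by
      ext g
      simp only [mem_piece, Submodule.mem_map, Ideal.mem_span_singleton_mul,
        LinearMap.mulLeft_apply]
      constructor
      · rintro ⟨⟨a, ha, rfl⟩, hn⟩
        refine ⟨homogeneousComponent (n - d) a,
          ⟨homogeneousComponent_mem_of_mem hJ ha _, homogeneousComponent_isHomogeneous _ a⟩, ?_⟩
        rw [← comp_mul hf hd, homogeneousComponent_eq_self hn]
      · rintro ⟨a, ⟨ha, hn⟩, rfl⟩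
        refine ⟨⟨a, ha, rfl⟩, ?_⟩
        have := hf.mul hn
        rwa [Nat.add_sub_cancel' hd] at this
    have hinj : Function.Injective (LinearMap.mulLeft ℂ f) := fun a b hab =>
      mul_left_cancel₀ hf0 hab
    rw [h1, ← (Submodule.equivMapOfInjective _ hinj (piece J (n - d))).finrank_eq]
  · simp only [HS, PowerSeries.coeff_mk]
    have h1 : piece (Ideal.span {f} * J) n = ⊥ := by
      rw [eq_bot_iff]
      rintro g ⟨hg, hn⟩
      obtain ⟨a, ha, rfl⟩ := Ideal.mem_span_singleton_mul.mp hg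
      rw [Submodule.mem_bot, ← homogeneousComponent_eq_self hn, comp_mul_zero hf hd]
    rw [h1]
    simp

lemma rank_nullity {N : ℕ} (J : Ideal (MvPolynomial (Fin N) ℂ)) {W : Type*} [AddCommGroup W]
    [Module ℂ W] (φ : MvPolynomial (Fin N) ℂ →ₗ[ℂ] W) (hφ : ∀ f, φ f = 0 ↔ f ∈ J) (n : ℕ) :
    Module.finrank ℂ ((homogeneousSubmodule (Fin N) ℂ n).map φ)
      + Module.finrank ℂ (piece J n) = Module.finrank ℂ (piece (⊤ : Ideal (MvPolynomial (Fin N) ℂ)) n) := by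
  have hk : piece J n
      = (LinearMap.ker (φ.domRestrict (homogeneousSubmodule (Fin N) ℂ n))).map
        (homogeneousSubmodule (Fin N) ℂ n).subtype := by
    ext f
    simp only [mem_piece, Submodule.mem_map, LinearMap.mem_ker, LinearMap.domRestrict_apply, hφ]
    constructor
    · rintro ⟨h1, h2⟩
      exact ⟨⟨f, h2⟩, h1, rfl⟩
    · rintro ⟨g, h1, rfl⟩
      exact ⟨h1, g.2⟩
  rw [piece_top, hk, Submodule.finrank_map_subtype_eq,
    ← LinearMap.finrank_range_add_finrank_ker (φ.domRestrict (homogeneousSubmodule (Fin N) ℂ n)),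
    LinearMap.range_domRestrict]

/-- Ideal generated by the variables outside the range of `e`. -/
noncomputable def varIdeal (e : Fin 4 → Fin 8) : Ideal (MvPolynomial (Fin 8) ℂ) :=
  Ideal.span (X '' (Set.range e)ᶜ)

lemma varIdeal_homog (e : Fin 4 → Fin 8) :
    (varIdeal e).IsHomogeneous (homogeneousSubmodule (Fin 8) ℂ) := by
  apply Ideal.homogeneous_span
  rintro _ ⟨i, -, rfl⟩
  exact ⟨1, isHomogeneous_X ℂ i⟩

lemma killCompl_X_notMem {e : Fin 4 → Fin 8} (he : Function.Injective e) {i : Fin 8}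
    (hi : i ∉ Set.range e) : killCompl he (X i : MvPolynomial (Fin 8) ℂ) = 0 := by
  simp only [killCompl, aeval_X]
  rw [dif_neg hi]

lemma ker_killCompl {e : Fin 4 → Fin 8} (he : Function.Injective e)
    (f : MvPolynomial (Fin 8) ℂ) : killCompl he f = 0 ↔ f ∈ varIdeal e := by
  constructor
  · intro hf
    have key : ((Ideal.Quotient.mkₐ ℂ (varIdeal e)).comp (rename e)).comp (killCompl he)
        = Ideal.Quotient.mkₐ ℂ (varIdeal e) := by
      apply MvPolynomial.algHom_ext
      intro i
      by_cases hi : i ∈ Set.range e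
      · obtain ⟨j, rfl⟩ := hi
        have := killCompl_rename_app he (X j : MvPolynomial (Fin 4) ℂ)
        rw [rename_X] at this
        simp [this]
      · simp only [AlgHom.comp_apply, killCompl_X_notMem he hi, map_zero]
        symm
        rw [Ideal.Quotient.mkₐ_eq_mk, Ideal.Quotient.eq_zero_iff_mem]
        exact Ideal.subset_span ⟨i, hi, rfl⟩
    have := AlgHom.congr_fun key f
    rw [AlgHom.comp_apply, hf, map_zero] at this
    exact Ideal.Quotient.eq_zero_iff_mem.mp this.symm
  · intro hf
    have : varIdeal e ≤ RingHom.ker (killCompl he : MvPolynomial (Fin 8) ℂ →ₐ[ℂ] _) := by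
      rw [varIdeal, Ideal.span_le]
      rintro _ ⟨i, hi, rfl⟩
      exact killCompl_X_notMem he hi
    exact this hf

lemma killCompl_homog {e : Fin 4 → Fin 8} (he : Function.Injective e) (n : ℕ) :
    (homogeneousSubmodule (Fin 8) ℂ n).map (killCompl he).toLinearMap
      = homogeneousSubmodule (Fin 4) ℂ n := by
  apply le_antisymm
  · rintro _ ⟨f, hf, rfl⟩
    have := IsHomogeneous.aeval (n := 1) (m := n) (φ := f) hf (fun i =>
      killCompl he (X i : MvPolynomial (Fin 8) ℂ)) (fun i => by
        by_cases hi : i ∈ Set.range e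
        · obtain ⟨j, rfl⟩ := hi
          have := killCompl_rename_app he (X j : MvPolynomial (Fin 4) ℂ)
          rw [rename_X] at this
          rw [this]
          exact isHomogeneous_X ℂ j
        · rw [killCompl_X_notMem he hi]
          exact isHomogeneous_zero _ _ _)
    rw [one_mul] at this
    rwa [← comp_aeval_apply, aeval_X_left_apply] at this
  · intro f hf
    exact ⟨rename e f, hf.rename_isHomogeneous, killCompl_rename_app he f⟩

lemma HS_varIdeal {e : Fin 4 → Fin 8} (he : Function.Injective e) :
    HS (⊤ : Ideal (MvPolynomial (Fin 4) ℂ)) + HS (varIdeal e)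
      = HS (⊤ : Ideal (MvPolynomial (Fin 8) ℂ)) := by
  ext n
  simp only [HS, PowerSeries.coeff_mk, map_add]
  have := rank_nullity (varIdeal e) (killCompl he).toLinearMap (ker_killCompl he) n
  rw [killCompl_homog] at this
  rw [← this, piece_top]
  push_cast
  rfl

lemma HS_I (J : Ideal (MvPolynomial (Fin 8) ℂ)) :
    (PowerSeries.mk fun n => (Module.finrank ℂ
    ((homogeneousSubmodule (Fin 8) ℂ n).map (Ideal.Quotient.mkₐ ℂ J).toLinearMap) : ℤ))
     + HS J = HS (⊤ : Ideal (MvPolynomial (Fin 8) ℂ)) := by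
  ext n
  simp only [HS, PowerSeries.coeff_mk, map_add]
  exact_mod_cast rank_nullity J (Ideal.Quotient.mkₐ ℂ J).toLinearMap
    (fun f => Ideal.Quotient.eq_zero_iff_mem) n

/-- positions of `B₁,B₂,D₁,D₂`. -/
def eq4 : Fin 4 → Fin 8 := ![2, 3, 6, 7]
/-- positions of `A₁,A₂,C₁,C₂`. -/
def ep4 : Fin 4 → Fin 8 := ![0, 1, 4, 5]

lemma eq4_inj : Function.Injective eq4 := by decide
lemma ep4_inj : Function.Injective ep4 := by decide

lemma varIdeal_eq4 : varIdeal eq4 = Ideal.span {A₁, A₂, C₁, C₂} := by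
  have : (Set.range eq4)ᶜ = {0, 1, 4, 5} := by
    ext i; revert i; simp [eq4]; decide
  rw [varIdeal, this]
  simp [Set.image_insert_eq, A₁, A₂, C₁, C₂]

lemma varIdeal_ep4 : varIdeal ep4 = Ideal.span {B₁, B₂, D₁, D₂} := by
  have : (Set.range ep4)ᶜ = {2, 3, 6, 7} := by
    ext i; revert i; simp [ep4]; decide
  rw [varIdeal, this]
  simp [Set.image_insert_eq, B₁, B₂, D₁, D₂]

lemma u_homog : u.IsHomogeneous 2 :=
  ((isHomogeneous_X ℂ _).mul (isHomogeneous_X ℂ _)).sub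
    ((isHomogeneous_X ℂ _).mul (isHomogeneous_X ℂ _))

lemma v_homog : v.IsHomogeneous 2 :=
  ((isHomogeneous_X ℂ _).mul (isHomogeneous_X ℂ _)).sub
    ((isHomogeneous_X ℂ _).mul (isHomogeneous_X ℂ _))

lemma u_ne : u ≠ 0 := by
  intro h
  have := congrArg (eval ![1, 0, 0, 0, 0, 1, 0, 0]) h
  simp [u, A₁, A₂, C₁, C₂] at this

lemma v_ne : v ≠ 0 := by
  intro h
  have := congrArg (eval ![0, 0, 1, 0, 0, 0, 0, 1]) h
  simp [v, B₁, B₂, D₁, D₂] at this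

lemma span_split {S : Type*} [CommRing S] (a b c d a₂ b₂ c₂ d₂ x y : S) :
    Ideal.span {d * x, c * x, a * x, b * x, a₂ * y, b₂ * y, c₂ * y, d₂ * y}
      = Ideal.span {x} * Ideal.span {a, b, c, d} ⊔ Ideal.span {y} * Ideal.span {a₂, b₂, c₂, d₂} := by
  rw [Ideal.span_mul_span', Ideal.span_mul_span', ← Ideal.span_union]
  congr 1
  simp only [Set.singleton_mul, Set.image_insert_eq, Set.image_singleton]
  simp only [mul_comm x, mul_comm y]
  ext z
  simp only [Set.mem_insert_iff, Set.mem_singleton_iff, Set.mem_union]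
  constructor
  · rintro (h | h | h | h | h | h | h | h) <;> simp [h]
  · rintro ((h | h | h | h) | (h | h | h | h)) <;> simp [h]

lemma I_eq : I = Ideal.span {v} * varIdeal eq4 ⊔ Ideal.span {u} * varIdeal ep4 := by
  rw [varIdeal_eq4, varIdeal_ep4]
  exact span_split A₁ A₂ C₁ C₂ B₁ B₂ D₁ D₂ v u

lemma u_mem : u ∈ varIdeal eq4 := by
  rw [varIdeal_eq4, u]
  exact Ideal.sub_mem _ (Ideal.mul_mem_right _ _ (Ideal.subset_span (by simp)))
    (Ideal.mul_mem_right _ _ (Ideal.subset_span (by simp)))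

lemma v_mem : v ∈ varIdeal ep4 := by
  rw [varIdeal_ep4, v]
  exact Ideal.sub_mem _ (Ideal.mul_mem_right _ _ (Ideal.subset_span (by simp)))
    (Ideal.mul_mem_right _ _ (Ideal.subset_span (by simp)))

lemma vars_sub4 (a b c d : Fin 8) :
    (X a * X b - X c * X d : MvPolynomial (Fin 8) ℂ).vars ⊆ {a, b, c, d} := by
  intro i hi
  have h1 := vars_sub_subset _ hi
  rw [Finset.mem_union] at h1
  rcases h1 with h1 | h1
  · have := vars_mul _ _ h1
    simp only [vars_X, Finset.mem_union, Finset.mem_singleton] at this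
    simp only [Finset.mem_insert, Finset.mem_singleton]
    tauto
  · have := vars_mul _ _ h1
    simp only [vars_X, Finset.mem_union, Finset.mem_singleton] at this
    simp only [Finset.mem_insert, Finset.mem_singleton]
    tauto

lemma vars_of_dvd {d f : MvPolynomial (Fin 8) ℂ} (hf : f ≠ 0) (h : d ∣ f) :
    d.vars ⊆ f.vars := by
  obtain ⟨g, rfl⟩ := h
  intro i hi
  have hd := left_ne_zero_of_mul hf
  have hg := right_ne_zero_of_mul hf
  rw [mem_vars_iff_degreeOf_ne_zero] at hi ⊢
  rw [degreeOf_mul_eq hd hg]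
  omega

lemma relPrime : IsRelPrime u v := by
  intro d hu hv
  have h1 := (vars_of_dvd u_ne hu).trans (vars_sub4 0 5 1 4)
  have h2 := (vars_of_dvd v_ne hv).trans (vars_sub4 2 7 3 6)
  have h3 : d.vars = ∅ := by
    rw [Finset.eq_empty_iff_forall_notMem]
    intro i hi
    have := Finset.mem_inter.mpr ⟨h1 hi, h2 hi⟩
    clear hi
    revert this
    revert i
    decide
  rw [vars_eq_empty_iff_eq_C] at h3
  have h4 : d ≠ 0 := by
    rintro rfl
    exact u_ne (zero_dvd_iff.mp hu)
  rw [h3] at h4 ⊢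
  rw [Ne, C_eq_zero] at h4
  exact (IsUnit.mk0 _ h4).map C

lemma inf_eq : Ideal.span {v} * varIdeal eq4 ⊓ Ideal.span {u} * varIdeal ep4
    = Ideal.span {u * v} * ⊤ := by
  apply le_antisymm
  · rintro f ⟨h1, h2⟩
    obtain ⟨a, ha, rfl⟩ := Ideal.mem_span_singleton_mul.mp h1
    obtain ⟨b, hb, hab⟩ := Ideal.mem_span_singleton_mul.mp h2
    obtain ⟨k, rfl⟩ : u ∣ a := relPrime.dvd_of_dvd_mul_left ⟨b, hab.symm⟩
    exact Ideal.mem_span_singleton_mul.mpr ⟨k, trivial, by ring⟩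
  · intro f hf
    obtain ⟨k, -, rfl⟩ := Ideal.mem_span_singleton_mul.mp hf
    exact ⟨Ideal.mem_span_singleton_mul.mpr ⟨u * k, Ideal.mul_mem_right _ _ u_mem, by ring⟩,
      Ideal.mem_span_singleton_mul.mpr ⟨v * k, Ideal.mul_mem_right _ _ v_mem, by ring⟩⟩

lemma span_homog {f : MvPolynomial (Fin 8) ℂ} {d : ℕ} (hf : f.IsHomogeneous d) :
    (Ideal.span {f}).IsHomogeneous (homogeneousSubmodule (Fin 8) ℂ) := by
  apply Ideal.homogeneous_span
  rintro _ rfl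
  exact ⟨d, hf⟩

lemma main_series :
    (PowerSeries.mk fun n => (h n : ℤ)) * (1 - PowerSeries.X) ^ 6
      = 1 + 2 * PowerSeries.X + 3 * PowerSeries.X ^ 2
        - 4 * PowerSeries.X ^ 3 + 2 * PowerSeries.X ^ 4 := by
  have e1 := HS_I I
  have e2 := HS_sup ((span_homog v_homog).mul (varIdeal_homog eq4))
    ((span_homog u_homog).mul (varIdeal_homog ep4))
  rw [← I_eq, inf_eq, HS_mul v_homog v_ne (varIdeal_homog _),
    HS_mul u_homog u_ne (varIdeal_homog _),
    HS_mul (u_homog.mul v_homog) (mul_ne_zero u_ne v_ne) (Ideal.IsHomogeneous.top _)] at e2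
  have e3 := HS_varIdeal eq4_inj
  have e4 := HS_varIdeal ep4_inj
  have e5 := HS_top 7
  have e6 := HS_top 3
  change (PowerSeries.mk fun n => (h n : ℤ)) + _ = _ at e1
  have hne : (1 - PowerSeries.X : PowerSeries ℤ) ^ 2 ≠ 0 := by
    apply pow_ne_zero
    intro h0
    have := congrArg PowerSeries.constantCoeff h0
    simp at this
  apply mul_right_cancel₀ hne
  simp only [Nat.reduceAdd] at e2 e3 e4 e5 e6
  generalize (PowerSeries.mk fun n => (h n : ℤ)) = H at *
  generalize HS I = HI at *
  generalize HS (varIdeal eq4) = P at *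
  generalize HS (varIdeal ep4) = Q at *
  generalize HS (⊤ : Ideal (MvPolynomial (Fin 8) ℂ)) = T8 at *
  generalize HS (⊤ : Ideal (MvPolynomial (Fin 4) ℂ)) = T4 at *
  generalize (PowerSeries.X : PowerSeries ℤ) = t at *
  linear_combination (1 - t) ^ 8 * (e1 - e2 - t ^ 2 * (e3 + e4)) + (1 - 2 * t ^ 2 + t ^ 4) * e5
    + 2 * t ^ 2 * (1 - t) ^ 4 * e6

end Helpers

/-- The Hilbert series of the full master space of phase I of `F₀`
satisfies `H(t)·(1−t)⁶ = 1 + 2t + 3t² − 4t³ + 2t⁴`, i.e.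
`H(t; F♭_{(F₀)_I}) = (1 + 2t + 3t² − 4t³ + 2t⁴)/(1−t)⁶`. -/
theorem hilbert_series_F0_phaseI :
    (PowerSeries.mk fun n => (h n : ℤ)) * (1 - PowerSeries.X) ^ 6
      = 1 + 2 * PowerSeries.X + 3 * PowerSeries.X ^ 2
        - 4 * PowerSeries.X ^ 3 + 2 * PowerSeries.X ^ 4 := by
  exact main_series

end F0PhaseIHilbert
end

section
/- Let R = ℂ[X₁₁, X₁₂, X₂₁, X₁₃, X₃₁, X₂₃, X₃₂] graded by assigning weight 2 to X₁₁ and weight 1 to all other variables, and let I ⊆ R be the ideal generated by the seven F-term polynomials of the SPP quiver theory: X₁₂X₂₁ − X₁₃X₃₁, X₂₁(X₁₁ − X₂₃X₃₂), X₁₂(X₁₁ − X₂₃X₃₂), X₃₁(X₃₂X₂₃ − X₁₁), X₁₃(X₃₂X₂₃ − X₁₁), X₂₃(X₃₁X₁₃ − X₂₁X₁₂), X₃₂(X₃₁X₁₃ − X₂₁X₁₂). Then the Hilbert series of R/I (with respect to this weighted grading) satisfies (Σ_{n≥0} h(n) tⁿ)·(1−t)⁴(1−t²) = 1 + 2t +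 2t² − 2t³ + t⁴; i.e. H(t; F♭_{SPP}) = (1 + 2t + 2t² − 2t³ + t⁴)/((1−t)⁴(1−t²)). -/
open MvPolynomial

namespace SPPHilbert

-- R = ℂ[X₁₁, X₁₂, X₂₁, X₁₃, X₃₁, X₂₃, X₃₂]
noncomputable def X₁₁ : MvPolynomial (Fin 7) ℂ := X 0
noncomputable def X₁₂ : MvPolynomial (Fin 7) ℂ := X 1
noncomputable def X₂₁ : MvPolynomial (Fin 7) ℂ := X 2
noncomputable def X₁₃ : MvPolynomial (Fin 7) ℂ := X 3
noncomputable def X₃₁ : MvPolynomial (Fin 7) ℂ := X 4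
noncomputable def X₂₃ : MvPolynomial (Fin 7) ℂ := X 5
noncomputable def X₃₂ : MvPolynomial (Fin 7) ℂ := X 6

/-- The grading: weight 2 for `X₁₁`, weight 1 for all other variables. -/
def w : Fin 7 → ℕ := fun i => if i = 0 then 2 else 1

/-- The ideal generated by the seven F-term polynomials of the SPP quiver theory. -/
noncomputable def I : Ideal (MvPolynomial (Fin 7) ℂ) :=
  Ideal.span
    {X₁₂ * X₂₁ - X₁₃ * X₃₁,
      X₂₁ * (X₁₁ - X₂₃ * X₃₂), X₁₂ * (X₁₁ - X₂₃ * X₃₂),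
      X₃₁ * (X₃₂ * X₂₃ - X₁₁), X₁₃ * (X₃₂ * X₂₃ - X₁₁),
      X₂₃ * (X₃₁ * X₁₃ - X₂₁ * X₁₂), X₃₂ * (X₃₁ * X₁₃ - X₂₁ * X₁₂)}

/-- The Hilbert function of `R/I` with respect to the weighted grading `w`:
`h(n) = dim_ℂ R_n/(I ∩ R_n)` where `R_n` is the weighted-degree-`n` piece. -/
noncomputable def h (n : ℕ) : ℕ :=
  Module.finrank ℂ
    ((weightedHomogeneousSubmodule ℂ w n).map (Ideal.Quotient.mkₐ ℂ I).toLinearMap)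

/-! ### Normal forms of monomials -/

/-- The normal form of a monomial exponent modulo the binomial ideal `I`. -/
noncomputable def nf (m : Fin 7 →₀ ℕ) : Fin 7 →₀ ℕ :=
  if m 1 + m 2 + m 3 + m 4 = 0 then m
  else Finsupp.equivFunOnFinite.symm
    ![0, m 1 - m 2, m 2 - m 1, m 3 + min (m 1) (m 2), m 4 + min (m 1) (m 2),
      m 5 + m 0, m 6 + m 0]

/-- Standard monomials. -/
def Std (m : Fin 7 →₀ ℕ) : Prop :=
  (m 0 = 0 ∨ m 1 + m 2 + m 3 + m 4 = 0) ∧ (m 1 = 0 ∨ m 2 = 0)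

/-- The weight of an exponent. -/
def wt (m : Fin 7 →₀ ℕ) : ℕ := 2 * m 0 + m 1 + m 2 + m 3 + m 4 + m 5 + m 6

lemma weight_eq (m : Fin 7 →₀ ℕ) : Finsupp.weight w m = wt m := by
  rw [Finsupp.weight_apply, Finsupp.sum_fintype _ _ (by simp)]
  simp [Fin.sum_univ_seven, w, wt, mul_comm]

lemma nf_std (m : Fin 7 →₀ ℕ) : Std (nf m) := by
  unfold nf Std
  split_ifs with h0
  · omega
  · simp
    omega

lemma nf_of_std (m : Fin 7 →₀ ℕ) (hm : Std m) : nf m = m := by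
  unfold nf
  unfold Std at hm
  split_ifs with h0
  · rfl
  · ext i
    fin_cases i <;> simp <;> omega

lemma wt_nf (m : Fin 7 →₀ ℕ) : wt (nf m) = wt m := by
  unfold nf wt
  split_ifs with h0
  · rfl
  · simp
    omega

/-- Normal form as a linear map. -/
noncomputable def N : MvPolynomial (Fin 7) ℂ →ₗ[ℂ] MvPolynomial (Fin 7) ℂ :=
  (basisMonomials (Fin 7) ℂ).constr ℂ (fun m => monomial (nf m) (1 : ℂ))

lemma N_monomial (m : Fin 7 →₀ ℕ) : N (monomial m 1) = monomial (nf m) 1 := by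
  have := (basisMonomials (Fin 7) ℂ).constr_basis ℂ (fun m => monomial (nf m) (1 : ℂ)) m
  simpa [N] using this

lemma N_mul_binomial (p q : Fin 7 →₀ ℕ) (hpq : ∀ m, nf (m + p) = nf (m + q))
    (r : MvPolynomial (Fin 7) ℂ) : N (r * (monomial p 1 - monomial q 1)) = 0 := by
  have : N ∘ₗ LinearMap.mulRight ℂ (monomial p (1 : ℂ) - monomial q 1) = 0 := by
    refine (basisMonomials (Fin 7) ℂ).ext fun m => ?_
    simp [mul_sub, monomial_mul, N_monomial, hpq]
  exact LinearMap.congr_fun this r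

lemma nf_congr (m m' : Fin 7 →₀ ℕ) (h1 : m 1 + m 2 + m 3 + m 4 ≠ 0)
    (h2 : m' 1 + m' 2 + m' 3 + m' 4 ≠ 0) (e1 : m 1 - m 2 = m' 1 - m' 2)
    (e2 : m 2 - m 1 = m' 2 - m' 1) (e3 : m 3 + min (m 1) (m 2) = m' 3 + min (m' 1) (m' 2))
    (e4 : m 4 + min (m 1) (m 2) = m' 4 + min (m' 1) (m' 2))
    (e5 : m 5 + m 0 = m' 5 + m' 0) (e6 : m 6 + m 0 = m' 6 + m' 0) : nf m = nf m' := by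
  unfold nf
  rw [if_neg h1, if_neg h2, e1, e2, e3, e4, e5, e6]

lemma N_I (p : MvPolynomial (Fin 7) ℂ) (hp : p ∈ I) : N p = 0 := by
  suffices ∀ r, N (r * p) = 0 by simpa using this 1
  unfold I at hp
  induction hp using Submodule.span_induction with
  | zero => simp
  | add x y _ _ hx hy => intro r; rw [mul_add, map_add, hx, hy, add_zero]
  | smul a x _ hx => intro r; rw [smul_eq_mul, ← mul_assoc]; exact hx _
  | mem x hx =>
    intro r
    simp only [Set.mem_insert_iff, Set.mem_singleton_iff, X₁₁, X₁₂, X₂₁, X₁₃, X₃₁, X₂₃, X₃₂,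
      mul_sub, X, monomial_mul, mul_one] at hx
    rcases hx with rfl | rfl | rfl | rfl | rfl | rfl | rfl <;>
    · refine N_mul_binomial _ _ (fun m => ?_) r
      apply nf_congr <;> simp <;> omega

lemma mul_pow_eq {Q : Type*} [CommRing Q] {y a z : Q} (hy : y * a = y * z) (k : ℕ) :
    y * a ^ k = y * z ^ k := by
  induction k with
  | zero => simp
  | succ k ih =>
    rw [pow_succ, ← mul_assoc, ih, mul_right_comm, hy, pow_succ]; ring

lemma rel_pow {Q : Type*} [CommRing Q] {y a z t : Q} (hy : y * a = y * z) (k n : ℕ) (hn : n ≠ 0) :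
    y ^ n * a ^ k * t = y ^ n * z ^ k * t := by
  obtain ⟨n, rfl⟩ := Nat.exists_eq_succ_of_ne_zero hn
  have := mul_pow_eq hy k
  rw [pow_succ, mul_assoc (y ^ n), this]; ring

lemma bc_pow {Q : Type*} [CommRing Q] {b c d e : Q} (hy : b * c = d * e) (m n : ℕ) :
    b ^ m * c ^ n = b ^ (m - n) * c ^ (n - m) * (d ^ min m n * e ^ min m n) := by
  rw [← mul_pow, ← hy, mul_pow]
  rcases le_total m n with h1 | h1
  · obtain ⟨k, rfl⟩ := Nat.exists_eq_add_of_le h1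
    simp; ring
  · obtain ⟨k, rfl⟩ := Nat.exists_eq_add_of_le h1
    simp; ring

lemma monomial_eq7 (m : Fin 7 →₀ ℕ) : (monomial m (1 : ℂ)) =
    X 0 ^ m 0 * X 1 ^ m 1 * X 2 ^ m 2 * X 3 ^ m 3 * X 4 ^ m 4 * X 5 ^ m 5 * X 6 ^ m 6 := by
  rw [monomial_eq, Finsupp.prod_fintype _ _ (by simp)]
  simp [Fin.prod_univ_seven]

lemma mk_rel {p q : MvPolynomial (Fin 7) ℂ} (hpq : p - q ∈ I) :
    Ideal.Quotient.mk I p = Ideal.Quotient.mk I q := Ideal.Quotient.eq.mpr hpq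

lemma mk_nf (m : Fin 7 →₀ ℕ) : Ideal.Quotient.mk I (monomial m 1)
    = Ideal.Quotient.mk I (monomial (nf m) 1) := by
  by_cases h0 : m 1 + m 2 + m 3 + m 4 = 0
  · rw [nf, if_pos h0]
  have hbc : Ideal.Quotient.mk I (X 1 * X 2) = Ideal.Quotient.mk I (X 3 * X 4) :=
    mk_rel (Ideal.subset_span (by simp [X₁₂, X₂₁, X₁₃, X₃₁]))
  have hc : Ideal.Quotient.mk I (X 2 * X 0) = Ideal.Quotient.mk I (X 2 * (X 5 * X 6)) :=
    mk_rel (Ideal.subset_span (by simp [X₁₁, X₁₂, X₂₁, X₁₃, X₃₁, X₂₃, X₃₂, mul_sub]))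
  have hb : Ideal.Quotient.mk I (X 1 * X 0) = Ideal.Quotient.mk I (X 1 * (X 5 * X 6)) :=
    mk_rel (Ideal.subset_span (by simp [X₁₁, X₁₂, X₂₁, X₁₃, X₃₁, X₂₃, X₃₂, mul_sub]))
  have he : Ideal.Quotient.mk I (X 4 * X 0) = Ideal.Quotient.mk I (X 4 * (X 5 * X 6)) :=
    (mk_rel (Ideal.subset_span (by
      simp [X₁₁, X₁₂, X₂₁, X₁₃, X₃₁, X₂₃, X₃₂, mul_sub, mul_comm (X 6 : MvPolynomial (Fin 7) ℂ) (X 5)]))).symm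
  have hd : Ideal.Quotient.mk I (X 3 * X 0) = Ideal.Quotient.mk I (X 3 * (X 5 * X 6)) :=
    (mk_rel (Ideal.subset_span (by
      simp [X₁₁, X₁₂, X₂₁, X₁₃, X₃₁, X₂₃, X₃₂, mul_sub, mul_comm (X 6 : MvPolynomial (Fin 7) ℂ) (X 5)]))).symm
  rw [monomial_eq7, monomial_eq7, nf, if_neg h0]
  simp only [map_mul, map_pow] at hbc hb hc hd he ⊢
  simp
  generalize Ideal.Quotient.mk I (X 0) = a at *
  generalize Ideal.Quotient.mk I (X 1) = b at *
  generalize Ideal.Quotient.mk I (X 2) = c at *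
  generalize Ideal.Quotient.mk I (X 3) = d at *
  generalize Ideal.Quotient.mk I (X 4) = e at *
  generalize Ideal.Quotient.mk I (X 5) = f at *
  generalize Ideal.Quotient.mk I (X 6) = g at *
  generalize m 0 = m0 at *
  generalize m 1 = m1 at *
  generalize m 2 = m2 at *
  generalize m 3 = m3 at *
  generalize m 4 = m4 at *
  generalize m 5 = m5 at *
  generalize m 6 = m6 at *
  have key : a ^ m0 * b ^ m1 * c ^ m2 * d ^ m3 * e ^ m4
      = (f * g) ^ m0 * b ^ m1 * c ^ m2 * d ^ m3 * e ^ m4 := by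
    by_cases h1 : m1 = 0
    · by_cases h2 : m2 = 0
      · by_cases h3 : m3 = 0
        · have h4 : m4 ≠ 0 := by omega
          linear_combination rel_pow (t := b ^ m1 * c ^ m2 * d ^ m3) he m0 m4 h4
        · linear_combination rel_pow (t := b ^ m1 * c ^ m2 * e ^ m4) hd m0 m3 h3
      · linear_combination rel_pow (t := b ^ m1 * d ^ m3 * e ^ m4) hc m0 m2 h2
    · linear_combination rel_pow (t := c ^ m2 * d ^ m3 * e ^ m4) hb m0 m1 h1
  have key2 := bc_pow hbc m1 m2
  rw [key]
  linear_combination (f * g) ^ m0 * d ^ m3 * e ^ m4 * f ^ m5 * g ^ m6 * key2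

/-- Standard monomials of weight `n`. -/
abbrev StdN (n : ℕ) := {m : {m : Fin 7 →₀ ℕ // Std m} // wt m.1 = n}

lemma h_eq (n : ℕ) [Finite (StdN n)] : h n = Nat.card (StdN n) := by
  classical
  have := Fintype.ofFinite (StdN n)
  let b : StdN n → (MvPolynomial (Fin 7) ℂ ⧸ I) := fun s => Ideal.Quotient.mkₐ ℂ I (monomial s.1.1 1)
  have hb : LinearIndependent ℂ b := by
    let Nb : (MvPolynomial (Fin 7) ℂ ⧸ I) →ₗ[ℂ] MvPolynomial (Fin 7) ℂ :=
      (Submodule.restrictScalars ℂ I).liftQ N (fun p hp => N_I p hp)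
    refine LinearIndependent.of_comp Nb ?_
    have : Nb ∘ b = (basisMonomials (Fin 7) ℂ) ∘ (fun s : StdN n => s.1.1) := by
      funext s
      have h1 : Nb (b s) = N (monomial s.1.1 1) := rfl
      simp [h1, N_monomial, nf_of_std _ s.1.2]
    rw [this]
    exact (basisMonomials (Fin 7) ℂ).linearIndependent.comp _
      (Subtype.val_injective.comp Subtype.val_injective)
  have hspan : (weightedHomogeneousSubmodule ℂ w n).map (Ideal.Quotient.mkₐ ℂ I).toLinearMap
      = Submodule.span ℂ (Set.range b) := by
    apply le_antisymm
    · rintro _ ⟨p, hp, rfl⟩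
      rw [p.as_sum, map_sum]
      refine Submodule.sum_mem _ fun m hm => ?_
      have hw : wt m = n := by
        rw [← weight_eq]
        exact hp (mem_support_iff.mp hm)
      have : monomial m (coeff m p) = coeff m p • monomial m (1 : ℂ) := by simp [smul_monomial]
      rw [this, map_smul]
      refine Submodule.smul_mem _ _ (Submodule.subset_span ?_)
      exact ⟨⟨⟨nf m, nf_std m⟩, (wt_nf m).trans hw⟩, (mk_nf m).symm⟩
    · rw [Submodule.span_le]
      rintro _ ⟨s, rfl⟩
      refine ⟨_, ?_, rfl⟩
      refine isWeightedHomogeneous_monomial w _ _ ?_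
      rw [weight_eq]; exact s.2
  rw [h, hspan, finrank_span_eq_card hb, Nat.card_eq_fintype_card]

/-! ### Counting -/

/-- Generating function of a weighted type. -/
noncomputable def gf {α : Type} (f : α → ℕ) : PowerSeries ℤ :=
  PowerSeries.mk fun n => (Nat.card {a // f a = n} : ℤ)

/-- Finite fibres. -/
def FF {α : Type} (f : α → ℕ) : Prop := ∀ n, Finite {a // f a = n}

lemma gf_equiv {α β : Type} {f : α → ℕ} {g : β → ℕ} (e : α ≃ β) (he : ∀ a, g (e a) = f a) :
    gf f = gf g := by
  ext n
  simp only [gf, PowerSeries.coeff_mk]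
  rw [Nat.card_congr (e.subtypeEquiv (p := fun a => f a = n) (q := fun b => g b = n)
    (fun a => by rw [he]))]

lemma FF_equiv {α β : Type} {f : α → ℕ} {g : β → ℕ} (e : α ≃ β) (he : ∀ a, g (e a) = f a)
    (hg : FF g) : FF f := fun n => by
  have := hg n
  exact Finite.of_equiv _ (e.subtypeEquiv (p := fun a => f a = n) (q := fun b => g b = n)
    (fun a => by rw [he])).symm

lemma FF_equiv' {α β : Type} {f : α → ℕ} {g : β → ℕ} (e : α ≃ β) (he : ∀ a, g (e a) = f a)
    (hf : FF f) : FF g :=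
  FF_equiv e.symm (fun b => by rw [← he, e.apply_symm_apply]) hf

/-- The fibre of a sum type. -/
def sumFib {α β : Type} (f : α → ℕ) (g : β → ℕ) (n : ℕ) :
    {a // Sum.elim f g a = n} ≃ {a // f a = n} ⊕ {b // g b = n} :=
  Equiv.subtypeSum

lemma FF_sum {α β : Type} {f : α → ℕ} {g : β → ℕ} (hf : FF f) (hg : FF g) :
    FF (Sum.elim f g) := fun n => by
  have := hf n
  have := hg n
  exact Finite.of_equiv _ (sumFib f g n).symm

lemma gf_sum {α β : Type} {f : α → ℕ} {g : β → ℕ} (hf : FF f) (hg : FF g) :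
    gf (Sum.elim f g) = gf f + gf g := by
  ext n
  have := hf n
  have := hg n
  simp only [gf, PowerSeries.coeff_mk, map_add]
  rw [Nat.card_congr (sumFib f g n), Nat.card_sum]
  push_cast; rfl

/-- Add a variable of weight `d`. -/
def ext {α : Type} (f : α → ℕ) (d : ℕ) : α × ℕ → ℕ := fun x => f x.1 + d * x.2

lemma FF_ext {α : Type} {f : α → ℕ} (hf : FF f) (d : ℕ) (hd : 0 < d) : FF (ext f d) := fun n => by
  have : ∀ k : Fin (n + 1), Finite {a // f a = k} := fun k => hf k
  refine Finite.of_injective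
    (β := (Σ k : Fin (n + 1), {a // f a = k}) × Fin (n + 1))
    (fun x => (⟨⟨f x.1.1, ?_⟩, ⟨x.1.1, rfl⟩⟩, ⟨x.1.2, ?_⟩)) ?_
  · have := x.2
    simp only [ext] at this
    omega
  · have := x.2
    simp only [ext] at this
    nlinarith
  · rintro ⟨⟨a, k⟩, hx⟩ ⟨⟨b, l⟩, hy⟩ hxy
    simp only [Prod.mk.injEq, Fin.mk.injEq] at hxy
    obtain ⟨h1, h2⟩ := hxy
    have h3 := congrArg (fun z : (Σ k : Fin (n + 1), {a // f a = k}) => z.2.1) h1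
    simp only at h3
    simp [h2, h3]

lemma gf_shift {α : Type} (f : α → ℕ) (d : ℕ) :
    gf (fun a => f a + d) = gf f * PowerSeries.X ^ d := by
  ext n
  rw [PowerSeries.coeff_mul_X_pow']
  simp only [gf, PowerSeries.coeff_mk]
  split_ifs with hd
  · rw [Nat.card_congr (Equiv.subtypeEquivRight (p := fun a => f a + d = n)
      (q := fun a => f a = n - d) (fun a => by omega))]
  · have : IsEmpty {a // f a + d = n} := ⟨fun a => by have := a.2; omega⟩
    simp

/-- Split off the exponent zero. -/
def splitNat (α : Type) : α × ℕ ≃ α ⊕ (α × ℕ) where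
  toFun x := match x with
    | (a, 0) => Sum.inl a
    | (a, k + 1) => Sum.inr (a, k)
  invFun x := match x with
    | Sum.inl a => (a, 0)
    | Sum.inr (a, k) => (a, k + 1)
  left_inv := by rintro ⟨a, _ | k⟩ <;> rfl
  right_inv := by rintro (a | ⟨a, k⟩) <;> rfl

lemma FF_shift {α : Type} {f : α → ℕ} (hf : FF f) (d : ℕ) : FF (fun a => f a + d) := fun n => by
  have := hf (n - d)
  exact Finite.of_injective (β := {a // f a = n - d})
    (fun x => ⟨x.1, by have : f x.1 + d = n := x.2; omega⟩)
    (fun x y hxy => by simpa [Subtype.ext_iff] using hxy)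

lemma gf_ext {α : Type} {f : α → ℕ} (hf : FF f) (d : ℕ) (hd : 0 < d) :
    gf (ext f d) * (1 - PowerSeries.X ^ d) = gf f := by
  have h1 : gf (ext f d) = gf (Sum.elim f (fun x => ext f d x + d)) := by
    refine gf_equiv (splitNat α) ?_
    rintro ⟨a, _ | k⟩ <;> simp [splitNat, ext]
    ring
  rw [gf_sum hf (FF_shift (FF_ext hf d hd) d), gf_shift] at h1
  linear_combination h1

/-- The trivial weighted type. -/
def pt : Unit → ℕ := fun _ => 0

lemma FF_pt : FF pt := fun _ => inferInstance

lemma gf_pt : gf pt = 1 := by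
  ext n
  simp only [gf, PowerSeries.coeff_mk, PowerSeries.coeff_one, pt]
  split_ifs with hn
  · subst hn; simp
  · have : IsEmpty {a : Unit // 0 = n} := ⟨fun a => hn a.2.symm⟩
    simp

/-- weight function with variables of weights 2, 1, 1 -/
def wA : ((Unit × ℕ) × ℕ) × ℕ → ℕ := ext (ext (ext pt 2) 1) 1

/-- weight function with five variables of weight 1 -/
def wB : ((((Unit × ℕ) × ℕ) × ℕ) × ℕ) × ℕ → ℕ := ext (ext (ext (ext (ext pt 1) 1) 1) 1) 1

lemma FF_wA : FF wA :=
  FF_ext (FF_ext (FF_ext FF_pt 2 (by simp)) 1 (by simp)) 1 (by simp)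

lemma FF_wB : FF wB :=
  FF_ext (FF_ext (FF_ext (FF_ext (FF_ext FF_pt 1 (by simp)) 1 (by simp)) 1 (by simp)) 1
    (by simp)) 1 (by simp)

lemma gf_wA : gf wA * (1 - PowerSeries.X ^ 2) * (1 - PowerSeries.X) ^ 2 = 1 := by
  have h0 := FF_pt
  have h1 := FF_ext h0 2 (by simp)
  have h2 := FF_ext h1 1 (by simp)
  have e0 := gf_ext h0 2 (by simp)
  have e1 := gf_ext h1 1 (by simp)
  have e2 := gf_ext h2 1 (by simp)
  rw [gf_pt] at e0
  rw [pow_one] at e1 e2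
  rw [wA]
  linear_combination e0 + (1 - PowerSeries.X ^ 2) * e1
    + (1 - PowerSeries.X ^ 2) * (1 - PowerSeries.X) * e2

lemma gf_wB : gf wB * (1 - PowerSeries.X) ^ 5 = 1 := by
  have h0 := FF_pt
  have h1 := FF_ext h0 1 (by simp)
  have h2 := FF_ext h1 1 (by simp)
  have h3 := FF_ext h2 1 (by simp)
  have h4 := FF_ext h3 1 (by simp)
  have e0 := gf_ext h0 1 (by simp)
  have e1 := gf_ext h1 1 (by simp)
  have e2 := gf_ext h2 1 (by simp)
  have e3 := gf_ext h3 1 (by simp)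
  have e4 := gf_ext h4 1 (by simp)
  rw [gf_pt] at e0
  rw [pow_one] at e0 e1 e2 e3 e4
  rw [wB]
  linear_combination e0 + (1 - PowerSeries.X) * e1 + (1 - PowerSeries.X) ^ 2 * e2
    + (1 - PowerSeries.X) ^ 3 * e3 + (1 - PowerSeries.X) ^ 4 * e4

/-- Exponent vector from a list of values. -/
noncomputable def vec (v : Fin 7 → ℕ) : Fin 7 →₀ ℕ := Finsupp.equivFunOnFinite.symm v

/-- The weight of the three families of standard monomials. -/
def wT : (((Unit × ℕ) × ℕ) × ℕ) ⊕ ((((((Unit × ℕ) × ℕ) × ℕ) × ℕ) × ℕ) ⊕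
    (((((Unit × ℕ) × ℕ) × ℕ) × ℕ) × ℕ)) → ℕ :=
  Sum.elim (fun x => wA x + 2) (Sum.elim wB (fun x => wB x + 1))

/-- The standard monomials fall into three families. -/
noncomputable def stdMap : (((Unit × ℕ) × ℕ) × ℕ) ⊕ ((((((Unit × ℕ) × ℕ) × ℕ) × ℕ) × ℕ) ⊕
    (((((Unit × ℕ) × ℕ) × ℕ) × ℕ) × ℕ)) → {m : Fin 7 →₀ ℕ // Std m}
  | Sum.inl ⟨⟨⟨_, k⟩, i⟩, j⟩ => ⟨vec ![k + 1, 0, 0, 0, 0, i, j], by simp [Std, vec]⟩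
  | Sum.inr (Sum.inl ⟨⟨⟨⟨⟨_, c⟩, d⟩, e⟩, i⟩, j⟩) =>
      ⟨vec ![0, 0, c, d, e, i, j], by simp [Std, vec]⟩
  | Sum.inr (Sum.inr ⟨⟨⟨⟨⟨_, b⟩, d⟩, e⟩, i⟩, j⟩) =>
      ⟨vec ![0, b + 1, 0, d, e, i, j], by simp [Std, vec]⟩

lemma vec_inj {u v : Fin 7 → ℕ} : vec u = vec v ↔ u = v := by simp [vec]

lemma stdMap_bij : Function.Bijective stdMap := by
  constructor
  · rintro (⟨⟨⟨_, k⟩, i⟩, j⟩ | ⟨⟨⟨⟨⟨_, c⟩, d⟩, e⟩, i⟩, j⟩ | ⟨⟨⟨⟨⟨_, b⟩, d⟩, e⟩, i⟩, j⟩)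
      (⟨⟨⟨_, k'⟩, i'⟩, j'⟩ | ⟨⟨⟨⟨⟨_, c'⟩, d'⟩, e'⟩, i'⟩, j'⟩ | ⟨⟨⟨⟨⟨_, b'⟩, d'⟩, e'⟩, i'⟩, j'⟩) hxy <;>
    (replace hxy := congrArg Subtype.val hxy
     simp only [stdMap, vec_inj] at hxy
     simp at hxy
     try simp [hxy])
  · rintro ⟨m, hm⟩
    have hm' := hm
    unfold Std at hm
    by_cases h0 : m 0 = 0
    · by_cases h1 : m 1 = 0
      · refine ⟨Sum.inr (Sum.inl ⟨⟨⟨⟨⟨(), m 2⟩, m 3⟩, m 4⟩, m 5⟩, m 6⟩), Subtype.ext ?_⟩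
        ext i
        fin_cases i <;> simp [stdMap, vec] <;> omega
      · refine ⟨Sum.inr (Sum.inr ⟨⟨⟨⟨⟨(), m 1 - 1⟩, m 3⟩, m 4⟩, m 5⟩, m 6⟩), Subtype.ext ?_⟩
        ext i
        fin_cases i <;> simp [stdMap, vec] <;> omega
    · refine ⟨Sum.inl ⟨⟨⟨(), m 0 - 1⟩, m 5⟩, m 6⟩, Subtype.ext ?_⟩
      ext i
      fin_cases i <;> simp [stdMap, vec] <;> omega

lemma wt_stdMap (x) : wt (stdMap x).1 = wT x := by
  rcases x with (⟨⟨⟨_, k⟩, i⟩, j⟩ | ⟨⟨⟨⟨⟨_, c⟩, d⟩, e⟩, i⟩, j⟩ | ⟨⟨⟨⟨⟨_, b⟩, d⟩, e⟩, i⟩, j⟩) <;>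
  simp [wT, stdMap, vec, wt, wA, wB, ext, pt] <;> ring

lemma FF_wT : FF wT :=
  FF_sum (FF_shift FF_wA 2) (FF_sum FF_wB (FF_shift FF_wB 1))

lemma FF_std : FF (fun m : {m : Fin 7 →₀ ℕ // Std m} => wt m.1) :=
  FF_equiv' (Equiv.ofBijective stdMap stdMap_bij) (fun a => wt_stdMap a) FF_wT

lemma gf_std : gf (fun m : {m : Fin 7 →₀ ℕ // Std m} => wt m.1)
    = gf wA * PowerSeries.X ^ 2 + (gf wB + gf wB * PowerSeries.X) := by
  have h1 : gf wT = gf (fun m : {m : Fin 7 →₀ ℕ // Std m} => wt m.1) :=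
    gf_equiv (Equiv.ofBijective stdMap stdMap_bij) (fun a => wt_stdMap a)
  have h2 := gf_sum (FF_shift FF_wA 2) (FF_sum FF_wB (FF_shift FF_wB 1))
  have h3 := gf_sum FF_wB (FF_shift FF_wB 1)
  have h4 := gf_shift wA 2
  have h5 := gf_shift wB 1
  rw [pow_one] at h5
  rw [← h1, ← h4, ← h5, ← h3, ← h2]
  rfl

/-- The Hilbert series of the master space of SPP satisfies
`H(t)·(1−t)⁴(1−t²) = 1 + 2t + 2t² − 2t³ + t⁴`, i.e.
`H(t; F♭_{SPP}) = (1 + 2t + 2t² − 2t³ + t⁴)/((1−t)⁴(1−t²))`. -/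
theorem hilbert_series_SPP :
    (PowerSeries.mk fun n => (h n : ℤ))
        * (1 - PowerSeries.X) ^ 4 * (1 - PowerSeries.X ^ 2)
      = 1 + 2 * PowerSeries.X + 2 * PowerSeries.X ^ 2
        - 2 * PowerSeries.X ^ 3 + PowerSeries.X ^ 4 := by
  have hH : (PowerSeries.mk fun n => (h n : ℤ))
      = gf (fun m : {m : Fin 7 →₀ ℕ // Std m} => wt m.1) := by
    ext n
    have : Finite (StdN n) := FF_std n
    simp only [gf, PowerSeries.coeff_mk, h_eq]
  rw [hH, gf_std]
  have hA := gf_wA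
  have hB := gf_wB
  linear_combination PowerSeries.X ^ 2 * (1 - PowerSeries.X) ^ 2 * hA
    + (1 + PowerSeries.X) ^ 2 * hB

end SPPHilbert
end

section
/- Let R = ℂ[X_{ij}, Y_{ij}, Z_{ij} : (i,j) ∈ ℤ/2 × ℤ/2] be a polynomial ring in 12 variables with the standard grading, let W = Σ_{(i,j) ∈ ℤ/2×ℤ/2} (X_{i,j} Y_{i+1,j} Z_{i+1,j+1} − Y_{i,j} X_{i,j+1} Z_{i+1,j+1}) be the superpotential of the ℂ³/(ℤ₂×ℤ₂) quiver gauge theory (indices modulo 2), and let I ⊆ R be the ideal generated by the 12 partial derivatives of W. Then the Hilbert series of R/I satisfies (Σ_{n≥0} h(n) tⁿ)·(1−t)⁶ = 1 + 6t + 9t² − 5t³ + 3t⁴; i.e. H(t; F♭_{ℂ³/ℤ₂×ℤ₂}) = (1 + 6t + 9t² − 5t³ + 3t⁴)/(1−t)⁶. In particular the master space has dimension 6 and degree 14. -/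
open MvPolynomial

namespace C3Z2Z2Hilbert

/-- The superpotential of the `ℂ³/(ℤ₂×ℤ₂)` quiver gauge theory, in the polynomial
ring in the 12 variables `X_{i,j}, Y_{i,j}, Z_{i,j}` (indexed by
`Fin 3 × ℤ/2 × ℤ/2`, where the `Fin 3` component `0,1,2` selects `X,Y,Z`):
`W = Σ_{(i,j)} (X_{i,j} Y_{i+1,j} Z_{i+1,j+1} − Y_{i,j} X_{i,j+1} Z_{i+1,j+1})`,
indices modulo 2. -/
noncomputable def W : MvPolynomial (Fin 3 × ZMod 2 × ZMod 2) ℂ :=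
  ∑ i : ZMod 2, ∑ j : ZMod 2,
    (X (0, i, j) * X (1, (i + 1, j)) * X (2, (i + 1, j + 1))
      - X (1, (i, j)) * X (0, (i, j + 1)) * X (2, (i + 1, j + 1)))

/-- The ideal generated by the 12 partial derivatives of `W`. -/
noncomputable def I : Ideal (MvPolynomial (Fin 3 × ZMod 2 × ZMod 2) ℂ) :=
  Ideal.span (Set.range fun v => pderiv v W)

/-- The Hilbert function of `R/I` with the standard grading:
`h(n) = dim_ℂ R_n/(I ∩ R_n)`. -/
noncomputable def h (n : ℕ) : ℕ :=
  Module.finrank ℂ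
    ((homogeneousSubmodule (Fin 3 × ZMod 2 × ZMod 2) ℂ n).map
      (Ideal.Quotient.mkₐ ℂ I).toLinearMap)

set_option linter.unusedSimpArgs false


/-- If a map `inv` on monomials is a complete invariant for congruence modulo an ideal `J`, then the
graded pieces of the quotient are counted by the values of `inv`. -/
theorem finrank_of_invariant {σ T : Type*} (J : Ideal (MvPolynomial σ ℂ)) (inv : (σ →₀ ℕ) → T)
    (hrep : ∀ m m', inv m = inv m' → monomial m (1 : ℂ) - monomial m' 1 ∈ J)
    (hker : ∀ f ∈ J, (basisMonomials σ ℂ).constr ℂ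
      (fun m => (Finsupp.single (inv m) 1 : T →₀ ℂ)) f = 0) (n : ℕ) (F : Finset T)
    (hF : ∀ t, t ∈ F ↔ ∃ m : σ →₀ ℕ, m.degree = n ∧ inv m = t) :
    Module.finrank ℂ ((homogeneousSubmodule σ ℂ n).map
      (Ideal.Quotient.mkₐ ℂ J).toLinearMap) = F.card := by
  classical
  set L := (basisMonomials σ ℂ).constr ℂ (fun m => (Finsupp.single (inv m) 1 : T →₀ ℂ)) with hL
  have hLm : ∀ m, L (monomial m 1) = Finsupp.single (inv m) 1 := by
    intro m
    have := (basisMonomials σ ℂ).constr_basis ℂ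
      (fun m => (Finsupp.single (inv m) 1 : T →₀ ℂ)) m
    simpa [hL] using this
  set π := (Ideal.Quotient.mkₐ ℂ J).toLinearMap with hπ
  -- the section
  let rep : T → (σ →₀ ℕ) := Function.invFun inv
  have hrepinv : ∀ m, inv (rep (inv m)) = inv m := fun m => Function.invFun_eq ⟨m, rfl⟩
  let K : (T →₀ ℂ) →ₗ[ℂ] (MvPolynomial σ ℂ ⧸ J) :=
    Finsupp.linearCombination ℂ (fun t => π (monomial (rep t) 1))
  have hKL : K ∘ₗ L = π := by
    apply (basisMonomials σ ℂ).ext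
    intro m
    simp only [coe_basisMonomials, LinearMap.comp_apply, hLm, K, Finsupp.linearCombination_single,
      one_smul]
    simp only [hπ, AlgHom.toLinearMap_apply, Ideal.Quotient.mkₐ_eq_mk]
    exact Ideal.Quotient.eq.2 (hrep _ _ (hrepinv m))
  have hmono : homogeneousSubmodule σ ℂ n
      = Submodule.span ℂ ((fun m => monomial m (1 : ℂ)) '' {m | m.degree = n}) := by
    rw [homogeneousSubmodule_eq_finsupp_supported, AddMonoidAlgebra.supported_eq_span_single]
    rfl
  have hmapL : (homogeneousSubmodule σ ℂ n).map L
      = Submodule.span ℂ ((fun t => (Finsupp.single t 1 : T →₀ ℂ)) '' (F : Set T)) := by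
    rw [hmono, Submodule.map_span]
    congr 1
    ext x
    simp only [Set.mem_image, Set.mem_ofPred_eq, Finset.mem_coe, hF]
    constructor
    · rintro ⟨_, ⟨m, hm, rfl⟩, rfl⟩
      exact ⟨inv m, ⟨m, hm, rfl⟩, (hLm m).symm⟩
    · rintro ⟨_, ⟨m, hm, rfl⟩, rfl⟩
      exact ⟨_, ⟨m, hm, rfl⟩, hLm m⟩
  have hmapπ : (homogeneousSubmodule σ ℂ n).map π = ((homogeneousSubmodule σ ℂ n).map L).map K := by
    rw [← Submodule.map_comp, hKL]
  have hinj : Function.Injective (K.domRestrict ((homogeneousSubmodule σ ℂ n).map L)) := by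
    rw [injective_iff_map_eq_zero]
    rintro ⟨y, ⟨f, hf, rfl⟩⟩ h0
    have h1 : π f = 0 := by
      rw [← hKL]; exact h0
    have h2 : f ∈ J := by
      rw [hπ, AlgHom.toLinearMap_apply, Ideal.Quotient.mkₐ_eq_mk] at h1
      exact Ideal.Quotient.eq_zero_iff_mem.1 h1
    exact Subtype.ext (hker f h2)
  have hfr : Module.finrank ℂ ((homogeneousSubmodule σ ℂ n).map π)
      = Module.finrank ℂ ((homogeneousSubmodule σ ℂ n).map L) := by
    rw [hmapπ, ← LinearMap.finrank_range_of_inj hinj, LinearMap.range_domRestrict]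
  rw [hfr, hmapL]
  have hli : LinearIndependent ℂ (fun t : (F : Set T) => (Finsupp.single t.1 1 : T →₀ ℂ)) :=
    (Finsupp.linearIndependent_single_one ℂ T).comp _ Subtype.val_injective
  have := finrank_span_eq_card (R := ℂ) hli
  rw [Set.image_eq_range, this]
  simp

theorem z2 : ∀ i : ZMod 2, i = 0 ∨ i = 1 := by decide

theorem pderivX (i j : ZMod 2) : pderiv (0, i, j) W =
    X (1, i + 1, j) * X (2, i + 1, j + 1) - X (1, i, j + 1) * X (2, i + 1, j) := by
  have e : ∀ f : ZMod 2 → MvPolynomial (Fin 3 × ZMod 2 × ZMod 2) ℂ, ∑ i, f i = f 0 + f 1 :=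
    fun f => Fin.sum_univ_two f
  have h11 : (1 + 1 : ZMod 2) = 0 := by decide
  rcases z2 i with rfl | rfl <;>
  rcases z2 j with rfl | rfl <;>
  simp [W, e, pderiv_X, h11] <;> ring

theorem pderivY (i j : ZMod 2) : pderiv (1, i, j) W =
    X (0, i + 1, j) * X (2, i, j + 1) - X (0, i, j + 1) * X (2, i + 1, j + 1) := by
  have e : ∀ f : ZMod 2 → MvPolynomial (Fin 3 × ZMod 2 × ZMod 2) ℂ, ∑ i, f i = f 0 + f 1 :=
    fun f => Fin.sum_univ_two f
  have h11 : (1 + 1 : ZMod 2) = 0 := by decide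
  rcases z2 i with rfl | rfl <;>
  rcases z2 j with rfl | rfl <;>
  simp [W, e, pderiv_X, h11] <;> ring

theorem pderivZ (i j : ZMod 2) : pderiv (2, i, j) W =
    X (0, i + 1, j + 1) * X (1, i, j + 1) - X (0, i + 1, j) * X (1, i + 1, j + 1) := by
  have e : ∀ f : ZMod 2 → MvPolynomial (Fin 3 × ZMod 2 × ZMod 2) ℂ, ∑ i, f i = f 0 + f 1 :=
    fun f => Fin.sum_univ_two f
  have h11 : (1 + 1 : ZMod 2) = 0 := by decide
  rcases z2 i with rfl | rfl <;>
  rcases z2 j with rfl | rfl <;>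
  simp [W, e, pderiv_X, h11] <;> ring

/-- The three kinds of variables, labelled by their two toric charges. -/
def xv (p q : ZMod 2) : Fin 3 × ZMod 2 × ZMod 2 := (0, q, p + q)
/-- `Y` variables. -/
def yv (p r : ZMod 2) : Fin 3 × ZMod 2 × ZMod 2 := (1, p + r, r)
/-- `Z` variables. -/
def zv (q r : ZMod 2) : Fin 3 × ZMod 2 × ZMod 2 := (2, q, r)

/-- Class of a variable in the quotient. -/
noncomputable def cl (v : Fin 3 × ZMod 2 × ZMod 2) :
    MvPolynomial (Fin 3 × ZMod 2 × ZMod 2) ℂ ⧸ I := Ideal.Quotient.mk I (X v)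

theorem rel_p (p p' q r : ZMod 2) :
    cl (xv p q) * cl (yv p' r) = cl (xv p' q) * cl (yv p r) := by
  rcases eq_or_ne p p' with rfl | hne
  · rfl
  have hp : p' = p + 1 := by revert p p'; decide
  subst hp
  have hm : pderiv (2, q + 1, r + 1) W ∈ I := Ideal.subset_span ⟨_, rfl⟩
  rw [pderivZ] at hm
  have h1 := Ideal.Quotient.eq.2 hm
  simp only [map_mul] at h1
  simp only [cl, xv, yv]
  revert h1
  have h11 : (1 + 1 : ZMod 2) = 0 := by decide
  rcases z2 p with rfl | rfl <;>
  rcases z2 q with rfl | rfl <;>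
  rcases z2 r with rfl | rfl <;>
  simp only [h11, add_zero, zero_add] <;> intro h1 <;> 
  first | exact h1 | exact h1.symm

theorem rel_q (p q q' r : ZMod 2) :
    cl (xv p q) * cl (zv q' r) = cl (xv p q') * cl (zv q r) := by
  rcases eq_or_ne q q' with rfl | hne
  · rfl
  have hp : q' = q + 1 := by revert q q'; decide
  subst hp
  have hm : pderiv (1, p + r, r + 1) W ∈ I := Ideal.subset_span ⟨_, rfl⟩
  rw [pderivY] at hm
  have h1 := Ideal.Quotient.eq.2 hm
  simp only [map_mul] at h1
  simp only [cl, xv, zv]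
  revert h1
  have h11 : (1 + 1 : ZMod 2) = 0 := by decide
  rcases z2 p with rfl | rfl <;>
  rcases z2 q with rfl | rfl <;>
  rcases z2 r with rfl | rfl <;>
  simp only [h11, add_zero, zero_add] <;> intro h1 <;>
  first | exact h1 | exact h1.symm

theorem rel_r (p q r r' : ZMod 2) :
    cl (yv p r) * cl (zv q r') = cl (yv p r') * cl (zv q r) := by
  rcases eq_or_ne r r' with rfl | hne
  · rfl
  have hp : r' = r + 1 := by revert r r'; decide
  subst hp
  have hm : pderiv (0, q + 1, p + q) W ∈ I := Ideal.subset_span ⟨_, rfl⟩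
  rw [pderivX] at hm
  have h1 := Ideal.Quotient.eq.2 hm
  simp only [map_mul] at h1
  simp only [cl, yv, zv]
  revert h1
  have h11 : (1 + 1 : ZMod 2) = 0 := by decide
  rcases z2 p with rfl | rfl <;>
  rcases z2 q with rfl | rfl <;>
  rcases z2 r with rfl | rfl <;>
  simp only [h11, add_zero, zero_add] <;> intro h1 <;>
  first | exact h1 | exact h1.symm

section slots

variable {A : Type*} [CommMonoid A] {α β γ : Type*} [Fintype α] [Fintype β] [Fintype γ]

theorem two_swap [DecidableEq α] [DecidableEq β] {ι κ : Type*} (x : ZMod 2 → ι → A)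
    (y : ZMod 2 → κ → A)
    (hxy : ∀ p p' a b, x p a * y p' b = x p' a * y p b) (p : α ⊕ β → ZMod 2) (u : α → ι)
    (v : β → κ) (i : α) (j : β) :
    (∏ a, x (p (Equiv.swap (Sum.inl i) (Sum.inr j) (Sum.inl a))) (u a)) *
      (∏ b, y (p (Equiv.swap (Sum.inl i) (Sum.inr j) (Sum.inr b))) (v b))
      = (∏ a, x (p (Sum.inl a)) (u a)) * (∏ b, y (p (Sum.inr b)) (v b)) := by
  rw [← Finset.mul_prod_erase Finset.univ _ (Finset.mem_univ i),
    ← Finset.mul_prod_erase Finset.univ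
      (fun b => y (p (Equiv.swap (Sum.inl i) (Sum.inr j) (Sum.inr b))) (v b)) (Finset.mem_univ j),
    ← Finset.mul_prod_erase Finset.univ (fun a => x (p (Sum.inl a)) (u a)) (Finset.mem_univ i),
    ← Finset.mul_prod_erase Finset.univ (fun b => y (p (Sum.inr b)) (v b)) (Finset.mem_univ j)]
  have h1 : ∏ a ∈ Finset.univ.erase i,
      x (p (Equiv.swap (Sum.inl i) (Sum.inr j) (Sum.inl a))) (u a)
      = ∏ a ∈ Finset.univ.erase i, x (p (Sum.inl a)) (u a) := by
    refine Finset.prod_congr rfl fun a ha => ?_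
    rw [Equiv.swap_apply_of_ne_of_ne]
    · simpa using Finset.ne_of_mem_erase ha
    · simp
  have h2 : ∏ b ∈ Finset.univ.erase j,
      y (p (Equiv.swap (Sum.inl i) (Sum.inr j) (Sum.inr b))) (v b)
      = ∏ b ∈ Finset.univ.erase j, y (p (Sum.inr b)) (v b) := by
    refine Finset.prod_congr rfl fun a ha => ?_
    rw [Equiv.swap_apply_of_ne_of_ne]
    · simp
    · simpa using Finset.ne_of_mem_erase ha
  rw [h1, h2, Equiv.swap_apply_left, Equiv.swap_apply_right, mul_mul_mul_comm, hxy,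
    mul_mul_mul_comm]

theorem two_perm [Nonempty α] [Nonempty β] {ι κ : Type*} (x : ZMod 2 → ι → A)
    (y : ZMod 2 → κ → A)
    (hxy : ∀ p p' a b, x p a * y p' b = x p' a * y p b) (p : α ⊕ β → ZMod 2) (u : α → ι)
    (v : β → κ) (σ : Equiv.Perm (α ⊕ β)) :
    (∏ a, x (p (σ (Sum.inl a))) (u a)) * (∏ b, y (p (σ (Sum.inr b))) (v b))
      = (∏ a, x (p (Sum.inl a)) (u a)) * (∏ b, y (p (Sum.inr b)) (v b)) := by
  classical
  -- the set of permutations which preserve the product, for every `p`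
  let S : Subgroup (Equiv.Perm (α ⊕ β)) :=
    { carrier := {σ | ∀ p : α ⊕ β → ZMod 2,
        (∏ a, x (p (σ (Sum.inl a))) (u a)) * (∏ b, y (p (σ (Sum.inr b))) (v b))
          = (∏ a, x (p (Sum.inl a)) (u a)) * (∏ b, y (p (Sum.inr b)) (v b))}
      mul_mem' := by
        intro s t hs ht p
        exact (ht (fun c => p (s c))).trans (hs p)
      one_mem' := by
        intro p
        rfl
      inv_mem' := by
        intro s hs p
        have := hs (fun c => p (s⁻¹ c))
        simpa using this.symm }
  have hlr : ∀ i j, Equiv.swap (Sum.inl i : α ⊕ β) (Sum.inr j) ∈ S :=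
    fun i j p => two_swap x y hxy p u v i j
  have hsw : ∀ c d : α ⊕ β, c ≠ d → Equiv.swap c d ∈ S := by
    obtain ⟨i0⟩ := ‹Nonempty α›
    obtain ⟨j0⟩ := ‹Nonempty β›
    rintro (i | j) (i' | j') hne
    · rw [Equiv.swap_comm, ← Equiv.swap_mul_swap_mul_swap (x := (Sum.inl i : α ⊕ β))
        (y := Sum.inr j0) (z := Sum.inl i') (by simp) hne, Equiv.swap_comm (Sum.inr j0)]
      exact S.mul_mem (S.mul_mem (hlr i' j0) (hlr i j0)) (hlr i' j0)
    · exact hlr i j'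
    · rw [Equiv.swap_comm]; exact hlr i' j
    · rw [Equiv.swap_comm, ← Equiv.swap_mul_swap_mul_swap (x := (Sum.inr j : α ⊕ β))
        (y := Sum.inl i0) (z := Sum.inr j') (by simp) hne, Equiv.swap_comm (Sum.inr j)]
      exact S.mul_mem (S.mul_mem (hlr i0 j') (hlr i0 j)) (hlr i0 j')
  have : σ ∈ S := by
    refine Equiv.Perm.swap_induction_on σ (S.one_mem) ?_
    intro f c d hne hf
    exact S.mul_mem (hsw c d hne) hf
  exact this p

theorem exists_perm_of_sum_eq (f g : α → ZMod 2) (h : ∑ i, (f i).val = ∑ i, (g i).val) :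
    ∃ σ : Equiv.Perm α, ∀ i, g i = f (σ i) := by
  classical
  have hv : ∀ c : ZMod 2, c.val = if c = 1 then 1 else 0 := by decide
  simp only [hv, Finset.sum_boole, Nat.cast_id] at h
  have h0 : ∀ f : α → ZMod 2, (Finset.univ.filter fun i => f i = 0).card
      = Fintype.card α - (Finset.univ.filter fun i => f i = 1).card := by
    intro f
    have : (Finset.univ.filter fun i => f i = 0) = (Finset.univ.filter fun i => f i = 1)ᶜ := by
      ext i
      have : ∀ c : ZMod 2, c = 0 ↔ ¬ c = 1 := by decide
      simp [this (f i)]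
    rw [this, Finset.card_compl]
  have hc : ∀ c : ZMod 2, Nonempty ({i // g i = c} ≃ {i // f i = c}) := by
    intro c
    refine ⟨Fintype.equivOfCardEq ?_⟩
    rw [Fintype.card_subtype, Fintype.card_subtype]
    rcases z2 c with rfl | rfl
    · rw [h0, h0, h]
    · exact h.symm
  have e := fun c => (hc c).some
  refine ⟨Equiv.ofFiberEquiv e, fun i => ?_⟩
  exact (Equiv.ofFiberEquiv_map e i).symm

theorem two_count [Nonempty α] [Nonempty β] {ι κ : Type*} (x : ZMod 2 → ι → A)
    (y : ZMod 2 → κ → A)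
    (hxy : ∀ p p' a b, x p a * y p' b = x p' a * y p b) (p p' : α ⊕ β → ZMod 2) (u : α → ι)
    (v : β → κ) (h : ∑ i, (p i).val = ∑ i, (p' i).val) :
    (∏ a, x (p' (Sum.inl a)) (u a)) * (∏ b, y (p' (Sum.inr b)) (v b))
      = (∏ a, x (p (Sum.inl a)) (u a)) * (∏ b, y (p (Sum.inr b)) (v b)) := by
  obtain ⟨σ, hσ⟩ := exists_perm_of_sum_eq p p' h
  simp only [hσ]
  exact two_perm x y hxy p u v σ

theorem two_full [Nonempty α] [Nonempty β] (x y : ZMod 2 → ZMod 2 → A)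
    (hxy : ∀ p p' a b, x p a * y p' b = x p' a * y p b) (p p' : α ⊕ β → ZMod 2)
    (q q' : α → ZMod 2) (r r' : β → ZMod 2) (hp : ∑ i, (p i).val = ∑ i, (p' i).val)
    (hq : ∑ i, (q i).val = ∑ i, (q' i).val) (hr : ∑ i, (r i).val = ∑ i, (r' i).val) :
    (∏ a, x (p' (Sum.inl a)) (q' a)) * (∏ b, y (p' (Sum.inr b)) (r' b))
      = (∏ a, x (p (Sum.inl a)) (q a)) * (∏ b, y (p (Sum.inr b)) (r b)) := by
  obtain ⟨σ, hσ⟩ := exists_perm_of_sum_eq q q' hq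
  obtain ⟨τ, hτ⟩ := exists_perm_of_sum_eq r r' hr
  have h1 : (∏ a, x (p' (Sum.inl a)) (q' a)) = ∏ a, x (p' (Sum.inl (σ.symm a))) (q a) := by
    rw [← Equiv.prod_comp σ.symm]
    simp [hσ]
  have h2 : (∏ a, y (p' (Sum.inr a)) (r' a)) = ∏ a, y (p' (Sum.inr (τ.symm a))) (r a) := by
    rw [← Equiv.prod_comp τ.symm]
    simp [hτ]
  rw [h1, h2]
  refine two_count x y hxy p (fun c => p' ((Equiv.sumCongr σ.symm τ.symm) c)) q r ?_
  rw [hp, Equiv.sum_comp (Equiv.sumCongr σ.symm τ.symm) (fun c => (p' c).val)]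

/-- Full independence statement for the product of three families of letters. -/
theorem three_full (x y z : ZMod 2 → ZMod 2 → A)
    (hxy : ∀ p p' a b, x p a * y p' b = x p' a * y p b)
    (hxz : ∀ q q' a b, x a q * z q' b = x a q' * z q b)
    (hyz : ∀ r r' a b, y a r * z b r' = y a r' * z b r)
    (hne : (Nonempty α ∧ Nonempty β) ∨ (Nonempty α ∧ Nonempty γ) ∨ (Nonempty β ∧ Nonempty γ))
    (p p' : α ⊕ β → ZMod 2) (q q' : α ⊕ γ → ZMod 2) (r r' : β ⊕ γ → ZMod 2)
    (hp : ∑ i, (p i).val = ∑ i, (p' i).val)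
    (hq : ∑ i, (q i).val = ∑ i, (q' i).val) (hr : ∑ i, (r i).val = ∑ i, (r' i).val) :
    (∏ a, x (p' (Sum.inl a)) (q' (Sum.inl a))) * (∏ b, y (p' (Sum.inr b)) (r' (Sum.inl b)))
        * (∏ c, z (q' (Sum.inr c)) (r' (Sum.inr c)))
      = (∏ a, x (p (Sum.inl a)) (q (Sum.inl a))) * (∏ b, y (p (Sum.inr b)) (r (Sum.inl b)))
        * (∏ c, z (q (Sum.inr c)) (r (Sum.inr c))) := by
  rcases isEmpty_or_nonempty α with hα | hα
  · have hβ : Nonempty β := by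
      rcases hne with h | h | h
      exacts [h.2, (hα.false h.1.some).elim, h.1]
    have hγ : Nonempty γ := by
      rcases hne with h | h | h
      exacts [(hα.false h.1.some).elim, (hα.false h.1.some).elim, h.2]
    have := two_full (fun a b => y b a) (fun a b => z b a) (fun r r' a b => hyz r r' a b) r r'
      (fun b => p (Sum.inr b)) (fun b => p' (Sum.inr b))
      (fun c => q (Sum.inr c)) (fun c => q' (Sum.inr c)) hr (by simpa using hp) (by simpa using hq)
    simpa using this
  rcases isEmpty_or_nonempty β with hβ | hβ
  · have hγ : Nonempty γ := by
      rcases hne with h | h | h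
      exacts [(hβ.false h.2.some).elim, h.2, h.2]
    have := two_full (fun a b => x b a) z (fun r r' a b => hxz r r' a b) q q'
      (fun b => p (Sum.inl b)) (fun b => p' (Sum.inl b))
      (fun c => r (Sum.inr c)) (fun c => r' (Sum.inr c)) hq (by simpa using hp) (by simpa using hr)
    simpa using this
  rcases isEmpty_or_nonempty γ with hγ | hγ
  · have := two_full x y hxy p p'
      (fun b => q (Sum.inl b)) (fun b => q' (Sum.inl b))
      (fun c => r (Sum.inl c)) (fun c => r' (Sum.inl c)) hp (by simpa using hq) (by simpa using hr)
    simpa using this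
  have e1 := two_count x y hxy p p' (fun a => q' (Sum.inl a)) (fun b => r' (Sum.inl b)) hp
  have e2 := two_count (fun a b => x b a) z (fun r r' a b => hxz r r' a b) q q'
    (fun a => p (Sum.inl a)) (fun c => r' (Sum.inr c)) hq
  have e3 := two_count (fun a b => y b a) (fun a b => z b a) (fun r r' a b => hyz r r' a b) r r'
    (fun b => p (Sum.inr b)) (fun c => q (Sum.inr c)) hr
  beta_reduce at e1 e2 e3
  rw [e1, mul_right_comm, e2, mul_assoc, mul_comm (∏ c, z _ _), e3, mul_assoc]

theorem slots_exist (k : ZMod 2 → ZMod 2 → ℕ) (a : ℕ) (ha : ∑ c, ∑ d, k c d = a)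
    (x : ZMod 2 → ZMod 2 → A) :
    ∃ u v : Fin a → ZMod 2, (∏ i, x (u i) (v i) = ∏ c, ∏ d, x c d ^ k c d) ∧
      (∑ i, (u i).val = ∑ c, ∑ d, k c d * c.val) ∧
      (∑ i, (v i).val = ∑ c, ∑ d, k c d * d.val) := by
  have hcard : Fintype.card ((c : ZMod 2) × (d : ZMod 2) × Fin (k c d)) = a := by
    simp [Fintype.card_sigma, ha]
  let e := (Fintype.equivFinOfCardEq hcard).symm
  refine ⟨fun i => (e i).1, fun i => (e i).2.1, ?_, ?_, ?_⟩
  · rw [Equiv.prod_comp e (fun s => x s.1 s.2.1)]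
    simp [Fintype.prod_sigma]
  · rw [Equiv.sum_comp e (fun s => s.1.val)]
    simp [Fintype.sum_sigma, Finset.sum_mul]
  · rw [Equiv.sum_comp e (fun s => s.2.1.val)]
    simp [Fintype.sum_sigma]

end slots

theorem sum2 {M : Type*} [AddCommMonoid M] (f : ZMod 2 → M) : ∑ i, f i = f 0 + f 1 :=
  Fin.sum_univ_two f

theorem prod2 {M : Type*} [CommMonoid M] (f : ZMod 2 → M) : ∏ i, f i = f 0 * f 1 :=
  Fin.prod_univ_two f

/-- Number of `X` letters. -/
def cA (m : Fin 3 × ZMod 2 × ZMod 2 →₀ ℕ) : ℕ := ∑ c, ∑ d, m (xv c d)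
/-- Number of `Y` letters. -/
def cB (m : Fin 3 × ZMod 2 × ZMod 2 →₀ ℕ) : ℕ := ∑ c, ∑ d, m (yv c d)
/-- Number of `Z` letters. -/
def cC (m : Fin 3 × ZMod 2 × ZMod 2 →₀ ℕ) : ℕ := ∑ c, ∑ d, m (zv c d)
/-- First toric charge. -/
def cP (m : Fin 3 × ZMod 2 × ZMod 2 →₀ ℕ) : ℕ :=
  ∑ c, ∑ d, m (xv c d) * c.val + ∑ c, ∑ d, m (yv c d) * c.val
/-- Second toric charge. -/
def cQ (m : Fin 3 × ZMod 2 × ZMod 2 →₀ ℕ) : ℕ :=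
  ∑ c, ∑ d, m (xv c d) * d.val + ∑ c, ∑ d, m (zv c d) * c.val
/-- Third toric charge. -/
def cR (m : Fin 3 × ZMod 2 × ZMod 2 →₀ ℕ) : ℕ :=
  ∑ c, ∑ d, m (yv c d) * d.val + ∑ c, ∑ d, m (zv c d) * d.val

/-- At least two kinds of letters occur. -/
abbrev mx (a b c : ℕ) : Prop := (0 < a ∧ 0 < b) ∨ (0 < a ∧ 0 < c) ∨ (0 < b ∧ 0 < c)

/-- Extra invariant of the monomials in one kind of letters. -/
def cE (m : Fin 3 × ZMod 2 × ZMod 2 →₀ ℕ) : ℕ :=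
  if mx (cA m) (cB m) (cC m) then 0 else m (xv 1 1) + m (yv 1 1) + m (zv 1 1)

theorem val0 : (0 : ZMod 2).val = 0 := rfl
theorem val1 : (1 : ZMod 2).val = 1 := rfl

theorem cA_eq (m) : cA m = m (xv 0 0) + m (xv 0 1) + m (xv 1 0) + m (xv 1 1) := by
  simp [cA, sum2]; ring
theorem cB_eq (m) : cB m = m (yv 0 0) + m (yv 0 1) + m (yv 1 0) + m (yv 1 1) := by
  simp [cB, sum2]; ring
theorem cC_eq (m) : cC m = m (zv 0 0) + m (zv 0 1) + m (zv 1 0) + m (zv 1 1) := by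
  simp [cC, sum2]; ring
theorem cP_eq (m) : cP m = m (xv 1 0) + m (xv 1 1) + m (yv 1 0) + m (yv 1 1) := by
  simp only [cP, sum2, val0, val1]; ring
theorem cQ_eq (m) : cQ m = m (xv 0 1) + m (xv 1 1) + m (zv 1 0) + m (zv 1 1) := by
  simp only [cQ, sum2, val0, val1]; ring
theorem cR_eq (m) : cR m = m (yv 0 1) + m (yv 1 1) + m (zv 0 1) + m (zv 1 1) := by
  simp only [cR, sum2, val0, val1]; ring

theorem prod_all {M : Type*} [CommMonoid M] (f : Fin 3 × ZMod 2 × ZMod 2 → M) :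
    ∏ v, f v = (∏ c, ∏ d, f (xv c d)) * (∏ c, ∏ d, f (yv c d)) * (∏ c, ∏ d, f (zv c d)) := by
  have h11 : (1 + 1 : ZMod 2) = 0 := by decide
  simp only [Fintype.prod_prod_type, Fin.prod_univ_three, prod2, xv, yv, zv, h11, add_zero,
    zero_add]
  ac_rfl

theorem sum_all {M : Type*} [AddCommMonoid M] (f : Fin 3 × ZMod 2 × ZMod 2 → M) :
    ∑ v, f v = (∑ c, ∑ d, f (xv c d)) + (∑ c, ∑ d, f (yv c d)) + (∑ c, ∑ d, f (zv c d)) := by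
  have h11 : (1 + 1 : ZMod 2) = 0 := by decide
  simp only [Fintype.sum_prod_type, Fin.sum_univ_three, sum2, xv, yv, zv, h11, add_zero,
    zero_add]
  ac_rfl

theorem degree_eq (m : Fin 3 × ZMod 2 × ZMod 2 →₀ ℕ) : m.degree = cA m + cB m + cC m := by
  rw [Finsupp.degree_eq_sum, sum_all]; rfl

theorem mk_monomial (m : Fin 3 × ZMod 2 × ZMod 2 →₀ ℕ) :
    Ideal.Quotient.mk I (monomial m 1) = (∏ c, ∏ d, cl (xv c d) ^ m (xv c d))
      * (∏ c, ∏ d, cl (yv c d) ^ m (yv c d)) * (∏ c, ∏ d, cl (zv c d) ^ m (zv c d)) := by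
  rw [monomial_eq, Finsupp.prod_fintype _ _ (by simp), ← prod_all (fun v => cl v ^ m v)]
  simp [cl]

/-- Values of the complete invariant. -/
abbrev T := (_ : ℕ × ℕ) × (_ : ℕ × ℕ) × (ℕ × ℕ × ℕ × ℕ)

/-- The complete invariant of monomials modulo `I`. -/
def inv (m : Fin 3 × ZMod 2 × ZMod 2 →₀ ℕ) : T :=
  ⟨(cA m, cB m + cC m), ⟨(cB m, cC m), (cP m, cQ m, cR m, cE m)⟩⟩

theorem inv_eq_iff (m m') : inv m = inv m' ↔ cA m = cA m' ∧ cB m = cB m' ∧ cC m = cC m' ∧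
    cP m = cP m' ∧ cQ m = cQ m' ∧ cR m = cR m' ∧ cE m = cE m' := by
  constructor
  · intro h
    simp only [inv, Sigma.mk.injEq, Prod.mk.injEq, heq_eq_eq] at h
    tauto
  · rintro ⟨h1, h2, h3, h4, h5, h6, h7⟩
    simp only [inv, h1, h2, h3, h4, h5, h6, h7]

theorem rep_mixed (m m') (hm : mx (cA m) (cB m) (cC m)) (h : inv m = inv m') :
    Ideal.Quotient.mk I (monomial m 1) = Ideal.Quotient.mk I (monomial m' 1) := by
  obtain ⟨hA, hB, hC, hP, hQ, hR, -⟩ := (inv_eq_iff m m').1 h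
  obtain ⟨u1, v1, e1, s1, t1⟩ := slots_exist (fun c d => m (xv c d)) (cA m) rfl
    (fun c d => cl (xv c d))
  obtain ⟨u2, v2, e2, s2, t2⟩ := slots_exist (fun c d => m (yv c d)) (cB m) rfl
    (fun c d => cl (yv c d))
  obtain ⟨u3, v3, e3, s3, t3⟩ := slots_exist (fun c d => m (zv c d)) (cC m) rfl
    (fun c d => cl (zv c d))
  obtain ⟨u1', v1', e1', s1', t1'⟩ := slots_exist (fun c d => m' (xv c d)) (cA m) hA.symm
    (fun c d => cl (xv c d))
  obtain ⟨u2', v2', e2', s2', t2'⟩ := slots_exist (fun c d => m' (yv c d)) (cB m) hB.symm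
    (fun c d => cl (yv c d))
  obtain ⟨u3', v3', e3', s3', t3'⟩ := slots_exist (fun c d => m' (zv c d)) (cC m) hC.symm
    (fun c d => cl (zv c d))
  rw [mk_monomial, mk_monomial, ← e1, ← e2, ← e3, ← e1', ← e2', ← e3']
  have := three_full (α := Fin (cA m)) (β := Fin (cB m)) (γ := Fin (cC m))
    (fun c d => cl (xv c d)) (fun c d => cl (yv c d)) (fun c d => cl (zv c d))
    (fun p p' a b => rel_p p p' a b) (fun q q' a b => rel_q a q q' b)
    (fun r r' a b => rel_r a b r r')
    (by simpa only [← Fin.pos_iff_nonempty] using hm)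
    (Sum.elim u1' u2') (Sum.elim u1 u2) (Sum.elim v1' u3') (Sum.elim v1 u3)
    (Sum.elim v2' v3') (Sum.elim v2 v3)
    (by simpa only [cP, Fintype.sum_sum_type, Sum.elim_inl, Sum.elim_inr, s1, s2, s1', s2'] using hP.symm)
    (by simpa only [cQ, Fintype.sum_sum_type, Sum.elim_inl, Sum.elim_inr, t1, s3, t1', s3'] using hQ.symm)
    (by simpa only [cR, Fintype.sum_sum_type, Sum.elim_inl, Sum.elim_inr, t2, t3, t2', t3'] using hR.symm)
  simpa only [Sum.elim_inl, Sum.elim_inr] using this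

theorem ext_xyz {m m' : Fin 3 × ZMod 2 × ZMod 2 →₀ ℕ}
    (hx : ∀ c d, m (xv c d) = m' (xv c d)) (hy : ∀ c d, m (yv c d) = m' (yv c d))
    (hz : ∀ c d, m (zv c d) = m' (zv c d)) : m = m' := by
  have key : ∀ v, (∃ c d, v = xv c d) ∨ (∃ c d, v = yv c d) ∨ (∃ c d, v = zv c d) := by decide
  ext v
  rcases key v with ⟨c, d, rfl⟩ | ⟨c, d, rfl⟩ | ⟨c, d, rfl⟩
  exacts [hx c d, hy c d, hz c d]

theorem rep_pure (m m') (hm : ¬ mx (cA m) (cB m) (cC m)) (h : inv m = inv m') : m = m' := by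
  obtain ⟨hA, hB, hC, hP, hQ, hR, hE⟩ := (inv_eq_iff m m').1 h
  have hm' : ¬ mx (cA m') (cB m') (cC m') := by rwa [← hA, ← hB, ← hC]
  rw [cE, cE, if_neg hm, if_neg hm'] at hE
  simp only [cA_eq, cB_eq, cC_eq, cP_eq, cQ_eq, cR_eq, mx] at *
  have h3 : (m (yv 0 0) + m (yv 0 1) + m (yv 1 0) + m (yv 1 1) = 0 ∧
      m (zv 0 0) + m (zv 0 1) + m (zv 1 0) + m (zv 1 1) = 0) ∨
      (m (xv 0 0) + m (xv 0 1) + m (xv 1 0) + m (xv 1 1) = 0 ∧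
      m (zv 0 0) + m (zv 0 1) + m (zv 1 0) + m (zv 1 1) = 0) ∨
      (m (xv 0 0) + m (xv 0 1) + m (xv 1 0) + m (xv 1 1) = 0 ∧
      m (yv 0 0) + m (yv 0 1) + m (yv 1 0) + m (yv 1 1) = 0) := by omega
  clear hm hm' h
  rcases h3 with ⟨ha, hb⟩ | ⟨ha, hb⟩ | ⟨ha, hb⟩
  · have ha' := hB.symm.trans ha
    have hb' := hC.symm.trans hb
    simp only [Nat.add_eq_zero_iff] at ha hb ha' hb'
    obtain ⟨⟨⟨a1, a2⟩, a3⟩, a4⟩ := ha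
    obtain ⟨⟨⟨b1, b2⟩, b3⟩, b4⟩ := hb
    obtain ⟨⟨⟨a1', a2'⟩, a3'⟩, a4'⟩ := ha'
    obtain ⟨⟨⟨b1', b2'⟩, b3'⟩, b4'⟩ := hb'
    simp only [a1, a2, a3, a4, b1, b2, b3, b4, a1', a2', a3', a4', b1', b2', b3', b4', add_zero,
      zero_add] at hA hB hC hP hQ hR hE
    apply ext_xyz <;> intro c d <;> rcases z2 c with rfl | rfl <;> rcases z2 d with rfl | rfl <;> omega
  · have ha' := hA.symm.trans ha
    have hb' := hC.symm.trans hb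
    simp only [Nat.add_eq_zero_iff] at ha hb ha' hb'
    obtain ⟨⟨⟨a1, a2⟩, a3⟩, a4⟩ := ha
    obtain ⟨⟨⟨b1, b2⟩, b3⟩, b4⟩ := hb
    obtain ⟨⟨⟨a1', a2'⟩, a3'⟩, a4'⟩ := ha'
    obtain ⟨⟨⟨b1', b2'⟩, b3'⟩, b4'⟩ := hb'
    simp only [a1, a2, a3, a4, b1, b2, b3, b4, a1', a2', a3', a4', b1', b2', b3', b4', add_zero,
      zero_add] at hA hB hC hP hQ hR hE
    apply ext_xyz <;> intro c d <;> rcases z2 c with rfl | rfl <;> rcases z2 d with rfl | rfl <;> omega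
  · have ha' := hA.symm.trans ha
    have hb' := hB.symm.trans hb
    simp only [Nat.add_eq_zero_iff] at ha hb ha' hb'
    obtain ⟨⟨⟨a1, a2⟩, a3⟩, a4⟩ := ha
    obtain ⟨⟨⟨b1, b2⟩, b3⟩, b4⟩ := hb
    obtain ⟨⟨⟨a1', a2'⟩, a3'⟩, a4'⟩ := ha'
    obtain ⟨⟨⟨b1', b2'⟩, b3'⟩, b4'⟩ := hb'
    simp only [a1, a2, a3, a4, b1, b2, b3, b4, a1', a2', a3', a4', b1', b2', b3', b4', add_zero,
      zero_add] at hA hB hC hP hQ hR hE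
    apply ext_xyz <;> intro c d <;> rcases z2 c with rfl | rfl <;> rcases z2 d with rfl | rfl <;> omega

theorem rep_all (m m') (h : inv m = inv m') : monomial m (1 : ℂ) - monomial m' 1 ∈ I := by
  by_cases hm : mx (cA m) (cB m) (cC m)
  · exact Ideal.Quotient.eq.1 (rep_mixed m m' hm h)
  · rw [rep_pure m m' hm h, sub_self]; exact I.zero_mem

theorem ker_aux (L : MvPolynomial (Fin 3 × ZMod 2 × ZMod 2) ℂ →ₗ[ℂ] (T →₀ ℂ))
    (hL : ∀ m, L (monomial m 1) = Finsupp.single (inv m) 1) (u v u' v' : Fin 3 × ZMod 2 × ZMod 2)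
    (h : ∀ m, inv (m + Finsupp.single u 1 + Finsupp.single v 1)
      = inv (m + Finsupp.single u' 1 + Finsupp.single v' 1))
    (c : MvPolynomial (Fin 3 × ZMod 2 × ZMod 2) ℂ) : L (c * (X u * X v - X u' * X v')) = 0 := by
  have : L ∘ₗ LinearMap.mulRight ℂ (X u * X v - X u' * X v') = 0 := by
    apply (basisMonomials _ ℂ).ext
    intro m
    have e : ∀ u v, monomial m (1 : ℂ) * (X u * X v)
        = monomial (m + Finsupp.single u 1 + Finsupp.single v 1) 1 := by
      intro u v
      rw [X, X, monomial_mul, monomial_mul, add_assoc]; simp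
    simp only [coe_basisMonomials, LinearMap.comp_apply, LinearMap.mulRight_apply, mul_sub, e,
      map_sub, hL, h, sub_self, LinearMap.zero_apply]
  exact LinearMap.congr_fun this c

theorem inv_eq_of_mixed (m m') (hm : mx (cA m) (cB m) (cC m)) (hA : cA m = cA m')
    (hB : cB m = cB m') (hC : cC m = cC m') (hP : cP m = cP m') (hQ : cQ m = cQ m')
    (hR : cR m = cR m') : inv m = inv m' := by
  refine (inv_eq_iff m m').2 ⟨hA, hB, hC, hP, hQ, hR, ?_⟩
  have hm' : mx (cA m') (cB m') (cC m') := by rwa [← hA, ← hB, ← hC]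
  rw [cE, cE, if_pos hm, if_pos hm']

theorem inv_genX (i j : ZMod 2) (m) :
    inv (m + Finsupp.single (1, i + 1, j) 1 + Finsupp.single (2, i + 1, j + 1) 1)
      = inv (m + Finsupp.single (1, i, j + 1) 1 + Finsupp.single (2, i + 1, j) 1) := by
  have h11 : (1 + 1 : ZMod 2) = 0 := by decide
  apply inv_eq_of_mixed <;> simp only [cA_eq, cB_eq, cC_eq, cP_eq, cQ_eq, cR_eq, mx, xv, yv, zv] <;>
  rcases z2 i with rfl | rfl <;> rcases z2 j with rfl | rfl <;>
  simp [h11] <;> omega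

theorem inv_genY (i j : ZMod 2) (m) :
    inv (m + Finsupp.single (0, i + 1, j) 1 + Finsupp.single (2, i, j + 1) 1)
      = inv (m + Finsupp.single (0, i, j + 1) 1 + Finsupp.single (2, i + 1, j + 1) 1) := by
  have h11 : (1 + 1 : ZMod 2) = 0 := by decide
  apply inv_eq_of_mixed <;> simp only [cA_eq, cB_eq, cC_eq, cP_eq, cQ_eq, cR_eq, mx, xv, yv, zv] <;>
  rcases z2 i with rfl | rfl <;> rcases z2 j with rfl | rfl <;>
  simp [h11] <;> omega

theorem inv_genZ (i j : ZMod 2) (m) :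
    inv (m + Finsupp.single (0, i + 1, j + 1) 1 + Finsupp.single (1, i, j + 1) 1)
      = inv (m + Finsupp.single (0, i + 1, j) 1 + Finsupp.single (1, i + 1, j + 1) 1) := by
  have h11 : (1 + 1 : ZMod 2) = 0 := by decide
  apply inv_eq_of_mixed <;> simp only [cA_eq, cB_eq, cC_eq, cP_eq, cQ_eq, cR_eq, mx, xv, yv, zv] <;>
  rcases z2 i with rfl | rfl <;> rcases z2 j with rfl | rfl <;>
  simp [h11] <;> omega

theorem ker_all (f : MvPolynomial (Fin 3 × ZMod 2 × ZMod 2) ℂ) (hf : f ∈ I) :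
    (basisMonomials (Fin 3 × ZMod 2 × ZMod 2) ℂ).constr ℂ
      (fun m => (Finsupp.single (inv m) 1 : T →₀ ℂ)) f = 0 := by
  set L := (basisMonomials (Fin 3 × ZMod 2 × ZMod 2) ℂ).constr ℂ
    (fun m => (Finsupp.single (inv m) 1 : T →₀ ℂ)) with hL
  have hLm : ∀ m, L (monomial m 1) = Finsupp.single (inv m) 1 := by
    intro m
    have := (basisMonomials (Fin 3 × ZMod 2 × ZMod 2) ℂ).constr_basis ℂ
      (fun m => (Finsupp.single (inv m) 1 : T →₀ ℂ)) m
    simpa [hL] using this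
  obtain ⟨c, rfl⟩ := (Submodule.mem_span_range_iff_exists_fun _).1 hf
  rw [map_sum]
  refine Finset.sum_eq_zero ?_
  rintro ⟨k, i, j⟩ -
  rw [smul_eq_mul]
  fin_cases k
  · exact (pderivX i j).symm ▸ ker_aux L hLm _ _ _ _ (inv_genX i j) _
  · exact (pderivY i j).symm ▸ ker_aux L hLm _ _ _ _ (inv_genY i j) _
  · exact (pderivZ i j).symm ▸ ker_aux L hLm _ _ _ _ (inv_genZ i j) _

/-- Charges of the monomials of degree `n` in one kind of letters. -/
noncomputable def D (n : ℕ) : Finset (ℕ × ℕ × ℕ) :=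
  (Finset.finsuppAntidiag (Finset.univ : Finset (Fin 4)) n).image
    (fun k => (k 2 + k 3, k 1 + k 3, k 3))

theorem card_D (n : ℕ) : (D n).card = (n + 3).choose 3 := by
  rw [D, Finset.card_image_of_injOn, Finset.card_finsuppAntidiag_nat_eq_choose]
  · simp only [Finset.card_univ, Fintype.card_fin]
    rw [show 4 + n - 1 = n + 3 by omega, Nat.choose_symm_add]
  · intro k hk l hl h
    simp only [Finset.mem_coe, Finset.mem_finsuppAntidiag, Fin.sum_univ_four] at hk hl
    simp only [Prod.mk.injEq] at h
    ext i
    fin_cases i <;> simp <;> omega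

theorem mem_D (n P Q e : ℕ) : (P, Q, e) ∈ D n ↔ e ≤ P ∧ e ≤ Q ∧ P + Q ≤ n + e := by
  simp only [D, Finset.mem_image, Finset.mem_finsuppAntidiag, Fin.sum_univ_four, Prod.mk.injEq]
  constructor
  · rintro ⟨k, hk, h1, h2, h3⟩
    omega
  · rintro ⟨h1, h2, h3⟩
    refine ⟨Finsupp.equivFunOnFinite.symm ![n + e - P - Q, Q - e, P - e, e], ?_⟩
    simp
    omega

/-- The possible charges, given the numbers of letters of each kind. -/
noncomputable def G (a b c : ℕ) : Finset (ℕ × ℕ × ℕ × ℕ) :=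
  if mx a b c then
    Finset.range (a + b + 1) ×ˢ Finset.range (a + c + 1) ×ˢ Finset.range (b + c + 1) ×ˢ {0}
  else if b = 0 ∧ c = 0 then (D a).image (fun t => (t.1, t.2.1, 0, t.2.2))
  else if a = 0 ∧ c = 0 then (D b).image (fun t => (t.1, 0, t.2.1, t.2.2))
  else (D c).image (fun t => (0, t.1, t.2.1, t.2.2))

theorem choose_aux (n : ℕ) : (n + 3).choose 3 = (n + 1) * (n + 1) + (n + 1).choose 3 := by
  rw [Nat.choose_succ_succ' (n + 2) 2, Nat.choose_succ_succ' (n + 1) 2,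
    Nat.choose_succ_succ' (n + 1) 1]
  have : (n + 1).choose 2 * 2 = (n + 1) * n := by
    rw [Nat.choose_two_right, Nat.div_mul_cancel]
    · simp
    · exact (Nat.even_mul_pred_self (n + 1)).two_dvd
  simp only [Nat.choose_one_right]
  nlinarith

theorem card_G (a b c : ℕ) : (G a b c).card = (a + b + 1) * (a + c + 1) * (b + c + 1)
    + ((if b = 0 ∧ c = 0 then (a + 1).choose 3 else 0)
    + (if a = 0 ∧ c = 0 then (b + 1).choose 3 else 0)
    + (if a = 0 ∧ b = 0 then (c + 1).choose 3 else 0)) := by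
  have c1 : (1 : ℕ).choose 3 = 0 := rfl
  unfold G
  split_ifs with h1 h2 h3 h4 h5 h6 h7 h8 h9 h10 h11 h12 <;>
  first
  | (exfalso; simp only [mx] at *; omega)
  | (simp only [Finset.card_product, Finset.card_range, Finset.card_singleton]; ring)
  | (rw [Finset.card_image_of_injective, card_D, choose_aux]
     · simp_all
     · rintro ⟨a, b, c⟩ ⟨a', b', c'⟩ h
       simpa using h)

/-- All values of the invariant in degree `n`. -/
noncomputable def F (n : ℕ) : Finset T :=
  (Finset.HasAntidiagonal.antidiagonal n).sigma fun ak => (Finset.HasAntidiagonal.antidiagonal ak.2).sigma fun bc =>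
    G ak.1 bc.1 bc.2

/-- A `2 × 2` table. -/
def sq (k00 k01 k10 k11 : ℕ) (c d : ZMod 2) : ℕ :=
  if c = 0 then (if d = 0 then k00 else k01) else (if d = 0 then k10 else k11)

/-- A monomial from its exponents. -/
noncomputable def mon (x y z : ZMod 2 → ZMod 2 → ℕ) : Fin 3 × ZMod 2 × ZMod 2 →₀ ℕ :=
  Finsupp.equivFunOnFinite.symm fun v =>
    if v.1 = 0 then x (v.2.1 + v.2.2) v.2.1
    else if v.1 = 1 then y (v.2.1 + v.2.2) v.2.2 else z v.2.1 v.2.2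

theorem mon_x (x y z c d) : mon x y z (xv c d) = x c d := by
  have : d + (c + d) = c := by revert c d; decide
  simp [mon, xv, this]
theorem mon_y (x y z c d) : mon x y z (yv c d) = y c d := by
  have : c + d + d = c := by revert c d; decide
  simp [mon, yv, this]
theorem mon_z (x y z c d) : mon x y z (zv c d) = z c d := by
  simp [mon, zv]

theorem sq00 (a b c d) : sq a b c d 0 0 = a := rfl
theorem sq01 (a b c d) : sq a b c d 0 1 = b := rfl
theorem sq10 (a b c d) : sq a b c d 1 0 = c := rfl
theorem sq11 (a b c d) : sq a b c d 1 1 = d := rfl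

theorem exists_sq (a p q : ℕ) (hp : p ≤ a) (hq : q ≤ a) : ∃ k00 k01 k10 k11 : ℕ,
    k00 + k01 + k10 + k11 = a ∧ k10 + k11 = p ∧ k01 + k11 = q := by
  rcases le_total p q with h | h
  · exact ⟨a - q, q - p, 0, p, by omega, by omega, by omega⟩
  · exact ⟨a - p, 0, p - q, q, by omega, by omega, by omega⟩

theorem exists_split (a b p : ℕ) (h : p ≤ a + b) : ∃ p1 p2, p1 + p2 = p ∧ p1 ≤ a ∧ p2 ≤ b :=
  ⟨min p a, p - min p a, by omega, by omega, by omega⟩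

theorem mem_G_of (m) : (cP m, cQ m, cR m, cE m) ∈ G (cA m) (cB m) (cC m) := by
  unfold G cE
  split_ifs with h1 h2 h3
  · simp only [Finset.mem_product, Finset.mem_range, Finset.mem_singleton, cA_eq, cB_eq, cC_eq,
      cP_eq, cQ_eq, cR_eq, and_true, true_and]
    omega
  · refine Finset.mem_image.2 ⟨(cP m, cQ m, m (xv 1 1) + m (yv 1 1) + m (zv 1 1)), ?_, ?_⟩
    · rw [mem_D]
      simp only [cA_eq, cB_eq, cC_eq, cP_eq, cQ_eq] at *
      omega
    · simp only [cA_eq, cB_eq, cC_eq, cR_eq, Prod.mk.injEq, and_true, true_and] at *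
      omega
  · refine Finset.mem_image.2 ⟨(cP m, cR m, m (xv 1 1) + m (yv 1 1) + m (zv 1 1)), ?_, ?_⟩
    · rw [mem_D]
      simp only [cA_eq, cB_eq, cC_eq, cP_eq, cR_eq] at *
      omega
    · simp only [cA_eq, cB_eq, cC_eq, cQ_eq, Prod.mk.injEq, and_true, true_and] at *
      omega
  · have h4 : cA m = 0 ∧ cB m = 0 := by simp only [mx] at h1; omega
    refine Finset.mem_image.2 ⟨(cQ m, cR m, m (xv 1 1) + m (yv 1 1) + m (zv 1 1)), ?_, ?_⟩
    · rw [mem_D]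
      clear h1 h2 h3
      simp only [cA_eq, cB_eq, cC_eq, cQ_eq, cR_eq] at *
      omega
    · clear h1 h2 h3
      simp only [cA_eq, cB_eq, cC_eq, cP_eq, Prod.mk.injEq, and_true, true_and] at *
      omega

theorem inv_mk (m) (a b c P Q R e : ℕ) (hA : cA m = a) (hB : cB m = b) (hC : cC m = c)
    (hP : cP m = P) (hQ : cQ m = Q) (hR : cR m = R) (hE : cE m = e) :
    inv m = ⟨(a, b + c), ⟨(b, c), (P, Q, R, e)⟩⟩ := by
  subst hA hB hC hP hQ hR hE; rfl

theorem exists_of_mem_G (a b c P Q R e : ℕ) (h : (P, Q, R, e) ∈ G a b c) :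
    ∃ m, inv m = ⟨(a, b + c), ⟨(b, c), (P, Q, R, e)⟩⟩ := by
  unfold G at h
  split_ifs at h with h1 h2 h3
  · simp only [Finset.mem_product, Finset.mem_range, Finset.mem_singleton] at h
    obtain ⟨hP, hQ, hR, he⟩ := h
    obtain ⟨P1, P2, eP, lP1, lP2⟩ := exists_split a b P (by omega)
    obtain ⟨Q1, Q2, eQ, lQ1, lQ2⟩ := exists_split a c Q (by omega)
    obtain ⟨R1, R2, eR, lR1, lR2⟩ := exists_split b c R (by omega)
    obtain ⟨x00, x01, x10, x11, x1, x2, x3⟩ := exists_sq a P1 Q1 lP1 lQ1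
    obtain ⟨y00, y01, y10, y11, y1, y2, y3⟩ := exists_sq b P2 R1 lP2 lR1
    obtain ⟨z00, z01, z10, z11, z1, z2, z3⟩ := exists_sq c Q2 R2 lQ2 lR2
    let m := mon (sq x00 x01 x10 x11) (sq y00 y01 y10 y11) (sq z00 z01 z10 z11)
    have hA : cA m = a := by simp only [m, cA_eq, mon_x, sq00, sq01, sq10, sq11]; omega
    have hB : cB m = b := by simp only [m, cB_eq, mon_y, sq00, sq01, sq10, sq11]; omega
    have hC : cC m = c := by simp only [m, cC_eq, mon_z, sq00, sq01, sq10, sq11]; omega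
    refine ⟨m, inv_mk m a b c P Q R e hA hB hC ?_ ?_ ?_ ?_⟩
    · simp only [m, cP_eq, mon_x, mon_y, mon_z, sq00, sq01, sq10, sq11]; omega
    · simp only [m, cQ_eq, mon_x, mon_y, mon_z, sq00, sq01, sq10, sq11]; omega
    · simp only [m, cR_eq, mon_x, mon_y, mon_z, sq00, sq01, sq10, sq11]; omega
    · rw [cE, hA, hB, hC, if_pos h1, he]
  · obtain ⟨⟨p, q, e'⟩, hD, ht⟩ := Finset.mem_image.1 h
    rw [mem_D] at hD
    simp only [Prod.mk.injEq] at ht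
    let m := mon (sq (a + e - P - Q) (Q - e) (P - e) e) (sq 0 0 0 0) (sq 0 0 0 0)
    have hA : cA m = a := by simp only [m, cA_eq, mon_x, sq00, sq01, sq10, sq11]; omega
    have hB : cB m = b := by simp only [m, cB_eq, mon_y, sq00, sq01, sq10, sq11]; omega
    have hC : cC m = c := by simp only [m, cC_eq, mon_z, sq00, sq01, sq10, sq11]; omega
    refine ⟨m, inv_mk m a b c P Q R e hA hB hC ?_ ?_ ?_ ?_⟩
    · simp only [m, cP_eq, mon_x, mon_y, mon_z, sq00, sq01, sq10, sq11]; omega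
    · simp only [m, cQ_eq, mon_x, mon_y, mon_z, sq00, sq01, sq10, sq11]; omega
    · simp only [m, cR_eq, mon_x, mon_y, mon_z, sq00, sq01, sq10, sq11]; omega
    · rw [cE, hA, hB, hC, if_neg h1]
      simp only [m, mon_x, mon_y, mon_z, sq11]; omega
  · obtain ⟨⟨p, q, e'⟩, hD, ht⟩ := Finset.mem_image.1 h
    rw [mem_D] at hD
    simp only [Prod.mk.injEq] at ht
    let m := mon (sq 0 0 0 0) (sq (b + e - P - R) (R - e) (P - e) e) (sq 0 0 0 0)
    have hA : cA m = a := by simp only [m, cA_eq, mon_x, sq00, sq01, sq10, sq11]; omega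
    have hB : cB m = b := by simp only [m, cB_eq, mon_y, sq00, sq01, sq10, sq11]; omega
    have hC : cC m = c := by simp only [m, cC_eq, mon_z, sq00, sq01, sq10, sq11]; omega
    refine ⟨m, inv_mk m a b c P Q R e hA hB hC ?_ ?_ ?_ ?_⟩
    · simp only [m, cP_eq, mon_x, mon_y, mon_z, sq00, sq01, sq10, sq11]; omega
    · simp only [m, cQ_eq, mon_x, mon_y, mon_z, sq00, sq01, sq10, sq11]; omega
    · simp only [m, cR_eq, mon_x, mon_y, mon_z, sq00, sq01, sq10, sq11]; omega
    · rw [cE, hA, hB, hC, if_neg h1]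
      simp only [m, mon_x, mon_y, mon_z, sq11]; omega
  · obtain ⟨⟨p, q, e'⟩, hD, ht⟩ := Finset.mem_image.1 h
    rw [mem_D] at hD
    simp only [Prod.mk.injEq] at ht
    have h4 : a = 0 ∧ b = 0 := by simp only [mx] at h1; omega
    let m := mon (sq 0 0 0 0) (sq 0 0 0 0) (sq (c + e - Q - R) (R - e) (Q - e) e)
    have hA : cA m = a := by simp only [m, cA_eq, mon_x, sq00, sq01, sq10, sq11]; omega
    have hB : cB m = b := by simp only [m, cB_eq, mon_y, sq00, sq01, sq10, sq11]; omega
    have hC : cC m = c := by simp only [m, cC_eq, mon_z, sq00, sq01, sq10, sq11]; omega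
    refine ⟨m, inv_mk m a b c P Q R e hA hB hC ?_ ?_ ?_ ?_⟩
    · simp only [m, cP_eq, mon_x, mon_y, mon_z, sq00, sq01, sq10, sq11]; omega
    · simp only [m, cQ_eq, mon_x, mon_y, mon_z, sq00, sq01, sq10, sq11]; omega
    · simp only [m, cR_eq, mon_x, mon_y, mon_z, sq00, sq01, sq10, sq11]; omega
    · rw [cE, hA, hB, hC, if_neg h1]
      simp only [m, mon_x, mon_y, mon_z, sq11]; omega

theorem mem_F (n : ℕ) (t : T) : t ∈ F n ↔ ∃ m, m.degree = n ∧ inv m = t := by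
  constructor
  · obtain ⟨⟨a, k⟩, ⟨⟨b, c⟩, ⟨P, Q, R, e⟩⟩⟩ := t
    intro h
    simp only [F, Finset.mem_sigma, Finset.HasAntidiagonal.mem_antidiagonal] at h
    obtain ⟨h1, h2, h3⟩ := h
    subst h2
    obtain ⟨m, hm⟩ := exists_of_mem_G a b c P Q R e h3
    refine ⟨m, ?_, hm⟩
    rw [degree_eq]
    simp only [inv, Sigma.mk.injEq, Prod.mk.injEq, heq_eq_eq] at hm
    omega
  · rintro ⟨m, hm, rfl⟩
    simp only [F, inv, Finset.mem_sigma, Finset.HasAntidiagonal.mem_antidiagonal]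
    refine ⟨?_, trivial, mem_G_of m⟩
    rw [← hm, degree_eq]; ring

theorem h_eq (n : ℕ) : h n = ∑ ak ∈ Finset.HasAntidiagonal.antidiagonal n,
    ∑ bc ∈ Finset.HasAntidiagonal.antidiagonal ak.2, (G ak.1 bc.1 bc.2).card := by
  have := finrank_of_invariant I inv rep_all ker_all n (F n) (mem_F n)
  rw [h, this, F, Finset.card_sigma]
  exact Finset.sum_congr rfl fun ak _ => Finset.card_sigma _ _

theorem inner_sum (k : ℕ) : ∀ x y : ℚ,
    ∑ bc ∈ Finset.HasAntidiagonal.antidiagonal k, (x + (bc.1 : ℚ)) * (y + (bc.2 : ℚ))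
    = (k + 1) * x * y + (x + y) * k * (k + 1) / 2 + (k - 1) * k * (k + 1) / 6 := by
  induction k with
  | zero => intro x y; simp
  | succ k ih =>
    intro x y
    rw [Finset.Nat.sum_antidiagonal_succ]
    have := ih (x + 1) y
    have e : ∀ bc : ℕ × ℕ, (x + ((bc.1 + 1 : ℕ) : ℚ)) * (y + (bc.2 : ℚ))
        = ((x + 1) + (bc.1 : ℚ)) * (y + (bc.2 : ℚ)) := by intro bc; push_cast; ring
    simp only [e, this]
    push_cast
    ring

theorem outer_sum (w : ℚ) (N : ℕ) :
    ∑ k ∈ Finset.range N, ((k : ℚ) + 1) ^ 2 * (w ^ 2 - w * k + k * (k - 1) / 6)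
    = w ^ 2 * (N * (N + 1) * (2 * N + 1) / 6)
      - w * ((N : ℚ) ^ 2 * (N + 1) ^ 2 / 4 - N * (N + 1) * (2 * N + 1) / 6)
      + (N * (N + 1) * (2 * N + 1) * (3 * (N : ℚ) ^ 2 + 3 * N - 1) / 30
        - 3 * ((N : ℚ) ^ 2 * (N + 1) ^ 2 / 4) + 2 * (N * (N + 1) * (2 * N + 1) / 6)) / 6 := by
  induction N with
  | zero => simp
  | succ N ih =>
    rw [Finset.sum_range_succ, ih]
    push_cast
    ring

theorem main_sum (n : ℕ) :
    ∑ ak ∈ Finset.HasAntidiagonal.antidiagonal n,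
      ∑ bc ∈ Finset.HasAntidiagonal.antidiagonal ak.2,
      (((ak.1 + bc.1 + 1) * (ak.1 + bc.2 + 1) * (bc.1 + bc.2 + 1) : ℕ) : ℚ)
    = ∑ k ∈ Finset.range (n + 1),
      ((k : ℚ) + 1) ^ 2 * (((n : ℚ) + 1) ^ 2 - ((n : ℚ) + 1) * k + k * (k - 1) / 6) := by
  rw [← Finset.Nat.sum_antidiagonal_swap, Finset.Nat.sum_antidiagonal_eq_sum_range_succ_mk]
  refine Finset.sum_congr rfl fun k hk => ?_
  have hk' : k ≤ n := by simpa [Nat.lt_succ_iff] using hk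
  have e : ∀ bc ∈ Finset.HasAntidiagonal.antidiagonal k,
      (((n - k + bc.1 + 1) * (n - k + bc.2 + 1) * (bc.1 + bc.2 + 1) : ℕ) : ℚ)
      = ((k : ℚ) + 1) * (((n : ℚ) - k + 1 + (bc.1 : ℚ)) * ((n : ℚ) - k + 1 + (bc.2 : ℚ))) := by
    intro bc hbc
    have hb : bc.1 + bc.2 = k := Finset.HasAntidiagonal.mem_antidiagonal.1 hbc
    rw [hb]
    push_cast [Nat.cast_sub hk']
    ring
  simp only [Prod.swap_prod_mk]
  refine (Finset.sum_congr rfl e).trans ?_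
  rw [← Finset.mul_sum, inner_sum]
  ring

theorem if1 (n : ℕ) : ∑ ak ∈ Finset.HasAntidiagonal.antidiagonal n,
    ∑ bc ∈ Finset.HasAntidiagonal.antidiagonal ak.2,
    (if bc.1 = 0 ∧ bc.2 = 0 then (ak.1 + 1).choose 3 else 0) = (n + 1).choose 3 := by
  rw [Finset.sum_eq_single (n, 0)]
  · simp
  · rintro ⟨a, k⟩ h1 h2
    refine Finset.sum_eq_zero ?_
    rintro ⟨b, c⟩ h3
    simp only [Finset.HasAntidiagonal.mem_antidiagonal, ne_eq, Prod.mk.injEq] at *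
    rw [if_neg (by omega)]
  · intro h; exact absurd (Finset.HasAntidiagonal.mem_antidiagonal.2 (by simp)) h

theorem if2 (n : ℕ) : ∑ ak ∈ Finset.HasAntidiagonal.antidiagonal n,
    ∑ bc ∈ Finset.HasAntidiagonal.antidiagonal ak.2,
    (if ak.1 = 0 ∧ bc.2 = 0 then (bc.1 + 1).choose 3 else 0) = (n + 1).choose 3 := by
  rw [Finset.sum_eq_single (0, n)]
  · rw [Finset.sum_eq_single (n, 0)]
    · simp
    · rintro ⟨b, c⟩ h1 h2
      simp only [Finset.HasAntidiagonal.mem_antidiagonal, ne_eq, Prod.mk.injEq] at *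
      rw [if_neg (by omega)]
    · intro h; exact absurd (Finset.HasAntidiagonal.mem_antidiagonal.2 (by simp)) h
  · rintro ⟨a, k⟩ h1 h2
    refine Finset.sum_eq_zero ?_
    rintro ⟨b, c⟩ h3
    simp only [Finset.HasAntidiagonal.mem_antidiagonal, ne_eq, Prod.mk.injEq] at *
    rw [if_neg (by omega)]
  · intro h; exact absurd (Finset.HasAntidiagonal.mem_antidiagonal.2 (by simp)) h

theorem if3 (n : ℕ) : ∑ ak ∈ Finset.HasAntidiagonal.antidiagonal n,
    ∑ bc ∈ Finset.HasAntidiagonal.antidiagonal ak.2,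
    (if ak.1 = 0 ∧ bc.1 = 0 then (bc.2 + 1).choose 3 else 0) = (n + 1).choose 3 := by
  rw [Finset.sum_eq_single (0, n)]
  · rw [Finset.sum_eq_single (0, n)]
    · simp
    · rintro ⟨b, c⟩ h1 h2
      simp only [Finset.HasAntidiagonal.mem_antidiagonal, ne_eq, Prod.mk.injEq] at *
      rw [if_neg (by omega)]
    · intro h; exact absurd (Finset.HasAntidiagonal.mem_antidiagonal.2 (by simp)) h
  · rintro ⟨a, k⟩ h1 h2
    refine Finset.sum_eq_zero ?_
    rintro ⟨b, c⟩ h3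
    simp only [Finset.HasAntidiagonal.mem_antidiagonal, ne_eq, Prod.mk.injEq] at *
    rw [if_neg (by omega)]
  · intro h; exact absurd (Finset.HasAntidiagonal.mem_antidiagonal.2 (by simp)) h

theorem choose_three (n : ℕ) : ((n + 1).choose 3 : ℚ) = (n + 1) * n * (n - 1) / 6 := by
  induction n with
  | zero => simp [Nat.choose]
  | succ n ih =>
    rw [Nat.choose_succ_succ' (n + 1) 2]
    push_cast
    rw [ih, Nat.cast_choose_two]
    push_cast
    ring

theorem h_closed (n : ℕ) : (h n : ℚ) =
    ((n : ℚ) + 1) ^ 2 * (((n : ℚ) + 1) * ((n : ℚ) + 2) * (2 * n + 3) / 6)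
      - ((n : ℚ) + 1) * (((n : ℚ) + 1) ^ 2 * ((n : ℚ) + 2) ^ 2 / 4
        - ((n : ℚ) + 1) * ((n : ℚ) + 2) * (2 * n + 3) / 6)
      + (((n : ℚ) + 1) * ((n : ℚ) + 2) * (2 * n + 3)
          * (3 * ((n : ℚ) + 1) ^ 2 + 3 * ((n : ℚ) + 1) - 1) / 30
        - 3 * (((n : ℚ) + 1) ^ 2 * ((n : ℚ) + 2) ^ 2 / 4)
        + 2 * (((n : ℚ) + 1) * ((n : ℚ) + 2) * (2 * n + 3) / 6)) / 6
      + 3 * (((n : ℚ) + 1) * n * (n - 1) / 6) := by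
  have key : h n = (∑ ak ∈ Finset.HasAntidiagonal.antidiagonal n,
      ∑ bc ∈ Finset.HasAntidiagonal.antidiagonal ak.2,
      (ak.1 + bc.1 + 1) * (ak.1 + bc.2 + 1) * (bc.1 + bc.2 + 1)) + 3 * (n + 1).choose 3 := by
    rw [h_eq]
    simp only [card_G, Finset.sum_add_distrib, if1, if2, if3]
    ring
  rw [key, Nat.cast_add, Nat.cast_mul, choose_three, Nat.cast_sum]
  simp only [Nat.cast_sum]
  rw [main_sum, outer_sum]
  push_cast
  ring

/-- The Hilbert series of the master space of `ℂ³/(ℤ₂×ℤ₂)`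
satisfies `H(t)·(1−t)⁶ = 1 + 6t + 9t² − 5t³ + 3t⁴`, i.e.
`H(t; F♭) = (1 + 6t + 9t² − 5t³ + 3t⁴)/(1−t)⁶`; in particular the master space has
dimension 6 and degree 14. -/
theorem hilbert_series_C3Z2Z2 :
    (PowerSeries.mk fun n => (h n : ℤ)) * (1 - PowerSeries.X) ^ 6
      = 1 + 6 * PowerSeries.X + 9 * PowerSeries.X ^ 2
        - 5 * PowerSeries.X ^ 3 + 3 * PowerSeries.X ^ 4 := by
  have e6 : ((1 : PowerSeries ℤ) - PowerSeries.X) ^ 6 = PowerSeries.C 1 * PowerSeries.X ^ 0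
      - PowerSeries.C 6 * PowerSeries.X ^ 1 + PowerSeries.C 15 * PowerSeries.X ^ 2
      - PowerSeries.C 20 * PowerSeries.X ^ 3 + PowerSeries.C 15 * PowerSeries.X ^ 4
      - PowerSeries.C 6 * PowerSeries.X ^ 5 + PowerSeries.C 1 * PowerSeries.X ^ 6 := by
    simp only [map_ofNat, map_one]
    ring
  have er : (1 : PowerSeries ℤ) + 6 * PowerSeries.X + 9 * PowerSeries.X ^ 2
        - 5 * PowerSeries.X ^ 3 + 3 * PowerSeries.X ^ 4 = PowerSeries.C 1 * PowerSeries.X ^ 0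
      + PowerSeries.C 6 * PowerSeries.X ^ 1 + PowerSeries.C 9 * PowerSeries.X ^ 2
      - PowerSeries.C 5 * PowerSeries.X ^ 3 + PowerSeries.C 3 * PowerSeries.X ^ 4 := by
    simp only [map_ofNat, map_one]
    ring
  rw [e6, er]
  ext n
  simp only [mul_add, mul_sub, mul_left_comm _ (PowerSeries.C _), map_add, map_sub,
    PowerSeries.coeff_C_mul, PowerSeries.coeff_X_pow]
  simp only [PowerSeries.coeff_mul_X_pow', PowerSeries.coeff_mk]
  rcases n with _ | _ | _ | _ | _ | _ | n
  rotate_right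
  · rw [if_pos (by omega), if_pos (by omega), if_pos (by omega), if_pos (by omega),
      if_pos (by omega), if_pos (by omega), if_pos (by omega), if_neg (by omega),
      if_neg (by omega), if_neg (by omega), if_neg (by omega), if_neg (by omega)]
    have hh : ((h (n + 6) : ℤ) : ℚ) - 6 * (h (n + 5) : ℤ) + 15 * (h (n + 4) : ℤ)
        - 20 * (h (n + 3) : ℤ) + 15 * (h (n + 2) : ℤ) - 6 * (h (n + 1) : ℤ) + (h n : ℤ) = 0 := by
      simp only [Int.cast_natCast, h_closed]
      push_cast
      ring
    have hz : (h (n + 6) : ℤ) - 6 * (h (n + 5) : ℤ) + 15 * (h (n + 4) : ℤ)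
        - 20 * (h (n + 3) : ℤ) + 15 * (h (n + 2) : ℤ) - 6 * (h (n + 1) : ℤ) + (h n : ℤ) = 0 := by
      exact_mod_cast hh
    simp only [show n + 1 + 1 + 1 + 1 + 1 + 1 = n + 6 from rfl, Nat.sub_zero,
      show n + 6 - 1 = n + 5 by omega, show n + 6 - 2 = n + 4 by omega,
      show n + 6 - 3 = n + 3 by omega, show n + 6 - 4 = n + 2 by omega,
      show n + 6 - 5 = n + 1 by omega, show n + 6 - 6 = n by omega]
    linarith
  all_goals
    have h0 : (h 0 : ℤ) = 1 := by have := h_closed 0; norm_num at this; exact_mod_cast this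
    have h1 : (h 1 : ℤ) = 12 := by have := h_closed 1; norm_num at this; exact_mod_cast this
    have h2 : (h 2 : ℤ) = 66 := by have := h_closed 2; norm_num at this; exact_mod_cast this
    have h3 : (h 3 : ℤ) = 231 := by have := h_closed 3; norm_num at this; exact_mod_cast this
    have h4 : (h 4 : ℤ) = 624 := by have := h_closed 4; norm_num at this; exact_mod_cast this
    have h5 : (h 5 : ℤ) = 1425 := by have := h_closed 5; norm_num at this; exact_mod_cast this
    simp [h0, h1, h2, h3, h4, h5]

end C3Z2Z2Hilbert
end

section
/- Let R = ℂ[U₁, U₂, Ũ₁, Ũ₂, V₁, V₂, Y₁, Y₂, Y₃, Z] graded by assigning weight 2 to V₁ and V₂ and weight 1 to the remaining eight variables, and let J ⊆ R be the ideal generated by the nine polynomials Ũ₂Y₁ − U₂Y₃, Ũ₁Y₁ − U₁Y₃, Ũ₂V₁ − Ũ₁V₂, U₂V₁ − U₁V₂, U₂Ũ₁ − U₁Ũ₂, Ũ₂Y₂Z − V₂Y₃, Ũ₁Y₂Z − V₁Y₃, U₂Y₂Z − V₂Y₁, U₁Y₂Z − V₁Y₁ cutting out the coherent component of the dP₁ master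 space. Then the Hilbert series of R/J (with respect to this weighted grading) satisfies (Σ_{n≥0} h(n) tⁿ)·(1−t)⁴(1−t²)² = 1 + 4t + 7t² + 4t³ + t⁴; i.e. H(t; F_irr(dP₁)) = (1 + 4t + 7t² + 4t³ + t⁴)/((1−t)⁶(1+t)²). Note the numerator is palindromic, reflecting that the coherent component is Calabi–Yau. -/
open MvPolynomial

namespace DP1CoherentHilbert

-- R = ℂ[U₁, U₂, Ũ₁, Ũ₂, V₁, V₂, Y₁, Y₂, Y₃, Z]  (Ut denotes Ũ)
noncomputable def U₁ : MvPolynomial (Fin 10) ℂ := X 0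
noncomputable def U₂ : MvPolynomial (Fin 10) ℂ := X 1
noncomputable def Ut₁ : MvPolynomial (Fin 10) ℂ := X 2
noncomputable def Ut₂ : MvPolynomial (Fin 10) ℂ := X 3
noncomputable def V₁ : MvPolynomial (Fin 10) ℂ := X 4
noncomputable def V₂ : MvPolynomial (Fin 10) ℂ := X 5
noncomputable def Y₁ : MvPolynomial (Fin 10) ℂ := X 6
noncomputable def Y₂ : MvPolynomial (Fin 10) ℂ := X 7
noncomputable def Y₃ : MvPolynomial (Fin 10) ℂ := X 8
noncomputable def Z : MvPolynomial (Fin 10) ℂ := X 9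

/-- The grading: weight 2 for `V₁, V₂`, weight 1 for the remaining eight variables. -/
def w : Fin 10 → ℕ := fun i => if i = 4 ∨ i = 5 then 2 else 1

/-- The ideal cutting out the coherent component of the `dP₁` master space,
generated by the nine listed polynomials. -/
noncomputable def J : Ideal (MvPolynomial (Fin 10) ℂ) :=
  Ideal.span
    {Ut₂ * Y₁ - U₂ * Y₃, Ut₁ * Y₁ - U₁ * Y₃,
      Ut₂ * V₁ - Ut₁ * V₂, U₂ * V₁ - U₁ * V₂, U₂ * Ut₁ - U₁ * Ut₂,
      Ut₂ * Y₂ * Z - V₂ * Y₃, Ut₁ * Y₂ * Z - V₁ * Y₃,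
      U₂ * Y₂ * Z - V₂ * Y₁, U₁ * Y₂ * Z - V₁ * Y₁}

/-- The Hilbert function of `R/J` with respect to the weighted grading `w`:
`h(n) = dim_ℂ R_n/(J ∩ R_n)` where `R_n` is the weighted-degree-`n` piece. -/
noncomputable def h (n : ℕ) : ℕ :=
  Module.finrank ℂ
    ((weightedHomogeneousSubmodule ℂ w n).map (Ideal.Quotient.mkₐ ℂ J).toLinearMap)

/-! ### Straightening of monomials -/

/-- In any commutative ring with ten elements satisfying the nine relations, a monomial can be
rewritten as a standard monomial with the same toric multidegree. -/
lemma exists_standard {S : Type*} [CommRing S] (a b c d e f g k l m : S)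
    (r1 : d * g = b * l) (r2 : c * g = a * l) (r3 : d * e = c * f) (r4 : b * e = a * f)
    (r5 : b * c = a * d) (r6 : d * k * m = f * l) (r7 : c * k * m = e * l)
    (r8 : b * k * m = f * g) (r9 : a * k * m = e * g) :
    ∀ N u1 u2 t1 t2 v1 v2 y1 y2 y3 z : ℕ, u2 + t1 + 4 * v1 + v2 + 4 * y1 + y3 < N →
    ∃ u1' u2' t1' t2' v1' v2' y1' y2' y3' z' : ℕ,
      a ^ u1 * b ^ u2 * c ^ t1 * d ^ t2 * e ^ v1 * f ^ v2 * g ^ y1 * k ^ y2 * l ^ y3 * m ^ z =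
      a ^ u1' * b ^ u2' * c ^ t1' * d ^ t2' * e ^ v1' * f ^ v2' * g ^ y1' * k ^ y2' * l ^ y3'
        * m ^ z' ∧
      (u1 + t1 + v1 = u1' + t1' + v1' ∧ u2 + t2 + v2 = u2' + t2' + v2' ∧
      u1 + u2 + y1 = u1' + u2' + y1' ∧ t1 + t2 + y3 = t1' + t2' + y3' ∧
      y1 + y2 + y3 = y1' + y2' + y3' ∧ v1 + v2 + z = v1' + v2' + z') ∧
      ((u2' = 0 ∨ t1' = 0) ∧ (u2' = 0 ∨ v1' = 0) ∧ (t2' = 0 ∨ v1' = 0) ∧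
      (y1' = 0 ∨ t1' = 0) ∧ (y1' = 0 ∨ t2' = 0) ∧ (y1' = 0 ∨ v1' = 0) ∧
      (y1' = 0 ∨ v2' = 0) ∧ (y3' = 0 ∨ v1' = 0) ∧ (y3' = 0 ∨ v2' = 0)) := by
  intro N
  induction N with
  | zero => intros; omega
  | succ N ih =>
    intro u1 u2 t1 t2 v1 v2 y1 y2 y3 z hN
    by_cases h1 : u2 = 0 ∨ t1 = 0
    swap
    · obtain ⟨u2, rfl⟩ : ∃ j, u2 = j + 1 := ⟨u2 - 1, by omega⟩
      obtain ⟨t1, rfl⟩ : ∃ j, t1 = j + 1 := ⟨t1 - 1, by omega⟩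
      obtain ⟨u1', u2', t1', t2', v1', v2', y1', y2', y3', z', hm, hE, hS⟩ :=
        ih (u1 + 1) u2 t1 (t2 + 1) v1 v2 y1 y2 y3 z (by omega)
      refine ⟨u1', u2', t1', t2', v1', v2', y1', y2', y3', z', ?_, by omega, hS⟩
      rw [← hm]
      linear_combination (a ^ u1 * b ^ u2 * c ^ t1 * d ^ t2 * e ^ v1 * f ^ v2 * g ^ y1 * k ^ y2
        * l ^ y3 * m ^ z) * r5
    by_cases h2 : u2 = 0 ∨ v1 = 0
    swap
    · obtain ⟨u2, rfl⟩ : ∃ j, u2 = j + 1 := ⟨u2 - 1, by omega⟩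
      obtain ⟨v1, rfl⟩ : ∃ j, v1 = j + 1 := ⟨v1 - 1, by omega⟩
      obtain ⟨u1', u2', t1', t2', v1', v2', y1', y2', y3', z', hm, hE, hS⟩ :=
        ih (u1 + 1) u2 t1 t2 v1 (v2 + 1) y1 y2 y3 z (by omega)
      refine ⟨u1', u2', t1', t2', v1', v2', y1', y2', y3', z', ?_, by omega, hS⟩
      rw [← hm]
      linear_combination (a ^ u1 * b ^ u2 * c ^ t1 * d ^ t2 * e ^ v1 * f ^ v2 * g ^ y1 * k ^ y2
        * l ^ y3 * m ^ z) * r4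
    by_cases h3 : t2 = 0 ∨ v1 = 0
    swap
    · obtain ⟨t2, rfl⟩ : ∃ j, t2 = j + 1 := ⟨t2 - 1, by omega⟩
      obtain ⟨v1, rfl⟩ : ∃ j, v1 = j + 1 := ⟨v1 - 1, by omega⟩
      obtain ⟨u1', u2', t1', t2', v1', v2', y1', y2', y3', z', hm, hE, hS⟩ :=
        ih u1 u2 (t1 + 1) t2 v1 (v2 + 1) y1 y2 y3 z (by omega)
      refine ⟨u1', u2', t1', t2', v1', v2', y1', y2', y3', z', ?_, by omega, hS⟩
      rw [← hm]
      linear_combination (a ^ u1 * b ^ u2 * c ^ t1 * d ^ t2 * e ^ v1 * f ^ v2 * g ^ y1 * k ^ y2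
        * l ^ y3 * m ^ z) * r3
    by_cases h4 : y1 = 0 ∨ t1 = 0
    swap
    · obtain ⟨y1, rfl⟩ : ∃ j, y1 = j + 1 := ⟨y1 - 1, by omega⟩
      obtain ⟨t1, rfl⟩ : ∃ j, t1 = j + 1 := ⟨t1 - 1, by omega⟩
      obtain ⟨u1', u2', t1', t2', v1', v2', y1', y2', y3', z', hm, hE, hS⟩ :=
        ih (u1 + 1) u2 t1 t2 v1 v2 y1 y2 (y3 + 1) z (by omega)
      refine ⟨u1', u2', t1', t2', v1', v2', y1', y2', y3', z', ?_, by omega, hS⟩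
      rw [← hm]
      linear_combination (a ^ u1 * b ^ u2 * c ^ t1 * d ^ t2 * e ^ v1 * f ^ v2 * g ^ y1 * k ^ y2
        * l ^ y3 * m ^ z) * r2
    by_cases h5 : y1 = 0 ∨ t2 = 0
    swap
    · obtain ⟨y1, rfl⟩ : ∃ j, y1 = j + 1 := ⟨y1 - 1, by omega⟩
      obtain ⟨t2, rfl⟩ : ∃ j, t2 = j + 1 := ⟨t2 - 1, by omega⟩
      obtain ⟨u1', u2', t1', t2', v1', v2', y1', y2', y3', z', hm, hE, hS⟩ :=
        ih u1 (u2 + 1) t1 t2 v1 v2 y1 y2 (y3 + 1) z (by omega)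
      refine ⟨u1', u2', t1', t2', v1', v2', y1', y2', y3', z', ?_, by omega, hS⟩
      rw [← hm]
      linear_combination (a ^ u1 * b ^ u2 * c ^ t1 * d ^ t2 * e ^ v1 * f ^ v2 * g ^ y1 * k ^ y2
        * l ^ y3 * m ^ z) * r1
    by_cases h6 : y1 = 0 ∨ v1 = 0
    swap
    · obtain ⟨y1, rfl⟩ : ∃ j, y1 = j + 1 := ⟨y1 - 1, by omega⟩
      obtain ⟨v1, rfl⟩ : ∃ j, v1 = j + 1 := ⟨v1 - 1, by omega⟩
      obtain ⟨u1', u2', t1', t2', v1', v2', y1', y2', y3', z', hm, hE, hS⟩ :=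
        ih (u1 + 1) u2 t1 t2 v1 v2 y1 (y2 + 1) y3 (z + 1) (by omega)
      refine ⟨u1', u2', t1', t2', v1', v2', y1', y2', y3', z', ?_, by omega, hS⟩
      rw [← hm]
      linear_combination -(a ^ u1 * b ^ u2 * c ^ t1 * d ^ t2 * e ^ v1 * f ^ v2 * g ^ y1 * k ^ y2
        * l ^ y3 * m ^ z) * r9
    by_cases h7 : y1 = 0 ∨ v2 = 0
    swap
    · obtain ⟨y1, rfl⟩ : ∃ j, y1 = j + 1 := ⟨y1 - 1, by omega⟩
      obtain ⟨v2, rfl⟩ : ∃ j, v2 = j + 1 := ⟨v2 - 1, by omega⟩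
      obtain ⟨u1', u2', t1', t2', v1', v2', y1', y2', y3', z', hm, hE, hS⟩ :=
        ih u1 (u2 + 1) t1 t2 v1 v2 y1 (y2 + 1) y3 (z + 1) (by omega)
      refine ⟨u1', u2', t1', t2', v1', v2', y1', y2', y3', z', ?_, by omega, hS⟩
      rw [← hm]
      linear_combination -(a ^ u1 * b ^ u2 * c ^ t1 * d ^ t2 * e ^ v1 * f ^ v2 * g ^ y1 * k ^ y2
        * l ^ y3 * m ^ z) * r8
    by_cases h8 : y3 = 0 ∨ v1 = 0
    swap
    · obtain ⟨y3, rfl⟩ : ∃ j, y3 = j + 1 := ⟨y3 - 1, by omega⟩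
      obtain ⟨v1, rfl⟩ : ∃ j, v1 = j + 1 := ⟨v1 - 1, by omega⟩
      obtain ⟨u1', u2', t1', t2', v1', v2', y1', y2', y3', z', hm, hE, hS⟩ :=
        ih u1 u2 (t1 + 1) t2 v1 v2 y1 (y2 + 1) y3 (z + 1) (by omega)
      refine ⟨u1', u2', t1', t2', v1', v2', y1', y2', y3', z', ?_, by omega, hS⟩
      rw [← hm]
      linear_combination -(a ^ u1 * b ^ u2 * c ^ t1 * d ^ t2 * e ^ v1 * f ^ v2 * g ^ y1 * k ^ y2
        * l ^ y3 * m ^ z) * r7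
    by_cases h9 : y3 = 0 ∨ v2 = 0
    swap
    · obtain ⟨y3, rfl⟩ : ∃ j, y3 = j + 1 := ⟨y3 - 1, by omega⟩
      obtain ⟨v2, rfl⟩ : ∃ j, v2 = j + 1 := ⟨v2 - 1, by omega⟩
      obtain ⟨u1', u2', t1', t2', v1', v2', y1', y2', y3', z', hm, hE, hS⟩ :=
        ih u1 u2 t1 (t2 + 1) v1 v2 y1 (y2 + 1) y3 (z + 1) (by omega)
      refine ⟨u1', u2', t1', t2', v1', v2', y1', y2', y3', z', ?_, by omega, hS⟩
      rw [← hm]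
      linear_combination -(a ^ u1 * b ^ u2 * c ^ t1 * d ^ t2 * e ^ v1 * f ^ v2 * g ^ y1 * k ^ y2
        * l ^ y3 * m ^ z) * r6
    exact ⟨u1, u2, t1, t2, v1, v2, y1, y2, y3, z, rfl, by simp, h1, h2, h3, h4, h5, h6, h7, h8, h9⟩

/-- The standard monomial is given by the north-west corner rule. -/
lemma standard_formula (A1 A2 B1 B2 p q u1 u2 t1 t2 v1 v2 y1 y2 y3 z : ℕ)
    (e1 : u1 + t1 + v1 = A1) (e2 : u2 + t2 + v2 = A2)
    (e3 : u1 + u2 + y1 = B1) (e4 : t1 + t2 + y3 = B2)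
    (e5 : y1 + y2 + y3 = p) (e6 : v1 + v2 + z = q)
    (h : (u2 = 0 ∨ t1 = 0) ∧ (u2 = 0 ∨ v1 = 0) ∧ (t2 = 0 ∨ v1 = 0) ∧
      (y1 = 0 ∨ t1 = 0) ∧ (y1 = 0 ∨ t2 = 0) ∧ (y1 = 0 ∨ v1 = 0) ∧
      (y1 = 0 ∨ v2 = 0) ∧ (y3 = 0 ∨ v1 = 0) ∧ (y3 = 0 ∨ v2 = 0)) :
    u1 = min A1 B1 ∧ t1 = min (A1 - u1) B2 ∧ u2 = min A2 (B1 - u1) ∧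
      t2 = min (A2 - u2) (B2 - t1) := by
  obtain ⟨h1, h2, h3, h4, h5, h6, h7, h8, h9⟩ := h
  refine ⟨?_, ?_, ?_, ?_⟩
  · clear h3 h5 h7 h8 h9; omega
  · clear h5 h7 h9; omega
  · clear h2 h3 h6 h8 h9; omega
  · omega

lemma monomial_congr {S : Type*} [CommRing S] (a b c d e f g k l m : S)
    (r1 : d * g = b * l) (r2 : c * g = a * l) (r3 : d * e = c * f) (r4 : b * e = a * f)
    (r5 : b * c = a * d) (r6 : d * k * m = f * l) (r7 : c * k * m = e * l)
    (r8 : b * k * m = f * g) (r9 : a * k * m = e * g)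
    (u1 u2 t1 t2 v1 v2 y1 y2 y3 z u1' u2' t1' t2' v1' v2' y1' y2' y3' z' : ℕ)
    (hE : u1 + t1 + v1 = u1' + t1' + v1' ∧ u2 + t2 + v2 = u2' + t2' + v2' ∧
      u1 + u2 + y1 = u1' + u2' + y1' ∧ t1 + t2 + y3 = t1' + t2' + y3' ∧
      y1 + y2 + y3 = y1' + y2' + y3' ∧ v1 + v2 + z = v1' + v2' + z') :
    a ^ u1 * b ^ u2 * c ^ t1 * d ^ t2 * e ^ v1 * f ^ v2 * g ^ y1 * k ^ y2 * l ^ y3 * m ^ z =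
      a ^ u1' * b ^ u2' * c ^ t1' * d ^ t2' * e ^ v1' * f ^ v2' * g ^ y1' * k ^ y2' * l ^ y3'
        * m ^ z' := by
  obtain ⟨p1, p2, p3, p4, p5, p6, p7, p8, p9, p10, hp, hpE, hpS⟩ :=
    exists_standard a b c d e f g k l m r1 r2 r3 r4 r5 r6 r7 r8 r9 _
      u1 u2 t1 t2 v1 v2 y1 y2 y3 z (Nat.lt_succ_self _)
  obtain ⟨q1, q2, q3, q4, q5, q6, q7, q8, q9, q10, hq, hqE, hqS⟩ :=
    exists_standard a b c d e f g k l m r1 r2 r3 r4 r5 r6 r7 r8 r9 _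
      u1' u2' t1' t2' v1' v2' y1' y2' y3' z' (Nat.lt_succ_self _)
  rw [hp, hq]
  obtain ⟨E1, E2, E3, E4, E5, E6⟩ := hE
  obtain ⟨F1, F2, F3, F4, F5, F6⟩ := hpE
  obtain ⟨G1, G2, G3, G4, G5, G6⟩ := hqE
  obtain ⟨c1, c2, c3, c4⟩ := standard_formula _ _ _ _ _ _ p1 p2 p3 p4 p5 p6 p7 p8 p9 p10
    F1.symm F2.symm F3.symm F4.symm F5.symm F6.symm hpS
  obtain ⟨d1, d2, d3, d4⟩ := standard_formula _ _ _ _ _ _ q1 q2 q3 q4 q5 q6 q7 q8 q9 q10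
    (G1.symm.trans E1.symm) (G2.symm.trans E2.symm) (G3.symm.trans E3.symm)
    (G4.symm.trans E4.symm) (G5.symm.trans E5.symm) (G6.symm.trans E6.symm) hqS
  obtain rfl : p1 = q1 := by rw [c1, d1]
  obtain rfl : p3 = q3 := by rw [c2, d2]
  obtain rfl : p2 = q2 := by rw [c3, d3]
  obtain rfl : p4 = q4 := by rw [c4, d4]
  clear c1 c2 c3 c4 d1 d2 d3 d4 hpS hqS hp hq
  obtain rfl : p5 = q5 := by omega
  obtain rfl : p6 = q6 := by omega
  obtain rfl : p7 = q7 := by omega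
  obtain rfl : p9 = q9 := by omega
  obtain rfl : p8 = q8 := by omega
  obtain rfl : p10 = q10 := by omega
  rfl

/-! ### The toric parametrisation -/

/-- Images of the ten variables. -/
noncomputable def gen : Fin 10 → MvPolynomial (Fin 6) ℂ :=
  ![X 0 * X 2, X 1 * X 2, X 0 * X 3, X 1 * X 3, X 0 * X 5, X 1 * X 5,
    X 4 * X 2, X 4, X 4 * X 3, X 5]

noncomputable def φ : MvPolynomial (Fin 10) ℂ →ₐ[ℂ] MvPolynomial (Fin 6) ℂ := aeval gen

/-- Toric multidegree. -/
noncomputable def E (d : Fin 10 →₀ ℕ) : Fin 6 →₀ ℕ :=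
  Finsupp.equivFunOnFinite.symm ![d 0 + d 2 + d 4, d 1 + d 3 + d 5, d 0 + d 1 + d 6,
    d 2 + d 3 + d 8, d 6 + d 7 + d 8, d 4 + d 5 + d 9]

lemma prod_ten {S : Type*} [CommRing S] (F : Fin 10 → S) :
    ∏ i, F i = F 0 * F 1 * F 2 * F 3 * F 4 * F 5 * F 6 * F 7 * F 8 * F 9 := by
  simp only [Fin.prod_univ_castSucc, Fin.prod_univ_zero, one_mul]
  rfl

lemma φ_monomial (d : Fin 10 →₀ ℕ) : φ (monomial d 1) = monomial (E d) 1 := by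
  rw [φ, aeval_monomial, monomial_eq, Finsupp.prod_fintype _ _ (by simp),
    Finsupp.prod_fintype _ _ (by simp), prod_ten]
  simp [Fin.prod_univ_succ, E, gen, Fin.succ]
  ring

lemma J_le_ker : ∀ f ∈ J, φ f = 0 := by
  intro f hf
  have : J ≤ RingHom.ker φ.toRingHom := by
    rw [J, Ideal.span_le]
    intro g hg
    simp only [Set.mem_insert_iff, Set.mem_singleton_iff] at hg
    rcases hg with rfl | rfl | rfl | rfl | rfl | rfl | rfl | rfl | rfl <;>
    · simp [RingHom.mem_ker, φ, U₁, U₂, Ut₁, Ut₂, V₁, V₂, Y₁, Y₂, Y₃, Z, gen]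
      ring
  exact this hf

lemma mk_monomial_congr (d d' : Fin 10 →₀ ℕ) (h : E d = E d') :
    Ideal.Quotient.mk J (monomial d 1) = Ideal.Quotient.mk J (monomial d' 1) := by
  have key : ∀ d : Fin 10 →₀ ℕ, Ideal.Quotient.mk J (monomial d 1) =
      ∏ i, (Ideal.Quotient.mk J (X i)) ^ d i := by
    intro d
    rw [monomial_eq, Finsupp.prod_fintype _ _ (by simp)]
    simp
  have rel : ∀ f g : MvPolynomial (Fin 10) ℂ, f - g ∈ J →
      Ideal.Quotient.mk J f = Ideal.Quotient.mk J g := fun f g h => Ideal.Quotient.eq.2 h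
  rw [key, key, prod_ten, prod_ten]
  have hE := fun i => DFunLike.congr_fun h i
  have h0 := hE 0
  have h1 := hE 1
  have h2 := hE 2
  have h3 := hE 3
  have h4 := hE 4
  have h5 := hE 5
  simp [E] at h0 h1 h2 h3 h4 h5
  apply monomial_congr <;> [skip; skip; skip; skip; skip; skip; skip; skip; skip;
    exact ⟨h0, h1, h2, h3, h4, h5⟩] <;>
  · simp only [← map_mul]
    apply rel
    apply Ideal.subset_span
    simp [U₁, U₂, Ut₁, Ut₂, V₁, V₂, Y₁, Y₂, Y₃, Z]

open Classical in
/-- Linear map recovering the class modulo `J` from the toric image. -/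
noncomputable def ψ : MvPolynomial (Fin 6) ℂ →ₗ[ℂ] MvPolynomial (Fin 10) ℂ ⧸ J :=
  (basisMonomials (Fin 6) ℂ).constr ℂ fun c =>
    if hc : ∃ d, E d = c then Ideal.Quotient.mk J (monomial hc.choose 1) else 0

lemma ψ_comp : ψ ∘ₗ φ.toLinearMap = (Ideal.Quotient.mkₐ ℂ J).toLinearMap := by
  apply (basisMonomials (Fin 10) ℂ).ext
  intro d
  have hd : ∃ d', E d' = E d := ⟨d, rfl⟩
  have := (basisMonomials (Fin 6) ℂ).constr_basis ℂ (fun c =>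
    open Classical in
    if hc : ∃ d, E d = c then Ideal.Quotient.mk J (monomial hc.choose 1) else 0) (E d)
  rw [coe_basisMonomials] at this
  simp only [coe_basisMonomials, LinearMap.comp_apply, AlgHom.toLinearMap_apply, φ_monomial]
  rw [ψ, this, dif_pos hd]
  exact mk_monomial_congr _ _ hd.choose_spec

lemma ker_eq (f : MvPolynomial (Fin 10) ℂ) : φ f = 0 ↔ f ∈ J := by
  refine ⟨fun hf => ?_, J_le_ker f⟩
  have := LinearMap.congr_fun ψ_comp f
  simp [hf] at this
  exact Ideal.Quotient.eq_zero_iff_mem.1 this.symm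

lemma h_eq_finrank (n : ℕ) :
    h n = Module.finrank ℂ ((weightedHomogeneousSubmodule ℂ w n).map φ.toLinearMap) := by
  let θ : (MvPolynomial (Fin 10) ℂ ⧸ J) →ₐ[ℂ] MvPolynomial (Fin 6) ℂ :=
    Ideal.Quotient.liftₐ J φ J_le_ker
  have hθ : Function.Injective θ.toLinearMap := by
    rw [← LinearMap.ker_eq_bot, LinearMap.ker_eq_bot']
    intro x hx
    obtain ⟨f, rfl⟩ := Ideal.Quotient.mk_surjective x
    exact Ideal.Quotient.eq_zero_iff_mem.2 ((ker_eq f).1 hx)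
  have hc : φ.toLinearMap = θ.toLinearMap ∘ₗ (Ideal.Quotient.mkₐ ℂ J).toLinearMap := by
    ext; rfl
  rw [hc, Submodule.map_comp, h]
  exact (LinearEquiv.finrank_eq (Submodule.equivMapOfInjective _ hθ _))

/-! ### Counting -/

/-- Index set of the toric monomials of weight `n`. -/
def P (n : ℕ) : Finset (Σ _ : ℕ, Σ _ : ℕ, Σ _ : ℕ, ℕ × ℕ) :=
  (Finset.range (n + 1)).sigma fun N => (Finset.range (N + 1)).sigma fun A =>
    (Finset.Icc (2 * A - N) (A + n - N)).sigma fun B =>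
      Finset.range (A + 1) ×ˢ Finset.range (B + 1)

noncomputable def ex (n : ℕ) (i : Σ _ : ℕ, Σ _ : ℕ, Σ _ : ℕ, ℕ × ℕ) : Fin 6 →₀ ℕ :=
  Finsupp.equivFunOnFinite.symm ![i.2.2.2.1, i.2.1 - i.2.2.2.1, i.2.2.2.2,
    i.2.2.1 - i.2.2.2.2, n - i.1, i.1 - i.2.1]

lemma mem_P (n N A B a b : ℕ) : (⟨N, A, B, a, b⟩ : Σ _ : ℕ, Σ _ : ℕ, Σ _ : ℕ, ℕ × ℕ) ∈ P n ↔
    N ≤ n ∧ A ≤ N ∧ 2 * A - N ≤ B ∧ B ≤ A + n - N ∧ a ≤ A ∧ b ≤ B := by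
  simp [P, and_assoc]

lemma ex_inj (n : ℕ) : Function.Injective (fun i : P n => ex n i) := by
  rintro ⟨⟨N, A, B, a, b⟩, hi⟩ ⟨⟨N', A', B', a', b'⟩, hi'⟩ h
  rw [mem_P] at hi hi'
  have hE := fun i => DFunLike.congr_fun h i
  have h0 := hE 0
  have h1 := hE 1
  have h2 := hE 2
  have h3 := hE 3
  have h4 := hE 4
  have h5 := hE 5
  simp [ex] at h0 h1 h2 h3 h4 h5
  obtain rfl : N = N' := by omega
  obtain rfl : A = A' := by omega
  obtain rfl : B = B' := by omega
  obtain rfl : a = a' := by omega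
  obtain rfl : b = b' := by omega
  rfl

lemma weight_eq (d : Fin 10 →₀ ℕ) : Finsupp.weight w d =
    d 0 + d 1 + d 2 + d 3 + 2 * d 4 + 2 * d 5 + d 6 + d 7 + d 8 + d 9 := by
  rw [Finsupp.weight_apply, Finsupp.sum_fintype _ _ (by simp)]
  simp only [Fin.sum_univ_castSucc, Fin.sum_univ_zero, zero_add]
  change d 0 * 1 + d 1 * 1 + d 2 * 1 + d 3 * 1 + d 4 * 2 + d 5 * 2 + d 6 * 1 + d 7 * 1
    + d 8 * 1 + d 9 * 1 = _
  ring

lemma E_image (n : ℕ) (c : Fin 6 →₀ ℕ) :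
    (∃ d, Finsupp.weight w d = n ∧ E d = c) ↔ ∃ i : P n, ex n i = c := by
  constructor
  · rintro ⟨d, hd, rfl⟩
    rw [weight_eq] at hd
    refine ⟨⟨⟨n - (d 6 + d 7 + d 8), d 0 + d 2 + d 4 + (d 1 + d 3 + d 5),
      d 0 + d 1 + d 6 + (d 2 + d 3 + d 8), d 0 + d 2 + d 4, d 0 + d 1 + d 6⟩, ?_⟩, ?_⟩
    · rw [mem_P]; omega
    · ext i
      fin_cases i <;> simp [ex, E] <;> omega
  · rintro ⟨⟨⟨N, A, B, A1, B1⟩, hi⟩, rfl⟩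
    rw [mem_P] at hi
    obtain ⟨A2, rfl⟩ : ∃ A2, A = A1 + A2 := ⟨A - A1, by omega⟩
    obtain ⟨B2, rfl⟩ : ∃ B2, B = B1 + B2 := ⟨B - B1, by omega⟩
    obtain ⟨p, rfl⟩ : ∃ p, n = N + p := ⟨n - N, by omega⟩
    obtain ⟨q, rfl⟩ : ∃ q, N = A1 + A2 + q := ⟨N - (A1 + A2), by omega⟩
    obtain ⟨u1, hu1⟩ : ∃ u1, u1 = min A1 B1 := ⟨_, rfl⟩
    obtain ⟨t1, ht1⟩ : ∃ t1, t1 = min (A1 - u1) B2 := ⟨_, rfl⟩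
    obtain ⟨u2, hu2⟩ : ∃ u2, u2 = min A2 (B1 - u1) := ⟨_, rfl⟩
    obtain ⟨t2, ht2⟩ : ∃ t2, t2 = min (A2 - u2) (B2 - t1) := ⟨_, rfl⟩
    have k1 : u1 + t1 ≤ A1 := by omega
    have k2 : u2 + t2 ≤ A2 := by omega
    have k3 : u1 + u2 ≤ B1 := by omega
    have k4 : t1 + t2 ≤ B2 := by omega
    have k5 : u1 + u2 + t1 + t2 = A1 + A2 ∨ u1 + u2 + t1 + t2 = B1 + B2 := by omega
    clear hu1 ht1 hu2 ht2
    refine ⟨Finsupp.equivFunOnFinite.symm ![u1, u2, t1, t2, A1 - u1 - t1, A2 - u2 - t2,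
      B1 - u1 - u2, p - (B1 - u1 - u2) - (B2 - t1 - t2), B2 - t1 - t2,
      q - (A1 - u1 - t1) - (A2 - u2 - t2)], ?_, ?_⟩
    · rw [weight_eq]
      simp
      omega
    · ext i
      fin_cases i <;> simp [ex, E] <;> omega

lemma h_eq_card (n : ℕ) : h n = (P n).card := by
  have hli : LinearIndependent ℂ
      (fun i : P n => (monomial (ex n i) 1 : MvPolynomial (Fin 6) ℂ)) := by
    have := (basisMonomials (Fin 6) ℂ).linearIndependent.comp _ (ex_inj n)
    simpa [Function.comp_def] using this
  have hspan : (weightedHomogeneousSubmodule ℂ w n).map φ.toLinearMap =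
      Submodule.span ℂ (Set.range fun i : P n =>
        (monomial (ex n i) 1 : MvPolynomial (Fin 6) ℂ)) := by
    have hW : weightedHomogeneousSubmodule ℂ w n = Submodule.span ℂ
        ((fun d => (monomial d 1 : MvPolynomial (Fin 10) ℂ)) '' {d | Finsupp.weight w d = n}) := by
      rw [weightedHomogeneousSubmodule_eq_finsupp_supported, AddMonoidAlgebra.supported_eq_span_single]
      rfl
    rw [hW, Submodule.map_span]
    congr 1
    ext f
    constructor
    · rintro ⟨_, ⟨d, hd, rfl⟩, rfl⟩
      obtain ⟨i, hi⟩ := (E_image n (E d)).1 ⟨d, hd, rfl⟩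
      refine ⟨i, ?_⟩
      simp only [hi, AlgHom.toLinearMap_apply, φ_monomial]
    · rintro ⟨i, rfl⟩
      obtain ⟨d, hd, hi⟩ := (E_image n (ex n i)).2 ⟨i, rfl⟩
      refine ⟨_, ⟨d, hd, rfl⟩, ?_⟩
      simp only [← hi, AlgHom.toLinearMap_apply, φ_monomial]
  rw [h_eq_finrank, hspan, finrank_span_eq_card hli, Fintype.card_coe]

/-! ### Evaluation of the counting function -/

lemma sum_Icc_aux (lo k : ℕ) : ∑ B ∈ Finset.Icc lo (lo + k), ((B : ℚ) + 1) =
    ((lo + k + 1) * (lo + k + 2) - lo * (lo + 1)) / 2 := by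
  induction k with
  | zero => simp; ring
  | succ k ih =>
    rw [← add_assoc, Finset.sum_Icc_succ_top (by omega), ih]
    push_cast
    ring

/-- The truncated part of the count. -/
def K (N : ℕ) : ℚ := ∑ A ∈ Finset.range (N + 1),
  ((A : ℚ) + 1) * (((2 * A - N : ℕ) : ℚ) * (((2 * A - N : ℕ) : ℚ) + 1) / 2)

lemma K_even_aux (m k : ℕ) : ∑ j ∈ Finset.range k,
    ((m : ℚ) + j + 1) * ((2 * j) * (2 * j + 1) / 2) =
    (-1/6)*k*m + (-1/2)*k^2 + (-1/2)*k^2*m + (2/3)*k^3*m + (1/2)*k^4 := by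
  induction k with
  | zero => simp
  | succ k ih => rw [Finset.sum_range_succ, ih]; push_cast; ring

lemma K_odd_aux (m k : ℕ) : ∑ j ∈ Finset.range k,
    ((m : ℚ) + j + 2) * ((2 * j + 1) * (2 * j + 2) / 2) =
    (-1/3)*k + (-1/6)*k*m + (1/2)*k^2 + (1/2)*k^2*m + (4/3)*k^3 + (2/3)*k^3*m
      + (1/2)*k^4 := by
  induction k with
  | zero => simp
  | succ k ih => rw [Finset.sum_range_succ, ih]; push_cast; ring

lemma K_eq (N : ℕ) : K N = 3/64 + 17/32 * N + 5/6 * N^2 + 7/16 * N^3 + 7/96 * N^4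
    + (-1)^N * (-1/32 * N - 3/64) := by
  obtain ⟨m, rfl | rfl⟩ := Nat.even_or_odd' N
  · have h0 : ∑ A ∈ Finset.range m, ((A : ℚ) + 1) *
        (((2 * A - 2 * m : ℕ) : ℚ) * (((2 * A - 2 * m : ℕ) : ℚ) + 1) / 2) = 0 := by
      apply Finset.sum_eq_zero
      intro A hA
      rw [Finset.mem_range] at hA
      rw [show 2 * A - 2 * m = 0 by omega]
      simp
    rw [K, show 2 * m + 1 = m + (m + 1) by ring, Finset.sum_range_add, h0, zero_add]
    have h1 := K_even_aux m (m + 1)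
    have h2 : ∀ j ∈ Finset.range (m + 1), (((m + j : ℕ) : ℚ) + 1) *
        (((2 * (m + j) - 2 * m : ℕ) : ℚ) * (((2 * (m + j) - 2 * m : ℕ) : ℚ) + 1) / 2) =
        ((m : ℚ) + j + 1) * ((2 * j) * (2 * j + 1) / 2) := by
      intro j _
      rw [show 2 * (m + j) - 2 * m = 2 * j by omega]
      push_cast
      ring
    rw [Finset.sum_congr rfl h2, h1, pow_mul]
    push_cast
    norm_num
    ring
  · have h0 : ∑ A ∈ Finset.range (m + 1), ((A : ℚ) + 1) *
        (((2 * A - (2 * m + 1) : ℕ) : ℚ) * (((2 * A - (2 * m + 1) : ℕ) : ℚ) + 1) / 2) = 0 := by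
      apply Finset.sum_eq_zero
      intro A hA
      rw [Finset.mem_range] at hA
      rw [show 2 * A - (2 * m + 1) = 0 by omega]
      simp
    rw [K, show 2 * m + 1 + 1 = (m + 1) + (m + 1) by ring, Finset.sum_range_add, h0, zero_add]
    have h1 := K_odd_aux m (m + 1)
    have h2 : ∀ j ∈ Finset.range (m + 1), (((m + 1 + j : ℕ) : ℚ) + 1) *
        (((2 * (m + 1 + j) - (2 * m + 1) : ℕ) : ℚ) *
          (((2 * (m + 1 + j) - (2 * m + 1) : ℕ) : ℚ) + 1) / 2) =
        ((m : ℚ) + j + 2) * ((2 * j + 1) * (2 * j + 2) / 2) := by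
      intro j _
      rw [show 2 * (m + 1 + j) - (2 * m + 1) = 2 * j + 1 by omega]
      push_cast
      ring
    rw [Finset.sum_congr rfl h2, h1, pow_succ (-1 : ℚ), pow_mul]
    push_cast
    norm_num
    ring

lemma sum_K (n : ℕ) : ∑ N ∈ Finset.range n, K N = -1/64 - 79/960 * n - 1/24 * n^2 + 1/12 * n^3
    + 7/96 * n^4 + 7/480 * n^5 + (-1)^n * (1/64 * n + 1/64) := by
  induction n with
  | zero => norm_num
  | succ n ih => rw [Finset.sum_range_succ, ih, K_eq]; push_cast; ring

lemma C_aux (p : ℚ) (k : ℕ) : ∑ A ∈ Finset.range k,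
    ((A : ℚ) + 1) * ((A + p + 1) * (A + p + 2) / 2) =
    (1/12)*k + (5/12)*k*p + (1/4)*k*p^2 + (3/8)*k^2 + (3/4)*k^2*p + (1/4)*k^2*p^2
      + (5/12)*k^3 + (1/3)*k^3*p + (1/8)*k^4 := by
  induction k with
  | zero => simp
  | succ k ih => rw [Finset.sum_range_succ, ih]; push_cast; ring

lemma D_aux (x : ℚ) (k : ℕ) : ∑ N ∈ Finset.range k, ∑ A ∈ Finset.range (N + 1),
    ((A : ℚ) + 1) * ((A + (x - N) + 1) * (A + (x - N) + 2) / 2) =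
    (9/20)*k + (7/12)*k*x + (1/6)*k*x^2 + (13/24)*k^2 + (19/24)*k^2*x + (1/4)*k^2*x^2
      + (1/24)*k^3 + (1/6)*k^3*x + (1/12)*k^3*x^2 + (-1/24)*k^4 + (-1/24)*k^4*x
      + (1/120)*k^5 := by
  induction k with
  | zero => simp
  | succ k ih => rw [Finset.sum_range_succ, ih, C_aux]; push_cast; ring

lemma h_closed (n : ℕ) : (h n : ℚ) = 31/32 + 827/320 * n + 65/24 * n^2 + 67/48 * n^3
    + 17/48 * n^4 + 17/480 * n^5 + (-1)^n * (1/64 * n + 1/32) := by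
  have h1 : (h n : ℚ) = ∑ N ∈ Finset.range (n + 1), ((∑ A ∈ Finset.range (N + 1),
      ((A : ℚ) + 1) * ((A + (n - N) + 1) * (A + (n - N) + 2) / 2)) - K N) := by
    rw [h_eq_card, P]
    simp only [Finset.card_sigma, Finset.card_product, Finset.card_range]
    push_cast
    refine Finset.sum_congr rfl fun N hN => ?_
    rw [Finset.mem_range] at hN
    rw [K, ← Finset.sum_sub_distrib]
    refine Finset.sum_congr rfl fun A hA => ?_
    rw [Finset.mem_range] at hA
    rw [← Finset.mul_sum]
    obtain ⟨k, hk⟩ : ∃ k, A + n - N = (2 * A - N) + k := ⟨A + n - N - (2 * A - N), by omega⟩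
    have hk' : (A : ℚ) + (n - N) = ((2 * A - N : ℕ) : ℚ) + k := by
      have : A + n = (2 * A - N) + k + N := by omega
      have : ((A + n : ℕ) : ℚ) = (((2 * A - N) + k + N : ℕ) : ℚ) := by rw [this]
      push_cast at this
      linarith
    rw [hk, sum_Icc_aux, hk']
    ring
  rw [h1, Finset.sum_sub_distrib, D_aux, sum_K]
  push_cast
  ring

lemma h_rec (n : ℕ) : (h (n + 8) : ℤ) - 4 * h (n + 7) + 4 * h (n + 6) + 4 * h (n + 5)
    - 10 * h (n + 4) + 4 * h (n + 3) + 4 * h (n + 2) - 4 * h (n + 1) + h n = 0 := by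
  have : ((h (n + 8) : ℚ) - 4 * h (n + 7) + 4 * h (n + 6) + 4 * h (n + 5)
    - 10 * h (n + 4) + 4 * h (n + 3) + 4 * h (n + 2) - 4 * h (n + 1) + h n) = 0 := by
    simp only [h_closed]
    push_cast
    ring
  exact_mod_cast this

lemma h_values : h 0 = 1 ∧ h 1 = 8 ∧ h 2 = 35 ∧ h 3 = 108 ∧ h 4 = 271 ∧ h 5 = 588 ∧
    h 6 = 1150 ∧ h 7 = 2076 := by
  refine ⟨?_, ?_, ?_, ?_, ?_, ?_, ?_, ?_⟩ <;>
  · rw [← Nat.cast_inj (R := ℚ), h_closed]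
    norm_num

/-- The Hilbert series of the coherent component of the `dP₁`
master space satisfies `H(t)·(1−t)⁴(1−t²)² = 1 + 4t + 7t² + 4t³ + t⁴`, i.e.
`H(t; F_irr(dP₁)) = (1 + 4t + 7t² + 4t³ + t⁴)/((1−t)⁶(1+t)²)`; the numerator is
palindromic, reflecting that the coherent component is Calabi–Yau. -/
theorem hilbert_series_dP1_coherent :
    (PowerSeries.mk fun n => (h n : ℤ))
        * (1 - PowerSeries.X) ^ 4 * (1 - PowerSeries.X ^ 2) ^ 2
      = 1 + 4 * PowerSeries.X + 7 * PowerSeries.X ^ 2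
        + 4 * PowerSeries.X ^ 3 + PowerSeries.X ^ 4 := by
  have hD : ((1 - PowerSeries.X) ^ 4 * (1 - PowerSeries.X ^ 2) ^ 2 : PowerSeries ℤ) =
      1 - PowerSeries.C 4 * PowerSeries.X ^ 1 + PowerSeries.C 4 * PowerSeries.X ^ 2
      + PowerSeries.C 4 * PowerSeries.X ^ 3 - PowerSeries.C 10 * PowerSeries.X ^ 4
      + PowerSeries.C 4 * PowerSeries.X ^ 5 + PowerSeries.C 4 * PowerSeries.X ^ 6
      - PowerSeries.C 4 * PowerSeries.X ^ 7 + PowerSeries.X ^ 8 := by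
    have e4 : (PowerSeries.C 4 : PowerSeries ℤ) = 4 := rfl
    have e10 : (PowerSeries.C 10 : PowerSeries ℤ) = 10 := rfl
    rw [e4, e10]
    ring
  have hN : (1 + 4 * PowerSeries.X + 7 * PowerSeries.X ^ 2
        + 4 * PowerSeries.X ^ 3 + PowerSeries.X ^ 4 : PowerSeries ℤ) =
      PowerSeries.X ^ 0 + PowerSeries.C 4 * PowerSeries.X ^ 1
      + PowerSeries.C 7 * PowerSeries.X ^ 2
      + PowerSeries.C 4 * PowerSeries.X ^ 3 + PowerSeries.X ^ 4 := by
    have e4 : (PowerSeries.C 4 : PowerSeries ℤ) = 4 := rfl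
    have e7 : (PowerSeries.C 7 : PowerSeries ℤ) = 7 := rfl
    rw [e4, e7]
    ring
  rw [mul_assoc, hD, hN]
  ext n
  simp only [mul_add, mul_sub, mul_one, mul_left_comm _ (PowerSeries.C _) _, map_add, map_sub,
    PowerSeries.coeff_C_mul, PowerSeries.coeff_mul_X_pow', PowerSeries.coeff_mk,
    PowerSeries.coeff_X_pow, PowerSeries.coeff_C]
  obtain ⟨h0, h1, h2, h3, h4, h5, h6, h7⟩ := h_values
  by_cases hn : n < 8
  · interval_cases n <;> simp [h0, h1, h2, h3, h4, h5, h6, h7]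
  · obtain ⟨m, rfl⟩ : ∃ m, n = m + 8 := ⟨n - 8, by omega⟩
    have := h_rec m
    simp
    linarith

end DP1CoherentHilbert
end

section
/- Let R = ℂ[X₁₄, X₂₃, X₃₁, X₄₅, X₅₂, X₄₂, Y₂₃, X₃₄, X₅₃, Y₃₁, X₁₅] graded by assigning weight 2 to X₄₂, X₃₄, X₅₃, X₁₅ and weight 1 to X₁₄, X₂₃, X₃₁, X₄₅, X₅₂, Y₂₃, Y₃₁, and let J ⊆ R be the ideal generated by the nine polynomials X₄₅X₅₃ − X₄₂Y₂₃, X₃₄X₄₅ − Y₃₁X₁₅, X₄₂X₂₃X₁₄ − X₅₃X₁₅, X₄₅X₂₃X₁₄ − X₁₅Y₂₃, X₁₅X₃₁X₅₂ − X₃₄X₄₂, X₄₅X₃₁X₅₂ − Y₃₁X₄₂, Y₃₁X₂₃X₁₄ − X₃₄Y₂₃, Y₂₃X₃₁X₅₂ − X₅₃Y₃₁, X₃₁X₅₂X₂₃X₁₄ − X₃₄X₅₃ cutting out the coherent component of the dP₂ master space. Then the Hilbert series of R/J (with respect to this weighted grading) satisfies (Σ_{n≥0} h(n) tⁿ)·(1−t)⁵(1−t²)²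 = 1 + 2t + 5t² + 2t³ + t⁴; i.e. H(t; F_irr(dP₂)) = (1 + 2t + 5t² + 2t³ + t⁴)/((1−t)⁷(1+t)²). Note the numerator is palindromic, reflecting that the coherent component is Calabi–Yau of dimension 7. -/
open MvPolynomial

namespace DP2CoherentHilbert

-- R = ℂ[X₁₄, X₂₃, X₃₁, X₄₅, X₅₂, X₄₂, Y₂₃, X₃₄, X₅₃, Y₃₁, X₁₅]
noncomputable def X₁₄ : MvPolynomial (Fin 11) ℂ := X 0
noncomputable def X₂₃ : MvPolynomial (Fin 11) ℂ := X 1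
noncomputable def X₃₁ : MvPolynomial (Fin 11) ℂ := X 2
noncomputable def X₄₅ : MvPolynomial (Fin 11) ℂ := X 3
noncomputable def X₅₂ : MvPolynomial (Fin 11) ℂ := X 4
noncomputable def X₄₂ : MvPolynomial (Fin 11) ℂ := X 5
noncomputable def Y₂₃ : MvPolynomial (Fin 11) ℂ := X 6
noncomputable def X₃₄ : MvPolynomial (Fin 11) ℂ := X 7
noncomputable def X₅₃ : MvPolynomial (Fin 11) ℂ := X 8
noncomputable def Y₃₁ : MvPolynomial (Fin 11) ℂ := X 9
noncomputable def X₁₅ : MvPolynomial (Fin 11) ℂ := X 10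

/-- The grading: weight 2 for `X₄₂, X₃₄, X₅₃, X₁₅`, weight 1 for
`X₁₄, X₂₃, X₃₁, X₄₅, X₅₂, Y₂₃, Y₃₁`. -/
def w : Fin 11 → ℕ := fun i => if i = 5 ∨ i = 7 ∨ i = 8 ∨ i = 10 then 2 else 1

/-- The ideal cutting out the coherent component of the `dP₂` master space,
generated by the nine listed polynomials. -/
noncomputable def J : Ideal (MvPolynomial (Fin 11) ℂ) :=
  Ideal.span
    {X₄₅ * X₅₃ - X₄₂ * Y₂₃, X₃₄ * X₄₅ - Y₃₁ * X₁₅,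
      X₄₂ * X₂₃ * X₁₄ - X₅₃ * X₁₅, X₄₅ * X₂₃ * X₁₄ - X₁₅ * Y₂₃,
      X₁₅ * X₃₁ * X₅₂ - X₃₄ * X₄₂, X₄₅ * X₃₁ * X₅₂ - Y₃₁ * X₄₂,
      Y₃₁ * X₂₃ * X₁₄ - X₃₄ * Y₂₃, Y₂₃ * X₃₁ * X₅₂ - X₅₃ * Y₃₁,
      X₃₁ * X₅₂ * X₂₃ * X₁₄ - X₃₄ * X₅₃}

/-- The Hilbert function of `R/J` with respect to the weighted grading `w`:
`h(n) = dim_ℂ R_n/(J ∩ R_n)` where `R_n` is the weighted-degree-`n` piece. -/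
noncomputable def h (n : ℕ) : ℕ :=
  Module.finrank ℂ
    ((weightedHomogeneousSubmodule ℂ w n).map (Ideal.Quotient.mkₐ ℂ J).toLinearMap)

/-! ### Generating functions of weighted types -/

/-- `F` is the generating function of `wt : T → ℕ` (whose fibres are finite). -/
def IsGF {T : Type} (wt : T → ℕ) (F : PowerSeries ℤ) : Prop :=
  ∀ n, ∃ s : Finset T, (∀ t, t ∈ s ↔ wt t = n) ∧ (s.card : ℤ) = PowerSeries.coeff n F

/-- The geometric series `1 / (1 - X ^ k)`. -/
def geo (k : ℕ) : PowerSeries ℤ := PowerSeries.mk fun n => if k ∣ n then 1 else 0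

lemma geo_mul (k : ℕ) (hk : 0 < k) : geo k * (1 - PowerSeries.X ^ k) = 1 := by
  ext n
  rw [mul_sub, mul_one, map_sub, PowerSeries.coeff_mul_X_pow', PowerSeries.coeff_one]
  simp only [geo, PowerSeries.coeff_mk]
  by_cases hn : k ≤ n
  · have h0 : n ≠ 0 := by omega
    have : (k ∣ n - k) ↔ k ∣ n := by
      constructor
      · intro hd
        have := Nat.dvd_add hd (dvd_refl k)
        rwa [Nat.sub_add_cancel hn] at this
      · intro hd
        exact Nat.dvd_sub hd (dvd_refl k)
    simp [hn, h0, this]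
  · rcases Nat.eq_zero_or_pos n with h0 | h0
    · subst h0; simp [hk.ne']
    · have : ¬ k ∣ n := fun hd => hn (Nat.le_of_dvd h0 hd)
      simp [hn, h0.ne', this]

lemma isGF_nat (k : ℕ) (hk : 0 < k) : IsGF (fun x : ℕ => k * x) (geo k) := by
  intro n
  by_cases hd : k ∣ n
  · obtain ⟨q, rfl⟩ := hd
    refine ⟨{q}, ?_, by simp [geo]⟩
    intro t
    simp [hk.ne']
  · refine ⟨∅, ?_, by simp [geo, hd]⟩
    intro t
    simp only [Finset.notMem_empty, false_iff]
    rintro rfl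
    exact hd (dvd_mul_right _ _)

lemma IsGF.prod {S T : Type} {f : S → ℕ} {g : T → ℕ} {F G : PowerSeries ℤ}
    (hf : IsGF f F) (hg : IsGF g G) :
    IsGF (fun p : S × T => f p.1 + g p.2) (F * G) := by
  classical
  choose s hs hsc using hf
  choose t ht htc using hg
  intro n
  refine ⟨(Finset.HasAntidiagonal.antidiagonal n).biUnion fun p => s p.1 ×ˢ t p.2, ?_, ?_⟩
  · rintro ⟨x, y⟩
    simp [hs, ht]
  · rw [Finset.card_biUnion, PowerSeries.coeff_mul]
    · push_cast
      refine Finset.sum_congr rfl fun p _ => ?_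
      rw [Finset.card_product, ← hsc, ← htc]; push_cast; rfl
    · intro p _ q _ hpq
      rw [Function.onFun, Finset.disjoint_left]
      rintro ⟨x, y⟩ h1 h2
      simp only [Finset.mem_product, hs, ht] at h1 h2
      exact hpq (Prod.ext (h1.1.symm.trans h2.1) (h1.2.symm.trans h2.2))

lemma IsGF.shift {T : Type} {f : T → ℕ} {F : PowerSeries ℤ} (hf : IsGF f F) (c : ℕ) :
    IsGF (fun t => f t + c) (F * PowerSeries.X ^ c) := by
  intro n
  rw [PowerSeries.coeff_mul_X_pow']
  by_cases hn : c ≤ n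
  · obtain ⟨s, hs, hc⟩ := hf (n - c)
    refine ⟨s, fun t => ?_, by simp [hn, hc]⟩
    rw [hs]; show f t = n - c ↔ f t + c = n; omega
  · exact ⟨∅, fun t => by simp; omega, by simp [hn]⟩

lemma IsGF.sigma {k : ℕ} {T : Type} {f : Fin k → T → ℕ} {F : Fin k → PowerSeries ℤ}
    (hf : ∀ i, IsGF (f i) (F i)) :
    IsGF (fun p : (_ : Fin k) × T => f p.1 p.2) (∑ i, F i) := by
  intro n
  choose s hs hc using fun i => hf i n
  refine ⟨Finset.univ.sigma s, ?_, ?_⟩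
  · rintro ⟨i, t⟩
    simp [hs]
  · rw [Finset.card_sigma, map_sum]
    push_cast
    exact Finset.sum_congr rfl fun i _ => hc i

/-! ### Monomials and their normal forms -/

/-- Exponents of the seven variables `Y₃₁, X₃₄, X₄₂, X₄₅, X₁₅, X₅₃, Y₂₃`, together with
those of `X₁₄, X₂₃, X₃₁, X₅₂`. -/
@[ext] structure Ex where
  a : ℕ
  b : ℕ
  c : ℕ
  e : ℕ
  m : ℕ
  k : ℕ
  f : ℕ
  d : ℕ
  p : ℕ
  l : ℕ
  g : ℕ

/-- Weighted degree. -/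
def Ex.deg (v : Ex) : ℕ :=
  v.a + v.b + v.c + v.e + v.m + v.d + v.g + 2 * (v.k + v.f + v.p + v.l)

/-- The monomial with given exponents. -/
noncomputable def Ex.mon (v : Ex) : MvPolynomial (Fin 11) ℂ :=
  X 0 ^ v.a * X 1 ^ v.b * X 2 ^ v.c * X 3 ^ v.d * X 4 ^ v.e * X 5 ^ v.f * X 6 ^ v.g *
    X 7 ^ v.k * X 8 ^ v.l * X 9 ^ v.m * X 10 ^ v.p

/-- The parameter type of the standard monomials: six cells, each a copy of `ℕ ^ 7`. -/
abbrev T : Type := (_ : Fin 6) × ((ℕ × ℕ) × (ℕ × ℕ)) × (ℕ × (ℕ × ℕ))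

/-- The standard monomials. -/
def std : T → Ex
  | ⟨0, ((a, b), (c, e)), (x, (y, z))⟩ => ⟨a, b, c, e, x, 0, 0, y, z, 0, 0⟩
  | ⟨1, ((a, b), (c, e)), (x, (y, z))⟩ => ⟨a, b, c, e, x, 0, 0, y, 0, 0, z + 1⟩
  | ⟨2, ((a, b), (c, e)), (x, (y, z))⟩ => ⟨a, b, c, e, 0, 0, y + 1, x, z, 0, 0⟩
  | ⟨3, ((a, b), (c, e)), (x, (y, z))⟩ => ⟨a, b, c, e, 0, 0, z + 1, x, 0, 0, y + 1⟩
  | ⟨4, ((a, b), (c, e)), (x, (y, z))⟩ => ⟨a, b, c, e, x, y + 1, 0, 0, z, 0, 0⟩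
  | ⟨5, ((a, b), (c, e)), (x, (y, z))⟩ => ⟨a, b, c, e, 0, 0, y, 0, 0, z + 1, x⟩

/-- Weights in the cells. -/
def cw : Fin 6 → ℕ × ℕ := ![(1, 2), (1, 1), (2, 2), (1, 2), (2, 2), (2, 2)]

/-- Shifts of the cells. -/
def cs : Fin 6 → ℕ := ![0, 1, 2, 3, 2, 2]

lemma std_deg (t : T) : (std t).deg =
    ((1 * t.2.1.1.1 + 1 * t.2.1.1.2) + (1 * t.2.1.2.1 + 1 * t.2.1.2.2)
     + (1 * t.2.2.1 + ((cw t.1).1 * t.2.2.2.1 + (cw t.1).2 * t.2.2.2.2))) + cs t.1 := by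
  obtain ⟨i, ⟨⟨a, b⟩, ⟨c, e⟩⟩, ⟨x, ⟨y, z⟩⟩⟩ := t
  fin_cases i <;> simp [std, Ex.deg, cw, cs] <;> ring

/-- The generating function of the standard monomials. -/
lemma isGF_std : IsGF (fun t => (std t).deg)
    (∑ i : Fin 6, (geo 1 * geo 1 * (geo 1 * geo 1) *
      (geo 1 * (geo (cw i).1 * geo (cw i).2))) * PowerSeries.X ^ cs i) := by
  have hpos : ∀ i, 0 < (cw i).1 ∧ 0 < (cw i).2 := by decide
  have := IsGF.sigma (fun i : Fin 6 =>
    ((((isGF_nat 1 one_pos).prod (isGF_nat 1 one_pos)).prod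
      ((isGF_nat 1 one_pos).prod (isGF_nat 1 one_pos))).prod
      ((isGF_nat 1 one_pos).prod
        ((isGF_nat _ (hpos i).1).prod (isGF_nat _ (hpos i).2)))).shift (cs i))
  simpa only [std_deg] using this

lemma gf_identity : (∑ i : Fin 6, (geo 1 * geo 1 * (geo 1 * geo 1) *
      (geo 1 * (geo (cw i).1 * geo (cw i).2))) * PowerSeries.X ^ cs i)
        * (1 - PowerSeries.X) ^ 5 * (1 - PowerSeries.X ^ 2) ^ 2
      = 1 + 2 * PowerSeries.X + 5 * PowerSeries.X ^ 2
        + 2 * PowerSeries.X ^ 3 + PowerSeries.X ^ 4 := by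
  have h1 := geo_mul 1 one_pos
  have h2 := geo_mul 2 two_pos
  rw [pow_one] at h1
  have h12 : geo 1 = (1 + PowerSeries.X) * geo 2 := by
    linear_combination (geo 1) * (-h2) + (1 + PowerSeries.X) * geo 2 * h1
  simp only [Fin.sum_univ_six, cw, cs, Matrix.cons_val]
  generalize geo 1 = G at *
  generalize geo 2 = H at *
  generalize (PowerSeries.X : PowerSeries ℤ) = x at *
  have e5 : G ^ 5 * (1 - x) ^ 5 = 1 := by rw [← mul_pow, h1, one_pow]
  have e2 : H ^ 2 * (1 - x ^ 2) ^ 2 = 1 := by rw [← mul_pow, h2, one_pow]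
  have key : (G * H + G * G * x + H * H * x ^ 2 + G * H * x ^ 3 + H * H * x ^ 2
      + H * H * x ^ 2) = H ^ 2 * (1 + 2 * x + 5 * x ^ 2 + 2 * x ^ 3 + x ^ 4) := by
    rw [h12]; ring
  calc _ = (G * H + G * G * x + H * H * x ^ 2 + G * H * x ^ 3 + H * H * x ^ 2
      + H * H * x ^ 2) * (1 - x ^ 2) ^ 2 * (G ^ 5 * (1 - x) ^ 5) := by ring
    _ = (H ^ 2 * (1 - x ^ 2) ^ 2) * (1 + 2 * x + 5 * x ^ 2 + 2 * x ^ 3 + x ^ 4) := by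
        rw [e5, key]; ring
    _ = _ := by rw [e2]; ring

/-! ### Every monomial is congruent to a standard one -/

/-- The quotient map. -/
noncomputable abbrev q : MvPolynomial (Fin 11) ℂ →ₐ[ℂ] (MvPolynomial (Fin 11) ℂ ⧸ J) :=
  Ideal.Quotient.mkₐ ℂ J

lemma q_eq {x y : MvPolynomial (Fin 11) ℂ} (hxy : x - y ∈ J) : q x = q y :=
  (Ideal.Quotient.mk_eq_mk_iff_sub_mem x y).2 hxy

/-- Rewriting step bookkeeping: multiply a congruence by a monomial. -/
lemma q_step {x y z u v : MvPolynomial (Fin 11) ℂ} (hxy : q x = q y)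
    (hu : u = z * x) (hv : v = z * y) : q u = q v := by
  rw [hu, hv, map_mul, map_mul, hxy]

lemma normal_form (N : ℕ) : ∀ v : Ex,
    3 * (v.k + v.l) + 2 * (v.m + v.f + v.d + v.p + v.g) ≤ N →
    ∃ t : T, (std t).deg = v.deg ∧ q v.mon = q (std t).mon := by
  have r1 : q (X 3 * X 8) = q (X 5 * X 6) := q_eq (Ideal.subset_span (by
    simp [X₁₄, X₂₃, X₃₁, X₄₅, X₅₂, X₄₂, Y₂₃, X₃₄, X₅₃, Y₃₁, X₁₅]))
  have r2 : q (X 7 * X 3) = q (X 9 * X 10) := q_eq (Ideal.subset_span (by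
    simp [X₁₄, X₂₃, X₃₁, X₄₅, X₅₂, X₄₂, Y₂₃, X₃₄, X₅₃, Y₃₁, X₁₅]))
  have r3 : q (X 5 * X 1 * X 0) = q (X 8 * X 10) := q_eq (Ideal.subset_span (by
    simp [X₁₄, X₂₃, X₃₁, X₄₅, X₅₂, X₄₂, Y₂₃, X₃₄, X₅₃, Y₃₁, X₁₅]))
  have r4 : q (X 3 * X 1 * X 0) = q (X 10 * X 6) := q_eq (Ideal.subset_span (by
    simp [X₁₄, X₂₃, X₃₁, X₄₅, X₅₂, X₄₂, Y₂₃, X₃₄, X₅₃, Y₃₁, X₁₅]))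
  have r5 : q (X 10 * X 2 * X 4) = q (X 7 * X 5) := q_eq (Ideal.subset_span (by
    simp [X₁₄, X₂₃, X₃₁, X₄₅, X₅₂, X₄₂, Y₂₃, X₃₄, X₅₃, Y₃₁, X₁₅]))
  have r6 : q (X 3 * X 2 * X 4) = q (X 9 * X 5) := q_eq (Ideal.subset_span (by
    simp [X₁₄, X₂₃, X₃₁, X₄₅, X₅₂, X₄₂, Y₂₃, X₃₄, X₅₃, Y₃₁, X₁₅]))
  have r7 : q (X 9 * X 1 * X 0) = q (X 7 * X 6) := q_eq (Ideal.subset_span (by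
    simp [X₁₄, X₂₃, X₃₁, X₄₅, X₅₂, X₄₂, Y₂₃, X₃₄, X₅₃, Y₃₁, X₁₅]))
  have r8 : q (X 6 * X 2 * X 4) = q (X 8 * X 9) := q_eq (Ideal.subset_span (by
    simp [X₁₄, X₂₃, X₃₁, X₄₅, X₅₂, X₄₂, Y₂₃, X₃₄, X₅₃, Y₃₁, X₁₅]))
  have r9 : q (X 2 * X 4 * X 1 * X 0) = q (X 7 * X 8) := q_eq (Ideal.subset_span (by
    simp [X₁₄, X₂₃, X₃₁, X₄₅, X₅₂, X₄₂, Y₂₃, X₃₄, X₅₃, Y₃₁, X₁₅]))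
  induction N using Nat.strong_induction_on with
  | _ N ih =>
  rintro ⟨a, b, c, e, m, k, f, d, p, l, g⟩ hN
  have step : ∀ v' : Ex, 3 * (v'.k + v'.l) + 2 * (v'.m + v'.f + v'.d + v'.p + v'.g) < N →
      v'.deg = (Ex.mk a b c e m k f d p l g).deg →
      q (Ex.mk a b c e m k f d p l g).mon = q v'.mon →
      ∃ t : T, (std t).deg = (Ex.mk a b c e m k f d p l g).deg ∧
        q (Ex.mk a b c e m k f d p l g).mon = q (std t).mon := by
    intro v' hlt hd hq
    obtain ⟨t, h1, h2⟩ := ih _ hlt v' le_rfl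
    exact ⟨t, h1.trans hd, hq.trans h2⟩
  simp only at hN
  by_cases c1 : 0 < m ∧ 0 < f
  · obtain ⟨⟨m, rfl⟩, ⟨f, rfl⟩⟩ := c1.imp Nat.exists_eq_add_of_lt Nat.exists_eq_add_of_lt
    exact step ⟨a, b, c + 1, e + 1, m, k, f, d + 1, p, l, g⟩ (by simp only; omega)
      (by simp only [Ex.deg]; ring)
      (q_step (z := (Ex.mk a b c e m k f d p l g).mon) r6.symm
        (by simp only [Ex.mon]; ring) (by simp only [Ex.mon]; ring))
  by_cases c2 : 0 < m ∧ 0 < l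
  · obtain ⟨⟨m, rfl⟩, ⟨l, rfl⟩⟩ := c2.imp Nat.exists_eq_add_of_lt Nat.exists_eq_add_of_lt
    exact step ⟨a, b, c + 1, e + 1, m, k, f, d, p, l, g + 1⟩ (by simp only; omega)
      (by simp only [Ex.deg]; ring)
      (q_step (z := (Ex.mk a b c e m k f d p l g).mon) r8.symm
        (by simp only [Ex.mon]; ring) (by simp only [Ex.mon]; ring))
  by_cases c3 : 0 < k ∧ 0 < f
  · obtain ⟨⟨k, rfl⟩, ⟨f, rfl⟩⟩ := c3.imp Nat.exists_eq_add_of_lt Nat.exists_eq_add_of_lt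
    exact step ⟨a, b, c + 1, e + 1, m, k, f, d, p + 1, l, g⟩ (by simp only; omega)
      (by simp only [Ex.deg]; ring)
      (q_step (z := (Ex.mk a b c e m k f d p l g).mon) r5.symm
        (by simp only [Ex.mon]; ring) (by simp only [Ex.mon]; ring))
  by_cases c4 : 0 < k ∧ 0 < d
  · obtain ⟨⟨k, rfl⟩, ⟨d, rfl⟩⟩ := c4.imp Nat.exists_eq_add_of_lt Nat.exists_eq_add_of_lt
    exact step ⟨a, b, c, e, m + 1, k, f, d, p + 1, l, g⟩ (by simp only; omega)
      (by simp only [Ex.deg]; ring)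
      (q_step (z := (Ex.mk a b c e m k f d p l g).mon) r2
        (by simp only [Ex.mon]; ring) (by simp only [Ex.mon]; ring))
  by_cases c5 : 0 < k ∧ 0 < l
  · obtain ⟨⟨k, rfl⟩, ⟨l, rfl⟩⟩ := c5.imp Nat.exists_eq_add_of_lt Nat.exists_eq_add_of_lt
    exact step ⟨a + 1, b + 1, c + 1, e + 1, m, k, f, d, p, l, g⟩ (by simp only; omega)
      (by simp only [Ex.deg]; ring)
      (q_step (z := (Ex.mk a b c e m k f d p l g).mon) r9.symm
        (by simp only [Ex.mon]; ring) (by simp only [Ex.mon]; ring))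
  by_cases c6 : 0 < k ∧ 0 < g
  · obtain ⟨⟨k, rfl⟩, ⟨g, rfl⟩⟩ := c6.imp Nat.exists_eq_add_of_lt Nat.exists_eq_add_of_lt
    exact step ⟨a + 1, b + 1, c, e, m + 1, k, f, d, p, l, g⟩ (by simp only; omega)
      (by simp only [Ex.deg]; ring)
      (q_step (z := (Ex.mk a b c e m k f d p l g).mon) r7.symm
        (by simp only [Ex.mon]; ring) (by simp only [Ex.mon]; ring))
  by_cases c7 : 0 < d ∧ 0 < l
  · obtain ⟨⟨d, rfl⟩, ⟨l, rfl⟩⟩ := c7.imp Nat.exists_eq_add_of_lt Nat.exists_eq_add_of_lt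
    exact step ⟨a, b, c, e, m, k, f + 1, d, p, l, g + 1⟩ (by simp only; omega)
      (by simp only [Ex.deg]; ring)
      (q_step (z := (Ex.mk a b c e m k f d p l g).mon) r1
        (by simp only [Ex.mon]; ring) (by simp only [Ex.mon]; ring))
  by_cases c8 : 0 < p ∧ 0 < l
  · obtain ⟨⟨p, rfl⟩, ⟨l, rfl⟩⟩ := c8.imp Nat.exists_eq_add_of_lt Nat.exists_eq_add_of_lt
    exact step ⟨a + 1, b + 1, c, e, m, k, f + 1, d, p, l, g⟩ (by simp only; omega)
      (by simp only [Ex.deg]; ring)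
      (q_step (z := (Ex.mk a b c e m k f d p l g).mon) r3.symm
        (by simp only [Ex.mon]; ring) (by simp only [Ex.mon]; ring))
  by_cases c9 : 0 < p ∧ 0 < g
  · obtain ⟨⟨p, rfl⟩, ⟨g, rfl⟩⟩ := c9.imp Nat.exists_eq_add_of_lt Nat.exists_eq_add_of_lt
    exact step ⟨a + 1, b + 1, c, e, m, k, f, d + 1, p, l, g⟩ (by simp only; omega)
      (by simp only [Ex.deg]; ring)
      (q_step (z := (Ex.mk a b c e m k f d p l g).mon) r4.symm
        (by simp only [Ex.mon]; ring) (by simp only [Ex.mon]; ring))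
  -- no forbidden pair: the monomial is standard
  suffices hs : ∃ t : T, std t = ⟨a, b, c, e, m, k, f, d, p, l, g⟩ by
    obtain ⟨t, ht⟩ := hs
    exact ⟨t, by rw [ht], by rw [ht]⟩
  clear step ih hN r1 r2 r3 r4 r5 r6 r7 r8 r9
  by_cases hk : 0 < k
  · exact ⟨⟨4, ((a, b), (c, e)), (m, (k - 1, p))⟩, by
      simp only [std, Ex.mk.injEq, true_and, and_true]; omega⟩
  by_cases hl : 0 < l
  · exact ⟨⟨5, ((a, b), (c, e)), (g, (f, l - 1))⟩, by
      simp only [std, Ex.mk.injEq, true_and, and_true]; omega⟩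
  by_cases hf : 0 < f
  · by_cases hg : 0 < g
    · exact ⟨⟨3, ((a, b), (c, e)), (d, (g - 1, f - 1))⟩, by
      simp only [std, Ex.mk.injEq, true_and, and_true]; omega⟩
    · exact ⟨⟨2, ((a, b), (c, e)), (d, (f - 1, p))⟩, by
      simp only [std, Ex.mk.injEq, true_and, and_true]; omega⟩
  · by_cases hg : 0 < g
    · exact ⟨⟨1, ((a, b), (c, e)), (m, (d, g - 1))⟩, by
      simp only [std, Ex.mk.injEq, true_and, and_true]; omega⟩
    · exact ⟨⟨0, ((a, b), (c, e)), (m, (d, p))⟩, by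
      simp only [std, Ex.mk.injEq, true_and, and_true]; omega⟩

/-! ### Linear independence via the toric parametrization -/

/-- The toric parametrization. -/
noncomputable def φ : MvPolynomial (Fin 11) ℂ →ₐ[ℂ] MvPolynomial (Fin 7) ℂ :=
  aeval ![X 1, X 6, X 2, X 0 * X 4, X 3 * X 5, X 0 * X 5, X 1 * X 4, X 2 * X 3 * X 6,
    X 1 * X 5, X 2 * X 3 * X 4, X 0 * X 6]

lemma φ_J (x : MvPolynomial (Fin 11) ℂ) (hx : x ∈ J) : φ x = 0 := by
  have : J ≤ RingHom.ker φ := by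
    rw [J, Ideal.span_le]
    intro y hy
    simp only [Set.mem_insert_iff, Set.mem_singleton_iff] at hy
    rw [SetLike.mem_coe, RingHom.mem_ker]
    rcases hy with rfl | rfl | rfl | rfl | rfl | rfl | rfl | rfl | rfl <;>
    · simp [φ, X₁₄, X₂₃, X₃₁, X₄₅, X₅₂, X₄₂, Y₂₃, X₃₄, X₅₃, Y₃₁, X₁₅]
      try ring
  exact this hx

/-- Exponent vector of the image of a monomial. -/
noncomputable def Ex.im (v : Ex) : Fin 7 →₀ ℕ :=
  Finsupp.equivFunOnFinite.symm ![v.d + v.f + v.p, v.a + v.g + v.l, v.c + v.m + v.k,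
    v.e + v.m + v.k, v.d + v.g + v.m, v.e + v.f + v.l, v.b + v.p + v.k]

lemma φ_mon (v : Ex) : φ v.mon = monomial v.im 1 := by
  rw [MvPolynomial.monomial_eq, Finsupp.prod_fintype _ _ (by simp)]
  simp [φ, Ex.mon, Ex.im, Fin.prod_univ_succ]
  ring

lemma im_inj : Function.Injective fun t : T => (std t).im := by
  rintro ⟨i, ⟨⟨a, b⟩, ⟨c, e⟩⟩, ⟨x, ⟨y, z⟩⟩⟩ ⟨i', ⟨⟨a', b'⟩, ⟨c', e'⟩⟩, ⟨x', ⟨y', z'⟩⟩⟩ hh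
  have hh' := Finsupp.equivFunOnFinite.symm.injective hh
  have e0 := congrFun hh' 0
  have e1 := congrFun hh' 1
  have e2 := congrFun hh' 2
  have e3 := congrFun hh' 3
  have e4 := congrFun hh' 4
  have e5 := congrFun hh' 5
  have e6 := congrFun hh' 6
  clear hh hh'
  fin_cases i <;> fin_cases i' <;> simp [std] at e0 e1 e2 e3 e4 e5 e6 ⊢ <;> omega

lemma linInd : LinearIndependent ℂ fun t : T => q (std t).mon := by
  have h1 : LinearIndependent ℂ fun t : T => (monomial (std t).im (1 : ℂ)) := by
    have := (basisMonomials (Fin 7) ℂ).linearIndependent.comp _ im_inj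
    simpa [Function.comp_def] using this
  apply LinearIndependent.of_comp (Ideal.Quotient.liftₐ J φ φ_J).toLinearMap
  have h2 : (⇑(Ideal.Quotient.liftₐ J φ φ_J).toLinearMap ∘ fun t : T => q (std t).mon)
      = fun t : T => (monomial (std t).im (1 : ℂ)) := by
    funext t
    rw [← φ_mon]
    rfl
  rw [h2]
  exact h1

/-! ### The graded pieces -/

/-- Exponents from a finitely supported function. -/
def Ex.of (v : Fin 11 →₀ ℕ) : Ex := ⟨v 0, v 1, v 2, v 4, v 9, v 7, v 5, v 3, v 10, v 8, v 6⟩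

lemma mon_of (v : Fin 11 →₀ ℕ) : monomial v (1 : ℂ) = (Ex.of v).mon := by
  rw [MvPolynomial.monomial_eq, Finsupp.prod_fintype _ _ (by simp)]
  simp [Ex.mon, Ex.of, Fin.prod_univ_succ]
  ring_nf

lemma deg_of (v : Fin 11 →₀ ℕ) : Finsupp.weight w v = (Ex.of v).deg := by
  rw [Finsupp.weight_apply, Finsupp.sum_fintype _ _ (by simp)]
  simp [Ex.deg, Ex.of, Fin.sum_univ_succ, w]
  ring_nf

lemma mon_hom (v : Ex) : IsWeightedHomogeneous w v.mon v.deg := by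
  let u : Fin 11 →₀ ℕ := Finsupp.equivFunOnFinite.symm
    ![v.a, v.b, v.c, v.d, v.e, v.f, v.g, v.k, v.l, v.m, v.p]
  have hu : Ex.of u = v := rfl
  rw [← hu, ← mon_of, ← deg_of]
  exact isWeightedHomogeneous_monomial _ _ _ rfl

lemma map_eq_span (n : ℕ) :
    (weightedHomogeneousSubmodule ℂ w n).map (Ideal.Quotient.mkₐ ℂ J).toLinearMap
      = Submodule.span ℂ (Set.range fun t : {t : T // (std t).deg = n} => q (std t.1).mon) := by
  apply le_antisymm
  · rintro _ ⟨x, hx, rfl⟩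
    rw [SetLike.mem_coe, mem_weightedHomogeneousSubmodule] at hx
    rw [x.as_sum, map_sum]
    refine Submodule.sum_mem _ fun v hv => ?_
    have hdeg : Finsupp.weight w v = n := hx (by simpa using hv)
    obtain ⟨t, ht, hq⟩ := normal_form _ (Ex.of v) le_rfl
    have : monomial v (coeff v x) = coeff v x • (Ex.of v).mon := by
      rw [← mon_of, smul_monomial]; simp
    rw [this, map_smul]
    refine Submodule.smul_mem _ _ (Submodule.subset_span ⟨⟨t, ?_⟩, hq.symm⟩)
    rw [ht, ← deg_of, hdeg]
  · rw [Submodule.span_le]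
    rintro _ ⟨⟨t, rfl⟩, rfl⟩
    exact ⟨_, mon_hom _, rfl⟩

lemma h_eq (n : ℕ) : (h n : ℤ) = PowerSeries.coeff n
    (∑ i : Fin 6, (geo 1 * geo 1 * (geo 1 * geo 1) *
      (geo 1 * (geo (cw i).1 * geo (cw i).2))) * PowerSeries.X ^ cs i) := by
  obtain ⟨s, hs, hc⟩ := isGF_std n
  rw [← hc, h, map_eq_span]
  let _ : Fintype {t : T // (std t).deg = n} := Fintype.subtype s hs
  have hf := finrank_span_eq_card (linInd.comp
    (Subtype.val : {t : T // (std t).deg = n} → T) Subtype.val_injective)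
  simp only [Function.comp_def] at hf
  rw [hf, Fintype.card_of_subtype s hs]

/-- The Hilbert series of the coherent component of the `dP₂`
master space satisfies `H(t)·(1−t)⁵(1−t²)² = 1 + 2t + 5t² + 2t³ + t⁴`, i.e.
`H(t; F_irr(dP₂)) = (1 + 2t + 5t² + 2t³ + t⁴)/((1−t)⁷(1+t)²)`; the numerator is
palindromic, reflecting that the coherent component is Calabi–Yau of dimension 7. -/
theorem hilbert_series_dP2_coherent :
    (PowerSeries.mk fun n => (h n : ℤ))
        * (1 - PowerSeries.X) ^ 5 * (1 - PowerSeries.X ^ 2) ^ 2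
      = 1 + 2 * PowerSeries.X + 5 * PowerSeries.X ^ 2
        + 2 * PowerSeries.X ^ 3 + PowerSeries.X ^ 4 := by
  rw [← gf_identity]
  congr 2
  ext n
  rw [PowerSeries.coeff_mk, h_eq]

end DP2CoherentHilbert
end
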